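/- arXiv:1208.6507 — 6 statements merged into one kernel-verified Lean document; each statement's English description precedes it below -/
import Mathlib

section
/- (Radström cancellation) If K, L, M are nonempty compact convex subsets of ℝ^n and the Minkowski sums satisfy K + M = L + M, then K = L. -/
open Pointwise
/-- One inclusion of the cancellation law, by separating a point of `K` from `L`. -/
theorem radstrom_subset {n : ℕ} {K L M : Set (EuclideanSpace ℝ (Fin n))}
    (hLcp : IsCompact L) (hLcv : Convex ℝ L) (hMne : M.Nonempty) (hMcp : IsCompact M)
    (h : K + M ⊆ L + M) : K ⊆ L := by
  intro x hx
  by_contra hxL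
  obtain ⟨f, u, hf, hu⟩ := geometric_hahn_banach_closed_point hLcv hLcp.isClosed hxL
  obtain ⟨m, hm, hmax⟩ := hMcp.exists_isMaxOn hMne f.continuous.continuousOn
  obtain ⟨l, hl, m', hm', he⟩ := Set.mem_add.1 (h (Set.add_mem_add hx hm))
  have h1 := congrArg f he
  rw [map_add, map_add] at h1
  have h2 : f m' ≤ f m := hmax hm'
  have h3 := hf l hl
  linarith

/-- Radström cancellation: if `K`, `L`, `M` are nonempty compact convex subsets of `ℝⁿ` and
the Minkowski sums satisfy `K + M = L + M`, then `K = L`. -/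
theorem radstrom_cancellation (n : ℕ)
    (K L M : Set (EuclideanSpace ℝ (Fin n)))
    (hKne : K.Nonempty) (hKcp : IsCompact K) (hKcv : Convex ℝ K)
    (hLne : L.Nonempty) (hLcp : IsCompact L) (hLcv : Convex ℝ L)
    (hMne : M.Nonempty) (hMcp : IsCompact M) (hMcv : Convex ℝ M)
    (h : K + M = L + M) : K = L := by
  exact Set.Subset.antisymm (radstrom_subset hLcp hLcv hMne hMcp h.subset)
    (radstrom_subset hKcp hKcv hMne hMcp h.symm.subset)
end

section
/- The linear span of the restrictions to the unit sphere of support functions of nonempty compact convex subsets of ℝ^n is dense in C(S^{n-1}); equivalently, the set of functions of the form (h_K − h_L)|_{S^{n-1}}, where K and L range over nonempty compact convex subsets of ℝ^n, is dense in C(S^{n-1}) with the supremum norm. -/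
open RealInnerProductSpace

/-- The support function of a set `K ⊆ ℝⁿ`. -/
noncomputable def suppFn {n : ℕ} (K : Set (EuclideanSpace ℝ (Fin n)))
    (u : EuclideanSpace ℝ (Fin n)) : ℝ :=
  sSup ((fun x => ⟪x, u⟫) '' K)

theorem suppFn_le_iff_aux {n : ℕ} {K : Set (EuclideanSpace ℝ (Fin n))} (hn : K.Nonempty)
    (hK : IsCompact K) (u : EuclideanSpace ℝ (Fin n)) (c : ℝ) :
    suppFn K u ≤ c ↔ ∀ x ∈ K, ⟪x, u⟫ ≤ c := by
  have hb : BddAbove ((fun x => ⟪x, u⟫) '' K) :=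
    (hK.image (by fun_prop)).bddAbove
  rw [suppFn, csSup_le_iff hb (hn.image _)]
  simp

theorem suppFn_eq_aux {n : ℕ} {K : Set (EuclideanSpace ℝ (Fin n))} (hn : K.Nonempty)
    (hK : IsCompact K) (u : EuclideanSpace ℝ (Fin n)) {c : ℝ}
    (h : ∀ d, (∀ x ∈ K, ⟪x, u⟫ ≤ d) ↔ c ≤ d) : suppFn K u = c :=
  eq_of_forall_ge_iff fun d => (suppFn_le_iff_aux hn hK u d).trans (h d)

open Pointwise in
theorem suppFn_add_aux {n : ℕ} {K L : Set (EuclideanSpace ℝ (Fin n))} (hn : K.Nonempty)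
    (hK : IsCompact K) (hn' : L.Nonempty) (hL : IsCompact L) (u : EuclideanSpace ℝ (Fin n)) :
    suppFn (K + L) u = suppFn K u + suppFn L u := by
  refine suppFn_eq_aux (hn.add hn') (hK.add hL) u fun d => ?_
  rw [← le_sub_iff_add_le, suppFn_le_iff_aux hn hK]
  have : ∀ x, ⟪x, u⟫ ≤ d - suppFn L u ↔ ∀ y ∈ L, ⟪x + y, u⟫ ≤ d := by
    intro x
    rw [le_sub_comm, suppFn_le_iff_aux hn' hL]
    refine forall₂_congr fun y _ => ?_
    rw [inner_add_left, le_sub_iff_add_le, add_comm]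
  simp only [this]
  constructor
  · intro h x hx y hy
    exact h _ (Set.add_mem_add hx hy)
  · rintro h _ ⟨x, hx, y, hy, rfl⟩
    exact h x hx y hy

theorem isCompact_closedConvexHull_aux {n : ℕ} {K : Set (EuclideanSpace ℝ (Fin n))}
    (hK : IsCompact K) : IsCompact (closedConvexHull ℝ K) := by
  rw [closedConvexHull_eq_closure_convexHull]
  exact (isBounded_convexHull.2 hK.isBounded).isCompact_closure

theorem suppFn_hull_aux {n : ℕ} {K L : Set (EuclideanSpace ℝ (Fin n))} (hn : K.Nonempty)
    (hK : IsCompact K) (hn' : L.Nonempty) (hL : IsCompact L) (u : EuclideanSpace ℝ (Fin n)) :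
    suppFn (closedConvexHull ℝ (K ∪ L)) u = max (suppFn K u) (suppFn L u) := by
  refine suppFn_eq_aux (hn.inl.mono subset_closedConvexHull)
    (isCompact_closedConvexHull_aux (hK.union hL)) u fun d => ?_
  rw [max_le_iff, suppFn_le_iff_aux hn hK, suppFn_le_iff_aux hn' hL]
  constructor
  · intro h
    exact ⟨fun x hx => h x (subset_closedConvexHull (Or.inl hx)),
      fun x hx => h x (subset_closedConvexHull (Or.inr hx))⟩
  · rintro ⟨h1, h2⟩ x hx
    have hc : Convex ℝ {x : EuclideanSpace ℝ (Fin n) | ⟪x, u⟫ ≤ d} := by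
      intro a ha b hb s t hs ht hst
      simp only [Set.mem_ofPred_eq, inner_add_left, real_inner_smul_left] at *
      have e : d = s * d + t * d := by rw [← add_mul, hst, one_mul]
      rw [e]
      gcongr
    have hcl : IsClosed {x : EuclideanSpace ℝ (Fin n) | ⟪x, u⟫ ≤ d} :=
      isClosed_le (by fun_prop) continuous_const
    exact closedConvexHull_min (Set.union_subset h1 h2) hc hcl hx

theorem suppFn_ball_aux {n : ℕ} (w u : EuclideanSpace ℝ (Fin n)) (hu : ‖u‖ = 1) {r : ℝ}
    (hr : 0 ≤ r) : suppFn (Metric.closedBall w r) u = ⟪w, u⟫ + r := by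
  refine suppFn_eq_aux ⟨w, by simpa⟩ (isCompact_closedBall w r) u fun d => ?_
  constructor
  · intro h
    have := h (w + r • u) (by simp [norm_smul, hu, abs_of_nonneg hr])
    simpa [inner_add_left, real_inner_smul_left, real_inner_self_eq_norm_sq, hu] using this
  · intro h x hx
    have h1 : ⟪x - w, u⟫ ≤ ‖x - w‖ * ‖u‖ := real_inner_le_norm _ _
    rw [mem_closedBall_iff_norm] at hx
    rw [inner_sub_left, hu] at h1
    linarith

/-- The set of differences of support functions of nonempty compact convex subsets of `ℝⁿ`,
restricted to the unit sphere, is dense in `C(Sⁿ⁻¹)`. -/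
theorem dense_suppFn_sub (n : ℕ) :
    Dense {f : C(Metric.sphere (0 : EuclideanSpace ℝ (Fin n)) 1, ℝ) |
      ∃ K L : Set (EuclideanSpace ℝ (Fin n)),
        K.Nonempty ∧ IsCompact K ∧ Convex ℝ K ∧
        L.Nonempty ∧ IsCompact L ∧ Convex ℝ L ∧
        ∀ u : Metric.sphere (0 : EuclideanSpace ℝ (Fin n)) 1,
          f u = suppFn K (u : EuclideanSpace ℝ (Fin n))
              - suppFn L (u : EuclideanSpace ℝ (Fin n))} := by
  rw [dense_iff_closure_eq]
  set A := {f : C(Metric.sphere (0 : EuclideanSpace ℝ (Fin n)) 1, ℝ) |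
      ∃ K L : Set (EuclideanSpace ℝ (Fin n)),
        K.Nonempty ∧ IsCompact K ∧ Convex ℝ K ∧
        L.Nonempty ∧ IsCompact L ∧ Convex ℝ L ∧
        ∀ u : Metric.sphere (0 : EuclideanSpace ℝ (Fin n)) 1,
          f u = suppFn K (u : EuclideanSpace ℝ (Fin n))
              - suppFn L (u : EuclideanSpace ℝ (Fin n))} with hA
  have hneg : ∀ f ∈ A, -f ∈ A := by
    rintro f ⟨K, L, h1, h2, h3, h4, h5, h6, h⟩
    exact ⟨L, K, h4, h5, h6, h1, h2, h3, fun u => by simp [h u]⟩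
  have hsup : ∀ f ∈ A, ∀ g ∈ A, f ⊔ g ∈ A := by
    rintro f ⟨K, L, h1, h2, h3, h4, h5, h6, h⟩ g ⟨K', L', h1', h2', h3', h4', h5', h6', h'⟩
    open Pointwise in
    refine ⟨closedConvexHull ℝ ((K + L') ∪ (K' + L)), L + L', (h1.add h4').inl.mono subset_closedConvexHull,
      isCompact_closedConvexHull_aux ((h2.add h5').union (h2'.add h5)), convex_closedConvexHull, h4.add h4',
      h5.add h5', h6.add h6', fun u => ?_⟩
    rw [suppFn_hull_aux (h1.add h4') (h2.add h5') (h1'.add h4) (h2'.add h5),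
      suppFn_add_aux h1 h2 h4' h5', suppFn_add_aux h1' h2' h4 h5, suppFn_add_aux h4 h5 h4' h5',
      ContinuousMap.sup_apply, h u, h' u, ← max_sub_sub_right]
    congr 1 <;> ring
  have hmem : ∀ (w : EuclideanSpace ℝ (Fin n)) (a : ℝ),
      (⟨fun u => ⟪w, (u : EuclideanSpace ℝ (Fin n))⟫ + a, by fun_prop⟩ :
        C(Metric.sphere (0 : EuclideanSpace ℝ (Fin n)) 1, ℝ)) ∈ A := by
    intro w a
    refine ⟨Metric.closedBall w (max a 0), Metric.closedBall 0 (max (-a) 0), ⟨w, by simp⟩,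
      isCompact_closedBall _ _, convex_closedBall _ _, ⟨0, by simp⟩,
      isCompact_closedBall _ _, convex_closedBall _ _, fun u => ?_⟩
    have hu : ‖(u : EuclideanSpace ℝ (Fin n))‖ = 1 := by simp
    rw [suppFn_ball_aux _ _ hu (le_max_right _ _), suppFn_ball_aux _ _ hu (le_max_right _ _)]
    have : max a 0 - max (-a) 0 = a := by
      rcases le_total a 0 with h | h <;> simp [h]
    simp only [ContinuousMap.coe_mk, inner_zero_left]
    linarith
  refine ContinuousMap.sublattice_closure_eq_top A ⟨_, hmem 0 0⟩ ?_ hsup ?_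
  · intro f hf g hg
    have := hneg _ (hsup _ (hneg f hf) _ (hneg g hg))
    convert this using 1
    ext u
    simp [max_neg_neg]
  · intro v x y
    have hx : ‖(x : EuclideanSpace ℝ (Fin n))‖ = 1 := by simp
    have hy : ‖(y : EuclideanSpace ℝ (Fin n))‖ = 1 := by simp
    set c : ℝ := ⟪(x : EuclideanSpace ℝ (Fin n)), (y : EuclideanSpace ℝ (Fin n))⟫ with hc
    by_cases hxy : x = y
    · subst hxy
      exact ⟨_, hmem 0 (v x), by simp, by simp⟩
    have hc1 : 1 - c ≠ 0 := by
      intro h0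
      apply hxy
      ext1
      exact (inner_eq_one_iff_of_norm_eq_one (𝕜 := ℝ) hx hy).1 (hc ▸ (sub_eq_zero.1 h0).symm)
    refine ⟨_, hmem (((v x - v y) / (2 * (1 - c))) •
      ((x : EuclideanSpace ℝ (Fin n)) - y)) ((v x + v y) / 2), ?_, ?_⟩
    · simp only [ContinuousMap.coe_mk, real_inner_smul_left, inner_sub_left,
        real_inner_self_eq_norm_sq, hx, real_inner_comm (x : EuclideanSpace ℝ (Fin n)) y, ← hc]
      field_simp
      ring
    · simp only [ContinuousMap.coe_mk, real_inner_smul_left, inner_sub_left,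
        real_inner_self_eq_norm_sq, hy, ← hc]
      field_simp
      ring
end

section
/- (Reshetnyak) Let μ and ν be finite Borel measures on the unit sphere S^{n-1} ⊆ ℝ^n such that μ linearly majorizes ν. Then for every sublinear functional p : ℝ^n → ℝ one has ∫_{S^{n-1}} p dμ ≥ ∫_{S^{n-1}} p dν. -/
open MeasureTheory RealInnerProductSpace

/-- A finite Borel measure `μ` on the unit sphere `Sⁿ⁻¹` *linearly majorizes* `ν` if for every
finite decomposition of `Sⁿ⁻¹` into pairwise disjoint Borel sets `U 1, …, U m` there are finite
measures `μ 1, …, μ m` summing to `μ` such that for each `k`, `μ k` and the restriction of `ν`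
to `U k` give the same integral to every linear functional `⟪x, ·⟫` of `ℝⁿ`. -/
def LinearlyMajorizes {n : ℕ}
    (μ ν : Measure (Metric.sphere (0 : EuclideanSpace ℝ (Fin n)) 1)) : Prop :=
  ∀ (m : ℕ) (U : Fin m → Set (Metric.sphere (0 : EuclideanSpace ℝ (Fin n)) 1)),
    (∀ k, MeasurableSet (U k)) → Pairwise (Function.onFun Disjoint U) →
    (⋃ k, U k) = Set.univ →
    ∃ μs : Fin m → Measure (Metric.sphere (0 : EuclideanSpace ℝ (Fin n)) 1),
      (∀ k, IsFiniteMeasure (μs k)) ∧ μ = ∑ k, μs k ∧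
      ∀ (k : Fin m) (x : EuclideanSpace ℝ (Fin n)),
        ∫ z, ⟪x, (z : EuclideanSpace ℝ (Fin n))⟫ ∂(μs k)
          = ∫ z in U k, ⟪x, (z : EuclideanSpace ℝ (Fin n))⟫ ∂ν

/-- Supporting functional of a sublinear functional at a nonzero point. -/
theorem exists_support {n : ℕ} (p : EuclideanSpace ℝ (Fin n) → ℝ)
    (hsub : ∀ x y, p (x + y) ≤ p x + p y)
    (hhom : ∀ (t : ℝ), 0 ≤ t → ∀ x, p (t • x) = t * p x)
    (w : EuclideanSpace ℝ (Fin n)) (hw : w ≠ 0) :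
    ∃ x : EuclideanSpace ℝ (Fin n), ⟪x, w⟫ = p w ∧ ∀ z, ⟪x, z⟫ ≤ p z := by
  have h0 : p 0 = 0 := by simpa using hhom 0 le_rfl 0
  obtain ⟨g, hg1, hg2⟩ := exists_extension_of_le_sublinear
    (LinearPMap.mkSpanSingleton (σ := RingHom.id ℝ) w (p w) hw) p
    (fun c hc x => hhom c hc.le x) hsub (by
      rintro ⟨x, hx⟩
      obtain ⟨c, rfl⟩ := Submodule.mem_span_singleton.1 hx
      rw [LinearPMap.mkSpanSingleton'_apply]
      simp only [RingHom.id_apply, smul_eq_mul]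
      rcases le_total 0 c with hc | hc
      · rw [hhom c hc]
      · have h1 := hhom (-c) (by linarith) w
        have h2 := hsub (c • w) ((-c) • w)
        rw [← add_smul, add_neg_cancel, zero_smul, h0] at h2
        linarith)
  refine ⟨(InnerProductSpace.toDual ℝ _).symm (LinearMap.toContinuousLinearMap g), ?_, ?_⟩
  · rw [InnerProductSpace.toDual_symm_apply]
    have := hg1 ⟨w, Submodule.mem_span_singleton_self w⟩
    rw [LinearPMap.mkSpanSingleton_apply] at this
    simpa using this
  · intro z
    rw [InnerProductSpace.toDual_symm_apply]
    simpa using hg2 z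

/-- Reshetnyak's theorem: if `μ` linearly majorizes `ν` then `∫ p dμ ≥ ∫ p dν` for every
sublinear functional `p` on `ℝⁿ`. -/
theorem reshetnyak (n : ℕ)
    (μ ν : Measure (Metric.sphere (0 : EuclideanSpace ℝ (Fin n)) 1))
    [IsFiniteMeasure μ] [IsFiniteMeasure ν]
    (hmaj : LinearlyMajorizes μ ν)
    (p : EuclideanSpace ℝ (Fin n) → ℝ)
    (hsub : ∀ x y, p (x + y) ≤ p x + p y)
    (hhom : ∀ (t : ℝ), 0 ≤ t → ∀ x, p (t • x) = t * p x) :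
    ∫ z, p (z : EuclideanSpace ℝ (Fin n)) ∂ν ≤ ∫ z, p (z : EuclideanSpace ℝ (Fin n)) ∂μ := by
  have hconv : ConvexOn ℝ Set.univ p := by
    refine ⟨convex_univ, fun x _ y _ a b ha hb _ => ?_⟩
    have := hsub (a • x) (b • y)
    rw [hhom a ha, hhom b hb] at this
    simpa using this
  have hcont : Continuous p := continuousOn_univ.1 (hconv.continuousOn isOpen_univ)
  have hint : ∀ (f : Metric.sphere (0 : EuclideanSpace ℝ (Fin n)) 1 → ℝ), Continuous f →
      ∀ (κ : Measure (Metric.sphere (0 : EuclideanSpace ℝ (Fin n)) 1)) [IsFiniteMeasure κ],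
      Integrable f κ := fun f hf κ _ =>
    hf.integrable_of_hasCompactSupport (HasCompactSupport.of_compactSpace f)
  have hpc : Continuous (fun z : Metric.sphere (0 : EuclideanSpace ℝ (Fin n)) 1 =>
    p (z : EuclideanSpace ℝ (Fin n))) := hcont.comp continuous_subtype_val
  have hlc : ∀ x : EuclideanSpace ℝ (Fin n),
      Continuous (fun z : Metric.sphere (0 : EuclideanSpace ℝ (Fin n)) 1 =>
    ⟪x, (z : EuclideanSpace ℝ (Fin n))⟫) := fun x => by fun_prop
  have key : ∀ ε : ℝ, 0 < ε → ∫ z, p (z : EuclideanSpace ℝ (Fin n)) ∂ν ≤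
      ∫ z, p (z : EuclideanSpace ℝ (Fin n)) ∂μ + ε * ν.real Set.univ := by
    intro ε hε
    have hsupp : ∀ w : Metric.sphere (0 : EuclideanSpace ℝ (Fin n)) 1,
        ∃ x : EuclideanSpace ℝ (Fin n), ⟪x, (w : EuclideanSpace ℝ (Fin n))⟫ = p w ∧
          ∀ z, ⟪x, z⟫ ≤ p z := fun w =>
      exists_support p hsub hhom w (ne_zero_of_mem_unit_sphere w)
    choose x hx1 hx2 using hsupp
    let V : Metric.sphere (0 : EuclideanSpace ℝ (Fin n)) 1 →
        Set (Metric.sphere (0 : EuclideanSpace ℝ (Fin n)) 1) :=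
      fun w => {z | p z < ⟪x w, (z : EuclideanSpace ℝ (Fin n))⟫ + ε}
    have hVo : ∀ w, IsOpen (V w) := fun w => isOpen_lt hpc ((hlc _).add continuous_const)
    obtain ⟨t, -, ht⟩ := isCompact_univ.elim_nhds_subcover V (fun w _ =>
      (hVo w).mem_nhds (by
        change p w < ⟪x w, (w : EuclideanSpace ℝ (Fin n))⟫ + ε
        rw [hx1]; linarith))
    let e := t.equivFin
    let W : Fin t.card → Set (Metric.sphere (0 : EuclideanSpace ℝ (Fin n)) 1) :=
      fun k => V (e.symm k)
    let U := disjointed W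
    have hUm : ∀ k, MeasurableSet (U k) := fun k =>
      disjointedRec (fun s i hs => hs.diff (hVo _).measurableSet) (hVo _).measurableSet
    have hUd : Pairwise (Function.onFun Disjoint U) := disjoint_disjointed W
    have hUu : (⋃ k, U k) = Set.univ := by
      rw [iUnion_disjointed]
      refine Set.eq_univ_of_forall fun z => ?_
      obtain ⟨w, hw, hz⟩ := Set.mem_iUnion₂.1 (ht (Set.mem_univ z))
      exact Set.mem_iUnion.2 ⟨e ⟨w, hw⟩, by simpa [W] using hz⟩
    obtain ⟨μs, hfin, hμ, hk⟩ := hmaj _ U hUm hUd hUu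
    have hν : ∀ f : Metric.sphere (0 : EuclideanSpace ℝ (Fin n)) 1 → ℝ, Continuous f →
        ∫ z, f z ∂ν = ∑ k, ∫ z in U k, f z ∂ν := fun f hf => by
      rw [← setIntegral_univ, ← hUu]
      exact integral_iUnion_fintype hUm hUd (fun k => (hint f hf ν).integrableOn)
    have h1 : ε * ν.real Set.univ = ∑ k, ∫ z in U k, ε ∂ν := by
      rw [← hν _ continuous_const]; simp [mul_comm]
    rw [h1, hν _ hpc, hμ, integral_finsetSum_measure (fun k _ => hint _ hpc _),
      ← Finset.sum_add_distrib]
    refine Finset.sum_le_sum fun k _ => ?_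
    calc ∫ z in U k, p z ∂ν
        ≤ ∫ z in U k, (⟪x (e.symm k), (z : EuclideanSpace ℝ (Fin n))⟫ + ε) ∂ν :=
          setIntegral_mono_on (hint _ hpc _) (hint _ ((hlc _).add continuous_const) _) (hUm k)
            (fun z hz => le_of_lt (disjointed_subset W k hz))
      _ = ∫ z, ⟪x (e.symm k), (z : EuclideanSpace ℝ (Fin n))⟫ ∂(μs k) + ∫ z in U k, ε ∂ν := by
          rw [integral_add (hint _ (hlc _) _) (hint _ continuous_const _), hk]
      _ ≤ _ := by
          gcongr
          · exact hint _ (hlc _) _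
          · exact hint _ hpc _
          · exact fun z => hx2 _ _
  refine le_of_forall_pos_le_add fun δ hδ => ?_
  have hN : 0 ≤ ν.real Set.univ := measureReal_nonneg
  refine (key (δ / (ν.real Set.univ + 1)) (by positivity)).trans ?_
  gcongr
  rw [div_mul_eq_mul_div, div_le_iff₀ (by positivity)]
  nlinarith
end

section
/- Let μ and ν be finite Borel measures on the unit sphere S^{n-1} ⊆ ℝ^n. If ∫_{S^{n-1}} p dμ ≥ ∫_{S^{n-1}} p dν for every sublinear functional p : ℝ^n → ℝ, then μ linearly majorizes ν. (Together with Reshetnyak's theorem this characterizes linear majorization: the inequality holds for all sublinear p if and only if μ linearly majorizes ν.) -/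
open MeasureTheory RealInnerProductSpace

open scoped CompactlySupported

namespace LinMaj

lemma ciSup_add_le {m : ℕ} [NeZero m] (a b : Fin m → ℝ) :
    (⨆ k, (a k + b k)) ≤ (⨆ k, a k) + ⨆ k, b k :=
  ciSup_le fun k => add_le_add (le_ciSup (Set.finite_range a).bddAbove k)
    (le_ciSup (Set.finite_range b).bddAbove k)

lemma continuous_ciSup {X : Type*} [TopologicalSpace X] {m : ℕ} [NeZero m] (f : Fin m → X → ℝ)
    (hf : ∀ k, Continuous (f k)) : Continuous fun z => ⨆ k, f k z := by
  have := Continuous.finset_sup'_apply (s := Finset.univ) (f := f) Finset.univ_nonempty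
    (fun i _ => hf i)
  simpa only [Finset.sup'_univ_eq_ciSup] using this

lemma integrable_of_cont {X : Type*} [TopologicalSpace X] [CompactSpace X] [MeasurableSpace X]
    [OpensMeasurableSpace X] (μ : Measure X) [IsFiniteMeasure μ] {f : X → ℝ} (hf : Continuous f) :
    Integrable f μ :=
  hf.integrable_of_hasCompactSupport (HasCompactSupport.of_compactSpace f)

/-- The functional `⟪x, ·⟫` on the sphere, as a linear map in `x`. -/
noncomputable def lin (n : ℕ) : EuclideanSpace ℝ (Fin n) →ₗ[ℝ]
    C_c(Metric.sphere (0 : EuclideanSpace ℝ (Fin n)) 1, ℝ) where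
  toFun x := ⟨⟨fun z => ⟪x, (z : EuclideanSpace ℝ (Fin n))⟫, by fun_prop⟩,
    HasCompactSupport.of_compactSpace _⟩
  map_add' x y := by
    ext z
    exact inner_add_left x y _
  map_smul' t x := by
    ext z
    exact real_inner_smul_left x _ t

lemma lin_apply (n : ℕ) (x : EuclideanSpace ℝ (Fin n))
    (z : Metric.sphere (0 : EuclideanSpace ℝ (Fin n)) 1) :
    lin n x z = ⟪x, (z : EuclideanSpace ℝ (Fin n))⟫ := rfl

lemma lin_injective (n : ℕ) : Function.Injective (lin n) := by
  rw [injective_iff_map_eq_zero]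
  intro x hx
  by_contra h0
  have hn : ‖x‖ ≠ 0 := norm_ne_zero_iff.mpr h0
  have hz : ‖x‖⁻¹ • x ∈ Metric.sphere (0 : EuclideanSpace ℝ (Fin n)) 1 := by
    simp [norm_smul, hn]
  have h1 : lin n x ⟨_, hz⟩ = 0 := by rw [hx]; rfl
  rw [lin_apply, real_inner_smul_right, real_inner_self_eq_norm_sq] at h1
  field_simp at h1
  exact hn h1

theorem main (n : ℕ)
    (μ ν : Measure (Metric.sphere (0 : EuclideanSpace ℝ (Fin n)) 1))
    [IsFiniteMeasure μ] [IsFiniteMeasure ν]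
    (h : ∀ p : EuclideanSpace ℝ (Fin n) → ℝ,
      (∀ x y, p (x + y) ≤ p x + p y) →
      (∀ (t : ℝ), 0 ≤ t → ∀ x, p (t • x) = t * p x) →
      ∫ z, p (z : EuclideanSpace ℝ (Fin n)) ∂ν ≤ ∫ z, p (z : EuclideanSpace ℝ (Fin n)) ∂μ)
    (m : ℕ) [NeZero m] (U : Fin m → Set (Metric.sphere (0 : EuclideanSpace ℝ (Fin n)) 1))
    (hU : ∀ k, MeasurableSet (U k)) (hd : Pairwise (Function.onFun Disjoint U))
    (hu : (⋃ k, U k) = Set.univ) :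
    ∃ μs : Fin m → Measure (Metric.sphere (0 : EuclideanSpace ℝ (Fin n)) 1),
      (∀ k, IsFiniteMeasure (μs k)) ∧ μ = ∑ k, μs k ∧
      ∀ (k : Fin m) (x : EuclideanSpace ℝ (Fin n)),
        ∫ z, ⟪x, (z : EuclideanSpace ℝ (Fin n))⟫ ∂(μs k)
          = ∫ z in U k, ⟪x, (z : EuclideanSpace ℝ (Fin n))⟫ ∂ν := by
  have hlc : ∀ x : EuclideanSpace ℝ (Fin n), Continuous fun z : Metric.sphere (0 : EuclideanSpace ℝ (Fin n)) 1 => ⟪x, (z : EuclideanSpace ℝ (Fin n))⟫ := fun x => by fun_prop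
  -- the sublinear functional
  let q : (Fin m → C_c(Metric.sphere (0 : EuclideanSpace ℝ (Fin n)) 1, ℝ)) → ℝ := fun f => ∫ z, (⨆ k, f k z) ∂μ
  have hqc : ∀ f : Fin m → C_c(Metric.sphere (0 : EuclideanSpace ℝ (Fin n)) 1, ℝ), Continuous fun z => ⨆ k, f k z := fun f =>
    continuous_ciSup _ fun k => (f k).continuous
  have hqi : ∀ f : Fin m → C_c(Metric.sphere (0 : EuclideanSpace ℝ (Fin n)) 1, ℝ), Integrable (fun z => ⨆ k, f k z) μ := fun f =>
    integrable_of_cont μ (hqc f)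
  -- the linear functional
  let T : (Fin m → EuclideanSpace ℝ (Fin n)) →ₗ[ℝ] (Fin m → C_c(Metric.sphere (0 : EuclideanSpace ℝ (Fin n)) 1, ℝ)) :=
    LinearMap.pi fun k => lin n ∘ₗ LinearMap.proj k
  have hT : ∀ x k, T x k = lin n (x k) := fun x k => rfl
  have hTi : Function.Injective T := by
    intro x y hxy
    funext k
    exact lin_injective n (congrFun hxy k)
  let I : Fin m → EuclideanSpace ℝ (Fin n) →ₗ[ℝ] ℝ := fun k =>
    { toFun := fun x => ∫ z in U k, ⟪x, (z : EuclideanSpace ℝ (Fin n))⟫ ∂ν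
      map_add' := fun x y => by
        simp only [inner_add_left]
        exact integral_add (integrable_of_cont _ (hlc x)) (integrable_of_cont _ (hlc y))
      map_smul' := fun t x => by
        simp only [real_inner_smul_left, integral_const_mul]
        rfl }
  let l : (Fin m → EuclideanSpace ℝ (Fin n)) →ₗ[ℝ] ℝ := ∑ k, I k ∘ₗ LinearMap.proj k
  have hl : ∀ x, l x = ∑ k, ∫ z in U k, ⟪x k, (z : EuclideanSpace ℝ (Fin n))⟫ ∂ν := fun x => by
    simp [l, I]
  have hlq : ∀ x, l x ≤ q (T x) := by
    intro x
    have hc : Continuous fun z : Metric.sphere (0 : EuclideanSpace ℝ (Fin n)) 1 => ⨆ k, ⟪x k, (z : EuclideanSpace ℝ (Fin n))⟫ := continuous_ciSup _ fun k => hlc (x k)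
    calc l x = ∑ k, ∫ z in U k, ⟪x k, (z : EuclideanSpace ℝ (Fin n))⟫ ∂ν := hl x
      _ ≤ ∑ k, ∫ z in U k, (⨆ j, ⟪x j, (z : EuclideanSpace ℝ (Fin n))⟫) ∂ν := by
        refine Finset.sum_le_sum fun k _ => ?_
        refine integral_mono (integrable_of_cont _ (hlc _)) (integrable_of_cont _ hc) fun z => ?_
        exact le_ciSup (f := fun j => ⟪x j, (z : EuclideanSpace ℝ (Fin n))⟫) (Set.finite_range _).bddAbove k
      _ = ∫ z, (⨆ j, ⟪x j, (z : EuclideanSpace ℝ (Fin n))⟫) ∂ν := by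
        rw [← integral_iUnion_fintype hU hd fun k => (integrable_of_cont ν hc).integrableOn, hu,
          setIntegral_univ]
      _ ≤ ∫ z, (⨆ j, ⟪x j, (z : EuclideanSpace ℝ (Fin n))⟫) ∂μ := by
        refine h (fun z => ⨆ j, ⟪x j, z⟫) ?_ ?_
        · intro y z
          simp only [inner_add_right]
          exact ciSup_add_le _ _
        · intro t ht y
          simp only [real_inner_smul_right]
          exact (Real.mul_iSup_of_nonneg ht _).symm
      _ = q (T x) := rfl
  let f : (Fin m → C_c(Metric.sphere (0 : EuclideanSpace ℝ (Fin n)) 1, ℝ)) →ₗ.[ℝ] ℝ :=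
    ⟨LinearMap.range T, l ∘ₗ (LinearEquiv.ofInjective T hTi).symm.toLinearMap⟩
  obtain ⟨g, hgf, hgq⟩ := exists_extension_of_le_sublinear f q
    (by
      intro c hc x
      simp only [q, Pi.smul_apply, CompactlySupportedContinuousMap.smul_apply, smul_eq_mul]
      rw [← integral_const_mul]
      congr 1
      funext z
      exact (Real.mul_iSup_of_nonneg hc.le _).symm)
    (by
      intro x y
      simp only [q, Pi.add_apply, CompactlySupportedContinuousMap.add_apply]
      rw [← integral_add (hqi x) (hqi y)]
      refine integral_mono (hqi (x + y)) ((hqi x).add (hqi y)) fun z => ?_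
      exact ciSup_add_le _ _)
    (by
      rintro ⟨_, x, rfl⟩
      have : (LinearEquiv.ofInjective T hTi).symm ⟨T x, x, rfl⟩ = x :=
        (LinearEquiv.symm_apply_eq _).mpr rfl
      change l ((LinearEquiv.ofInjective T hTi).symm ⟨T x, x, rfl⟩) ≤ q (T x)
      rw [this]
      exact hlq x)
  have hgT : ∀ x, g (T x) = l x := by
    intro x
    have : (LinearEquiv.ofInjective T hTi).symm ⟨T x, x, rfl⟩ = x :=
      (LinearEquiv.symm_apply_eq _).mpr rfl
    have h2 := hgf ⟨T x, x, rfl⟩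
    change g (T x) = l ((LinearEquiv.ofInjective T hTi).symm ⟨T x, x, rfl⟩) at h2
    rw [h2, this]
  -- positivity
  let Φ : Fin m → C_c(Metric.sphere (0 : EuclideanSpace ℝ (Fin n)) 1, ℝ) →ₚ[ℝ] ℝ := fun k =>
    PositiveLinearMap.mk₀ (g ∘ₗ LinearMap.single ℝ (fun _ => C_c(Metric.sphere (0 : EuclideanSpace ℝ (Fin n)) 1, ℝ)) k) (by
      intro u hu0
      have h1 := hgq (-(Pi.single k u))
      have h2 : q (-(Pi.single k u)) ≤ 0 := by
        refine integral_nonpos fun z => ciSup_le fun j => ?_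
        by_cases hjk : j = k
        · subst hjk
          simpa using hu0 z
        · simp [hjk]
      rw [map_neg] at h1
      change 0 ≤ g (Pi.single k u)
      linarith)
  have hΦ : ∀ k u, Φ k u = g (Pi.single k u) := fun k u => rfl
  have hfin : ∀ k, IsFiniteMeasure (RealRMK.rieszMeasure (Φ k)) := fun k => inferInstance
  refine ⟨fun k => RealRMK.rieszMeasure (Φ k), hfin, ?_, ?_⟩
  · refine ext_of_forall_integral_eq_of_IsFiniteMeasure fun u => ?_
    let w : C_c(Metric.sphere (0 : EuclideanSpace ℝ (Fin n)) 1, ℝ) := ⟨u.toContinuousMap, HasCompactSupport.of_compactSpace _⟩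
    change ∫ z, w z ∂μ = ∫ z, w z ∂_
    have hwc : Continuous fun z => w z := w.continuous
    rw [integral_finsetSum_measure fun k _ => integrable_of_cont _ hwc]
    simp only [RealRMK.integral_rieszMeasure, hΦ]
    rw [← map_sum, Finset.univ_sum_single (fun _ : Fin m => w)]
    have h1 := hgq (fun _ => w)
    have h2 := hgq (-(fun _ => w))
    have h3 : q (fun _ => w) = ∫ z, w z ∂μ := by simp [q]
    have h4 : q (-(fun _ => w)) = -∫ z, w z ∂μ := by simp [q, integral_neg]
    rw [map_neg] at h2
    linarith
  · intro k x
    have h1 := RealRMK.integral_rieszMeasure (Φ k) (lin n x)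
    simp only [lin_apply] at h1
    rw [h1, hΦ]
    have h2 : (Pi.single k (lin n x) : Fin m → C_c(Metric.sphere (0 : EuclideanSpace ℝ (Fin n)) 1, ℝ)) = T (Pi.single k x) := by
      funext j
      rw [hT]
      by_cases hjk : j = k
      · subst hjk; simp
      · simp [hjk]
    rw [h2, hgT]
    change (∑ k, I k ∘ₗ LinearMap.proj k : (Fin m → EuclideanSpace ℝ (Fin n)) →ₗ[ℝ] ℝ) (Pi.single k x) = I k x
    rw [LinearMap.sum_apply, Finset.sum_eq_single k]
    · simp
    · intro j _ hj
      simp [hj]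
    · simp

end LinMaj

/-- Necessity in Reshetnyak's characterization: if `∫ p dμ ≥ ∫ p dν` for every sublinear
functional `p` on `ℝⁿ`, then `μ` linearly majorizes `ν`. -/
theorem linearlyMajorizes_of_forall_sublinear (n : ℕ)
    (μ ν : Measure (Metric.sphere (0 : EuclideanSpace ℝ (Fin n)) 1))
    [IsFiniteMeasure μ] [IsFiniteMeasure ν]
    (h : ∀ p : EuclideanSpace ℝ (Fin n) → ℝ,
      (∀ x y, p (x + y) ≤ p x + p y) →
      (∀ (t : ℝ), 0 ≤ t → ∀ x, p (t • x) = t * p x) →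
      ∫ z, p (z : EuclideanSpace ℝ (Fin n)) ∂ν ≤ ∫ z, p (z : EuclideanSpace ℝ (Fin n)) ∂μ) :
    LinearlyMajorizes μ ν := by
  intro m U hU hd hu
  rcases Nat.eq_zero_or_pos m with rfl | hm
  · refine ⟨fun _ => 0, fun k => k.elim0, ?_, fun k => k.elim0⟩
    have h0 : (Set.univ : Set (Metric.sphere (0 : EuclideanSpace ℝ (Fin n)) 1)) = ∅ := by
      rw [← hu]; simp
    have h1 : μ = 0 := by
      rw [← Measure.measure_univ_eq_zero, h0, measure_empty]
    simp [h1]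
  · have : NeZero m := ⟨hm.ne'⟩
    exact LinMaj.main n μ ν h m U hU hd hu
end

section
/- (Minkowski existence theorem, polytopal case) Let n ≥ 2, let u_1, …, u_m be pairwise distinct unit vectors in ℝ^n whose linear span is all of ℝ^n, and let a_1, …, a_m be positive reals with a_1 u_1 + ⋯ + a_m u_m = 0. Then there exists a convex polytope P ⊆ ℝ^n (the convex hull of a finite set) with nonempty interior such that for each i the face F(P, u_i) has (n−1)-dimensional Hausdorff measure a_i, and for every unit vector u ∉ {u_1, …, u_m} the face F(P, u) has (n−1)-dimensional Hausdorff measure 0. -/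
open MeasureTheory RealInnerProductSpace

/-- The face of `K` in direction `u`. -/
noncomputable def face {n : ℕ} (K : Set (EuclideanSpace ℝ (Fin n)))
    (u : EuclideanSpace ℝ (Fin n)) : Set (EuclideanSpace ℝ (Fin n)) :=
  {x ∈ K | ⟪x, u⟫ = suppFn K u}


section Helpers

open scoped NNReal ENNReal Topology Pointwise
open Filter

/-- Euclidean space of dimension `k`. -/
abbrev ES (k : ℕ) := EuclideanSpace ℝ (Fin k)

/-- The top-dimensional Hausdorff measure on Euclidean space. -/
noncomputable abbrev rho (k : ℕ) : Measure (ES k) := μH[(k : ℝ)]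

instance rho_haar (k : ℕ) : (rho k).IsAddHaarMeasure := by
  simpa using MeasureTheory.isAddHaarMeasure_hausdorffMeasure (E := EuclideanSpace ℝ (Fin k))

/-- An isometric parametrization of the hyperplane orthogonal to `u`. -/
structure MFrame {k : ℕ} (u : ES (k + 1)) where
  emb : ES k →ₗᵢ[ℝ] ES (k + 1)
  orth : ∀ y, ⟪emb y, u⟫ = 0
  surj : ∀ x, ⟪x, u⟫ = 0 → ∃ y, emb y = x

theorem exists_frame {k : ℕ} (u : ES (k + 1)) (hu : ‖u‖ = 1) : Nonempty (MFrame u) := by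
  have hu0 : u ≠ 0 := by
    rintro rfl
    simp at hu
  have : Fact (Module.finrank ℝ (ES (k + 1)) = k + 1) := ⟨by simp⟩
  let b := OrthonormalBasis.fromOrthogonalSpanSingleton (𝕜 := ℝ) k hu0
  refine ⟨⟨(Submodule.subtypeₗᵢ _).comp b.repr.symm.toLinearIsometry, ?_, ?_⟩⟩
  · intro y
    have := (b.repr.symm y).2
    rw [Submodule.mem_orthogonal_singleton_iff_inner_left] at this
    exact this
  · intro x hx
    rw [← Submodule.mem_orthogonal_singleton_iff_inner_left] at hx
    refine ⟨b.repr ⟨x, hx⟩, ?_⟩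
    simp

namespace MFrame
variable {k : ℕ} {u : ES (k + 1)}

theorem norm_sq (f : MFrame u) (hu : ‖u‖ = 1) (y : ES k) (s : ℝ) :
    ‖f.emb y + s • u‖ ^ 2 = ‖y‖ ^ 2 + s ^ 2 := by
  rw [norm_add_sq_real, inner_smul_right, f.orth, norm_smul, hu, f.emb.norm_map]
  simp

theorem inner_u (f : MFrame u) (hu : ‖u‖ = 1) (y : ES k) (s : ℝ) :
    ⟪f.emb y + s • u, u⟫ = s := by
  rw [inner_add_left, f.orth, inner_smul_left, real_inner_self_eq_norm_sq, hu]
  simp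

/-- The linear decomposition of space associated with a frame. -/
noncomputable def equiv (f : MFrame u) (hu : ‖u‖ = 1) : (ES k × ℝ) ≃L[ℝ] ES (k + 1) :=
  (LinearEquiv.ofBijective
    (f.emb.toLinearMap.coprod (LinearMap.toSpanSingleton ℝ _ u)) (by
      constructor
      · rw [← LinearMap.ker_eq_bot, LinearMap.ker_eq_bot']
        rintro ⟨y, s⟩ h
        have h1 := f.norm_sq hu y s
        have h2 : f.emb y + s • u = 0 := by simpa using h
        rw [h2] at h1
        simp only [norm_zero] at h1
        have hy : ‖y‖ = 0 := by nlinarith [sq_nonneg ‖y‖, sq_nonneg s]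
        have hs : s = 0 := by nlinarith [sq_nonneg ‖y‖, sq_nonneg s]
        simp [norm_eq_zero.mp hy, hs]
      · intro x
        obtain ⟨y, hy⟩ := f.surj (x - ⟪x, u⟫ • u) (by
          rw [inner_sub_left, inner_smul_left, real_inner_self_eq_norm_sq, hu]; simp)
        refine ⟨(y, ⟪x, u⟫), ?_⟩
        simp [hy])).toContinuousLinearEquiv

theorem equiv_apply (f : MFrame u) (hu : ‖u‖ = 1) (y : ES k) (s : ℝ) :
    f.equiv hu (y, s) = f.emb y + s • u := by
  change (f.emb.toLinearMap.coprod (LinearMap.toSpanSingleton ℝ _ u)) (y, s) = _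
  simp

theorem fubini_aux (f : MFrame u) (hu : ‖u‖ = 1) : ∃ c : ℝ≥0, 0 < c ∧
    ∀ B : Set (ES (k + 1)), MeasurableSet B →
      (c : ℝ≥0∞) * volume B = ((rho k).prod (volume : Measure ℝ)) {p | f.emb p.1 + p.2 • u ∈ B} := by
  have hm := ContinuousLinearEquiv.isAddHaarMeasure_map (f.equiv hu) ((rho k).prod volume)
  refine ⟨Measure.addHaarScalarFactor (Measure.map (f.equiv hu) ((rho k).prod volume)) volume,
    Measure.addHaarScalarFactor_pos_of_isAddHaarMeasure _ _, ?_⟩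
  intro B hB
  have := Measure.isAddLeftInvariant_eq_smul
    (Measure.map (f.equiv hu) ((rho k).prod volume)) volume
  have h2 := congrArg (fun μ => μ B) this
  simp only [Measure.smul_apply] at h2
  rw [Measure.map_apply (f.equiv hu).continuous.measurable hB] at h2
  rw [ENNReal.smul_def, smul_eq_mul] at h2
  rw [← h2]
  congr 1

end MFrame

theorem exists_fubini (k : ℕ) : ∃ C : ℝ≥0, 0 < C ∧
    ∀ (u : ES (k + 1)) (_ : ‖u‖ = 1) (f : MFrame u) (B : Set (ES (k + 1))), MeasurableSet B →
      (C : ℝ≥0∞) * volume B = ∫⁻ s : ℝ, rho k {y | f.emb y + s • u ∈ B} := by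
  let u0 : ES (k + 1) := EuclideanSpace.single 0 1
  have hu0 : ‖u0‖ = 1 := by simp [u0]
  obtain ⟨f0⟩ := exists_frame u0 hu0
  obtain ⟨C, hC, h0⟩ := f0.fubini_aux hu0
  refine ⟨C, hC, ?_⟩
  intro u hu f B hB
  obtain ⟨c, hc, h1⟩ := f.fubini_aux hu
  have key : c = C := by
    have hb : MeasurableSet (Metric.closedBall (0 : ES (k + 1)) 1) :=
      Metric.isClosed_closedBall.measurableSet
    have e0 := h0 _ hb
    have e1 := h1 _ hb
    have : {p : ES k × ℝ | f.emb p.1 + p.2 • u ∈ Metric.closedBall (0 : ES (k + 1)) 1} =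
        {p | f0.emb p.1 + p.2 • u0 ∈ Metric.closedBall (0 : ES (k + 1)) 1} := by
      ext ⟨y, s⟩
      simp only [Set.mem_ofPred_eq, mem_closedBall_zero_iff]
      rw [← sq_le_one_iff₀ (norm_nonneg _), f.norm_sq hu,
        ← sq_le_one_iff₀ (norm_nonneg (f0.emb y + s • u0)), f0.norm_sq hu0]
    rw [this, ← e0] at e1
    have hpos : volume (Metric.closedBall (0 : ES (k + 1)) 1) ≠ 0 :=
      (Metric.measure_closedBall_pos _ _ one_pos).ne'
    have hfin : volume (Metric.closedBall (0 : ES (k + 1)) 1) ≠ ∞ :=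
      measure_closedBall_lt_top.ne
    exact_mod_cast (ENNReal.mul_left_inj hpos hfin).mp e1
  rw [← key, h1 B hB, Measure.prod_apply_symm]
  · rfl
  · have : Measurable (fun p : ES k × ℝ => f.emb p.1 + p.2 • u) := by
      have hh : Continuous (fun p : ES k × ℝ => f.emb p.1 + p.2 • u) := by
        have := f.emb.continuous
        fun_prop
      exact hh.measurable
    exact this hB

theorem slice_measure {k : ℕ} {u : ES (k + 1)} (hu : ‖u‖ = 1) (f : MFrame u)
    (B : Set (ES (k + 1))) (s : ℝ) :
    μH[(k : ℝ)] {x | x ∈ B ∧ ⟪x, u⟫ = s} = rho k {y | f.emb y + s • u ∈ B} := by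
  have hiso : Isometry (fun y => f.emb y + s • u) := by
    intro y z
    simp [edist_add_right, f.emb.isometry.edist_eq]
  have := hiso.hausdorffMeasure_image (d := (k : ℝ)) (Or.inl (by positivity))
    {y | f.emb y + s • u ∈ B}
  rw [rho, ← this]
  congr 1
  ext x
  simp only [Set.mem_ofPred_eq, Set.mem_image]
  constructor
  · rintro ⟨hx, hxs⟩
    obtain ⟨y, hy⟩ := f.surj (x - s • u) (by
      rw [inner_sub_left, inner_smul_left, real_inner_self_eq_norm_sq, hu, hxs]; simp)
    have : f.emb y + s • u = x := by rw [hy]; simp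
    exact ⟨y, by rwa [this], this⟩
  · rintro ⟨y, hy, rfl⟩
    exact ⟨hy, f.inner_u hu y s⟩

/-- Level sets of a nonzero linear functional on a Haar measure space are null. -/
theorem level_null {F : Type*} [NormedAddCommGroup F] [InnerProductSpace ℝ F]
    [MeasurableSpace F] [BorelSpace F] [FiniteDimensional ℝ F] (μ : Measure F)
    [μ.IsAddHaarMeasure] (l : F →ₗ[ℝ] ℝ) (hl : l ≠ 0) (c : ℝ) : μ {x | l x = c} = 0 := by
  let A : AffineSubspace ℝ F := (AffineSubspace.mk' c (⊥ : Submodule ℝ ℝ)).comap l.toAffineMap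
  have hA : (A : Set F) = {x | l x = c} := by
    ext x
    simp [A, AffineSubspace.mem_mk', sub_eq_zero]
  rw [← hA]
  apply Measure.addHaar_affineSubspace
  intro hT
  have h3 : ∀ x, l x = c := by
    intro x
    have : x ∈ (A : Set F) := by rw [hT]; trivial
    rwa [hA] at this
  apply hl
  ext x
  have h0 := h3 0
  rw [map_zero] at h0
  rw [h3 x, ← h0]
  rfl

theorem hyper_null {k : ℕ} (u : ES k) (hu : u ≠ 0) (c : ℝ) :
    volume {x : ES k | ⟪x, u⟫ = c} = 0 := by
  have := level_null (volume : Measure (ES k)) (innerSL ℝ u).toLinearMap (by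
    intro h
    have := congrArg (fun l => l u) h
    simp at this
    exact hu this) c
  simpa [real_inner_comm] using this

theorem slice_null {k : ℕ} {u : ES (k + 1)} (hu : ‖u‖ = 1) (f : MFrame u)
    (w : ES (k + 1)) (hw : ‖w‖ = 1) (h1 : w ≠ u) (h2 : w ≠ -u) (s c : ℝ) :
    rho k {y | ⟪f.emb y + s • u, w⟫ = c} = 0 := by
  have := level_null (rho k) ((innerSL ℝ w).toLinearMap.comp f.emb.toLinearMap) (by
    intro h
    obtain ⟨y, hy⟩ := f.surj (w - ⟪w, u⟫ • u) (by
      rw [inner_sub_left, inner_smul_left, real_inner_self_eq_norm_sq, hu]; simp)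
    have h3 := congrArg (fun l => l y) h
    simp only [LinearMap.comp_apply, LinearIsometry.coe_toLinearMap, hy] at h3
    simp only [ContinuousLinearMap.coe_coe, innerSL_apply_apply, inner_sub_right,
      inner_smul_right, real_inner_self_eq_norm_sq, hw, LinearMap.zero_apply] at h3
    have h4 : (⟪w, u⟫ - 1) * (⟪w, u⟫ + 1) = 0 := by nlinarith
    rcases mul_eq_zero.mp h4 with h | h
    · exact h1 ((inner_eq_one_iff_of_norm_eq_one (𝕜 := ℝ) hw hu).mp (by linarith))
    · refine h2 ((inner_eq_one_iff_of_norm_eq_one (𝕜 := ℝ) hw (by simpa using hu)).mp ?_)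
      rw [inner_neg_right]; linarith) (c - s * ⟪u, w⟫)
  convert this using 2
  ext y
  simp [inner_add_left, inner_smul_left, real_inner_comm w (f.emb y), eq_sub_iff_add_eq]

/-- The polyhedron with outer normals `u i` and support numbers `h i`. -/
def poly {d m : ℕ} (u : Fin m → ES d) (h : Fin m → ℝ) : Set (ES d) := {x | ∀ i, ⟪x, u i⟫ ≤ h i}

section Poly
variable {d m : ℕ} (u : Fin m → ES d)

theorem poly_closed (h : Fin m → ℝ) : IsClosed (poly u h) := by
  have : poly u h = ⋂ i, {x | ⟪x, u i⟫ ≤ h i} := by ext; simp [poly]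
  rw [this]
  exact isClosed_iInter fun i => isClosed_le (by fun_prop) (by fun_prop)

theorem poly_convex (h : Fin m → ℝ) : Convex ℝ (poly u h) := by
  intro x hx y hy s t hs ht hst i
  rw [inner_add_left, inner_smul_left, inner_smul_left]
  have h1 := mul_le_mul_of_nonneg_left (hx i) hs
  have h2 := mul_le_mul_of_nonneg_left (hy i) ht
  simp only [conj_trivial]
  calc s * ⟪x, u i⟫ + t * ⟪y, u i⟫ ≤ s * h i + t * h i := add_le_add h1 h2
    _ = h i := by rw [← add_mul, hst, one_mul]

theorem poly_mono {h h' : Fin m → ℝ} (hh : h ≤ h') : poly u h ⊆ poly u h' :=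
  fun _ hx i => (hx i).trans (hh i)

theorem poly_smul (h : Fin m → ℝ) {r : ℝ} (hr : 0 < r) : poly u (r • h) = r • poly u h := by
  ext x
  rw [Set.mem_smul_set_iff_inv_smul_mem₀ hr.ne']
  simp only [poly, Set.mem_ofPred_eq, inner_smul_left, conj_trivial, Pi.smul_apply, smul_eq_mul]
  refine forall_congr' fun i => ?_
  rw [inv_mul_le_iff₀ hr]

theorem poly_translate (h : Fin m → ℝ) (t : ES d) :
    poly u (fun i => h i - ⟪t, u i⟫) = (fun x => x + t) ⁻¹' poly u h := by
  ext x
  simp only [poly, Set.mem_ofPred_eq, Set.mem_preimage, inner_add_left]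
  exact forall_congr' fun i => le_sub_iff_add_le

theorem poly_bounded (hspan : Submodule.span ℝ (Set.range u) = ⊤) (a : Fin m → ℝ)
    (ha : ∀ i, 0 < a i) (hsum : ∑ i, a i • u i = 0) (h : Fin m → ℝ) :
    Bornology.IsBounded (poly u h) := by
  let T : ES d →ₗ[ℝ] (Fin m → ℝ) := LinearMap.pi fun i => (innerSL ℝ (u i)).toLinearMap
  have hT : LinearMap.ker T = ⊥ := by
    rw [LinearMap.ker_eq_bot']
    intro x hx
    have h1 : ∀ i, ⟪u i, x⟫ = 0 := fun i => by
      have := congrFun hx i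
      simpa [T] using this
    have h2 : x ∈ (Submodule.span ℝ (Set.range u))ᗮ := by
      rw [Submodule.mem_orthogonal]
      intro y hy
      induction hy using Submodule.span_induction with
      | mem z hz => obtain ⟨i, rfl⟩ := hz; exact h1 i
      | zero => simp
      | add y z _ _ h3 h4 => rw [inner_add_left, h3, h4, add_zero]
      | smul c y _ h3 => rw [inner_smul_left, h3, mul_zero]
    rw [hspan] at h2
    simpa using h2
  obtain ⟨K, -, hK⟩ := T.exists_antilipschitzWith hT
  have hb : Bornology.IsBounded
      (Set.Icc (fun i => -(∑ j, a j * |h j|) / a i) h) := Metric.isBounded_Icc _ _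
  refine (hK.isBounded_preimage hb).subset ?_
  intro x hx
  have hs : ∑ j, a j * ⟪x, u j⟫ = 0 := by
    have := congrArg (fun v => ⟪x, v⟫) hsum
    simpa [inner_sum, inner_smul_right] using this
  refine ⟨fun i => ?_, fun i => ?_⟩
  · simp only [T, LinearMap.pi_apply, ContinuousLinearMap.coe_coe, innerSL_apply_apply]
    rw [div_le_iff₀ (ha i), real_inner_comm]
    have h1 := Finset.add_sum_erase Finset.univ (fun j => a j * ⟪x, u j⟫) (Finset.mem_univ i)
    have h2 : ∑ j ∈ Finset.univ.erase i, a j * ⟪x, u j⟫ ≤ ∑ j, a j * |h j| := by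
      calc _ ≤ ∑ j ∈ Finset.univ.erase i, a j * |h j| := by
            refine Finset.sum_le_sum fun j _ => ?_
            exact mul_le_mul_of_nonneg_left ((hx j).trans (le_abs_self _)) (ha j).le
        _ ≤ _ := Finset.sum_le_univ_sum_of_nonneg fun j => by have := ha j; positivity
    rw [hs] at h1
    linarith
  · simpa [T, real_inner_comm] using hx i

theorem poly_compact (hspan : Submodule.span ℝ (Set.range u) = ⊤) (a : Fin m → ℝ)
    (ha : ∀ i, 0 < a i) (hsum : ∑ i, a i • u i = 0) (h : Fin m → ℝ) :
    IsCompact (poly u h) :=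
  Metric.isCompact_of_isClosed_isBounded (poly_closed u h) (poly_bounded u hspan a ha hsum h)

/-- small perturbations preserve strict inequalities -/
theorem small_pert (c b : Fin m → ℝ) : ∃ ε > 0, ∀ i, 0 < c i → ε * |b i| < c i := by
  have : ∀ᶠ ε in 𝓝[>] (0 : ℝ), ∀ i, 0 < c i → ε * |b i| < c i := by
    rw [eventually_all]
    intro i
    by_cases hc : 0 < c i
    · have h1 : Tendsto (fun ε : ℝ => ε * |b i|) (𝓝[>] 0) (𝓝 (0 * |b i|)) :=
        ((continuous_id.mul continuous_const).tendsto 0).mono_left nhdsWithin_le_nhds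
      rw [zero_mul] at h1
      filter_upwards [h1.eventually (gt_mem_nhds hc)] with e he _ using he
    · exact Eventually.of_forall fun e h => absurd h hc
  obtain ⟨e, h1, h2⟩ := (this.and self_mem_nhdsWithin).exists
  exact ⟨e, h2, h1⟩

theorem poly_hull (h : Fin m → ℝ) (hc : IsCompact (poly u h)) :
    ∃ S : Finset (ES d), poly u h = convexHull ℝ (S : Set (ES d)) := by
  have hfin : ((poly u h).extremePoints ℝ).Finite := by
    refine Set.Finite.of_injOn (f := fun x => {i | ⟪x, u i⟫ = h i}) (t := Set.univ)
      (fun _ _ => Set.mem_univ _) ?_ Set.finite_univ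
    intro x hx y hy hxy
    by_contra hne
    simp only at hxy
    obtain ⟨ε, hε, hp⟩ := small_pert (fun i => h i - ⟪x, u i⟫) (fun i => ⟪y - x, u i⟫)
    have hmem : ∀ s : ℝ, |s| ≤ ε → x + s • (y - x) ∈ poly u h := by
      intro s hs i
      rw [inner_add_left, inner_smul_left, conj_trivial]
      rcases (hx.1 i).lt_or_eq with hlt | heq
      · have h1 := hp i (by simpa using hlt)
        have h2 : s * ⟪y - x, u i⟫ ≤ ε * |⟪y - x, u i⟫| := by
          calc _ ≤ |s * ⟪y - x, u i⟫| := le_abs_self _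
            _ = |s| * |⟪y - x, u i⟫| := abs_mul _ _
            _ ≤ _ := mul_le_mul_of_nonneg_right hs (abs_nonneg _)
        linarith
      · have h1 : i ∈ {i | ⟪y, u i⟫ = h i} := by rw [← hxy]; exact heq
        have h2 : ⟪y, u i⟫ = h i := h1
        rw [inner_sub_left, h2, heq]; simp
    have h1 := hmem ε (abs_of_pos hε).le
    have h2 := hmem (-ε) (by rw [abs_neg, abs_of_pos hε])
    have h3 := hx.2 h1 h2 (by
      refine ⟨1/2, 1/2, by norm_num, by norm_num, by norm_num, ?_⟩
      module)
    have h4 : ε • (y - x) = 0 := by simpa using h3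
    rcases smul_eq_zero.mp h4 with h5 | h5
    · exact hε.ne' h5
    · exact hne (sub_eq_zero.mp h5).symm
  refine ⟨hfin.toFinset, ?_⟩
  rw [hfin.coe_toFinset]
  conv_lhs => rw [← closure_convexHull_extremePoints hc (poly_convex u h)]
  exact (hfin.isCompact_convexHull ℝ).isClosed.closure_eq

theorem poly_vol_continuous (hu : ∀ i, u i ≠ 0) (hspan : Submodule.span ℝ (Set.range u) = ⊤)
    (a : Fin m → ℝ) (ha : ∀ i, 0 < a i) (hsum : ∑ i, a i • u i = 0) :
    Continuous fun h => (volume (poly u h)).toReal := by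
  rw [continuous_iff_continuousAt]
  intro h
  have hK := poly_compact u hspan a ha hsum (fun i => h i + 1)
  refine (ENNReal.tendsto_toReal
    (poly_compact u hspan a ha hsum h).measure_lt_top.ne).comp ?_
  refine tendsto_measure_of_ae_tendsto_indicator _ (poly_closed u h).measurableSet
    (fun h => (poly_closed u h).measurableSet) hK.measurableSet hK.measure_lt_top.ne ?_ ?_
  · have : ∀ᶠ h' in 𝓝 h, ∀ i, h' i < h i + 1 := by
      rw [eventually_all]
      intro i
      exact (continuous_apply i).continuousAt.eventually (gt_mem_nhds (lt_add_one (h i)))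
    filter_upwards [this] with h' hh'
    exact poly_mono u fun i => (hh' i).le
  · have : ∀ᵐ x : ES d, ∀ i, ⟪x, u i⟫ ≠ h i := by
      rw [ae_all_iff]
      intro i
      rw [ae_iff]
      simpa using hyper_null (u i) (hu i) (h i)
    filter_upwards [this] with x hx
    have : ∀ᶠ h' in 𝓝 h, ∀ i, (⟪x, u i⟫ ≤ h' i ↔ ⟪x, u i⟫ ≤ h i) := by
      rw [eventually_all]
      intro i
      rcases lt_or_gt_of_ne (hx i) with hlt | hlt
      · filter_upwards [(continuous_apply i).continuousAt.eventually (lt_mem_nhds hlt)] with h' hh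
        exact ⟨fun _ => hlt.le, fun _ => hh.le⟩
      · filter_upwards [(continuous_apply i).continuousAt.eventually (gt_mem_nhds hlt)] with h' hh
        exact ⟨fun h5 => absurd h5 (not_le.mpr hh), fun h5 => absurd h5 (not_le.mpr hlt)⟩
    filter_upwards [this] with h' hh
    exact forall_congr' hh

theorem exists_max (hu : ∀ i, ‖u i‖ = 1) (hspan : Submodule.span ℝ (Set.range u) = ⊤)
    (a : Fin m → ℝ) (ha : ∀ i, 0 < a i) (hsum : ∑ i, a i • u i = 0) :
    ∃ h : Fin m → ℝ, 0 < (volume (poly u h)).toReal ∧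
      ∀ h' : Fin m → ℝ, (volume (poly u h')).toReal * Real.exp (-∑ i, a i * h' i) ≤
        (volume (poly u h)).toReal * Real.exp (-∑ i, a i * h i) := by
  have hu0 : ∀ i, u i ≠ 0 := fun i h0 => by simpa [h0] using hu i
  set F : (Fin m → ℝ) → ℝ :=
    fun h => (volume (poly u h)).toReal * Real.exp (-∑ i, a i * h i) with hF
  have hFc : Continuous F := by
    have := poly_vol_continuous u hu0 hspan a ha hsum
    fun_prop
  have hfin : ∀ h, volume (poly u h) ≠ ∞ := fun h =>
    (poly_compact u hspan a ha hsum h).measure_lt_top.ne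
  set b : Fin m → ℝ := fun i => (a i)⁻¹ with hb
  have hFb : 0 < F b := by
    refine mul_pos (ENNReal.toReal_pos ?_ (hfin b)) (Real.exp_pos _)
    obtain ⟨ε, hε, hp⟩ := small_pert b (fun _ => (1 : ℝ))
    have : Metric.ball (0 : ES d) ε ⊆ poly u b := by
      intro x hx i
      rw [mem_ball_zero_iff] at hx
      have h1 := hp i (inv_pos.mpr (ha i))
      have h2 := real_inner_le_norm x (u i)
      rw [hu i] at h2
      simp at h1
      linarith
    exact fun h0 => (Metric.measure_ball_pos volume (0 : ES d) hε).ne' (measure_mono_null this h0)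
  have htail : ∃ R : ℝ, 1 ≤ R ∧ ∀ L, R ≤ L →
      (volume (poly u b)).toReal * (L ^ d * Real.exp (-L)) ≤ F b := by
    have h1 := (Real.tendsto_pow_mul_exp_neg_atTop_nhds_zero d).const_mul
      (volume (poly u b)).toReal
    rw [mul_zero] at h1
    obtain ⟨R, hR⟩ := eventually_atTop.mp (h1.eventually (gt_mem_nhds hFb))
    exact ⟨max R 1, le_max_right _ _, fun L hL => (hR L ((le_max_left _ _).trans hL)).le⟩
  obtain ⟨R, hR1, hR⟩ := htail
  have hbK : b ∈ Set.Icc (0 : Fin m → ℝ) (R • b) := by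
    refine ⟨fun i => (inv_pos.mpr (ha i)).le, fun i => ?_⟩
    have : 0 < b i := inv_pos.mpr (ha i)
    simp only [Pi.smul_apply, smul_eq_mul]
    nlinarith
  obtain ⟨h, hhK, hmax⟩ := (isCompact_Icc (a := (0 : Fin m → ℝ)) (b := R • b)).exists_isMaxOn
    ⟨b, hbK⟩ hFc.continuousOn
  have hFbh : F b ≤ F h := hmax hbK
  have hnn : ∀ h' : Fin m → ℝ, 0 ≤ h' → F h' ≤ F h := by
    intro h' h0
    by_cases hK : h' ∈ Set.Icc (0 : Fin m → ℝ) (R • b)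
    · exact hmax hK
    · have hx : ∃ i, (R • b) i < h' i := by
        by_contra hcon
        push Not at hcon
        exact hK ⟨h0, hcon⟩
      obtain ⟨i, hi⟩ := hx
      have hle : ∀ j, a j * h' j ≤ ∑ i, a i * h' i := fun j =>
        Finset.single_le_sum (f := fun i => a i * h' i)
          (fun i _ => mul_nonneg (ha i).le (h0 i)) (Finset.mem_univ j)
      set L := ∑ i, a i * h' i with hL
      have hRL : R ≤ L := by
        refine le_trans ?_ (hle i)
        simp only [Pi.smul_apply, smul_eq_mul, hb] at hi
        rw [← div_eq_mul_inv, div_lt_iff₀ (ha i)] at hi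
        linarith
      have hLpos : 0 < L := by linarith
      have hsub : poly u h' ⊆ L • poly u b := by
        rw [← poly_smul u b hLpos]
        refine poly_mono u fun j => ?_
        simp only [Pi.smul_apply, smul_eq_mul, hb]
        rw [← div_eq_mul_inv, le_div_iff₀ (ha j)]
        have := hle j
        linarith
      have hvol : (volume (poly u h')).toReal ≤ L ^ d * (volume (poly u b)).toReal := by
        have h1 := measure_mono (μ := volume) hsub
        rw [Measure.addHaar_smul] at h1
        have h2 := ENNReal.toReal_mono (ENNReal.mul_ne_top ENNReal.ofReal_ne_top (hfin b)) h1
        rw [ENNReal.toReal_mul, ENNReal.toReal_ofReal (abs_nonneg _)] at h2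
        simpa [abs_of_pos hLpos] using h2
      calc F h' ≤ (L ^ d * (volume (poly u b)).toReal) * Real.exp (-L) :=
            mul_le_mul_of_nonneg_right hvol (Real.exp_pos _).le
        _ = (volume (poly u b)).toReal * (L ^ d * Real.exp (-L)) := by ring
        _ ≤ F b := hR L hRL
        _ ≤ F h := hFbh
  have hFh : 0 < F h := lt_of_lt_of_le hFb hFbh
  refine ⟨h, pos_of_mul_pos_left hFh (Real.exp_pos _).le, fun h' => ?_⟩
  change F h' ≤ F h
  rcases (poly u h').eq_empty_or_nonempty with he | ⟨t, ht⟩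
  · have : F h' = 0 := by simp [hF, he]
    rw [this]; exact hFh.le
  · have e1 : F h' = F (fun i => h' i - ⟪t, u i⟫) := by
      simp only [hF]
      rw [poly_translate, measure_preimage_add_right]
      have hs : ∑ j, a j * ⟪t, u j⟫ = 0 := by
        have := congrArg (fun v => ⟪t, v⟫) hsum
        simpa [inner_sum, inner_smul_right] using this
      simp only [mul_sub, Finset.sum_sub_distrib, hs, sub_zero]
    rw [e1]
    exact hnn _ fun i => sub_nonneg.mpr (ht i)

end Poly

section Deriv
variable {k m : ℕ} (u : Fin m → ES (k + 1))

/-- Slices of the polyhedron obtained by dropping the `i`-th constraint. -/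
def sliceSet (h : Fin m → ℝ) (i : Fin m) (f : MFrame (u i)) (s : ℝ) : Set (ES k) :=
  {y | ∀ j, j ≠ i → ⟪f.emb y + s • u i, u j⟫ ≤ h j}

theorem slice_update (hu : ∀ i, ‖u i‖ = 1) (h : Fin m → ℝ) (i : Fin m) (f : MFrame (u i))
    (s t : ℝ) (y : ES k) : f.emb y + s • u i ∈ poly u (Function.update h i t) ↔
      s ≤ t ∧ y ∈ sliceSet u h i f s := by
  simp only [poly, sliceSet, Set.mem_ofPred_eq]
  constructor
  · intro H
    refine ⟨?_, fun j hj => ?_⟩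
    · have := H i
      rwa [f.inner_u (hu i), Function.update_self] at this
    · have := H j
      rwa [Function.update_of_ne hj] at this
  · rintro ⟨h1, h2⟩ j
    by_cases hj : j = i
    · subst hj
      rwa [f.inner_u (hu j), Function.update_self]
    · rw [Function.update_of_ne hj]
      exact h2 j hj

theorem sliceSet_closed (h : Fin m → ℝ) (i : Fin m) (f : MFrame (u i)) :
    IsClosed {p : ES k × ℝ | p.1 ∈ sliceSet u h i f p.2} := by
  have : {p : ES k × ℝ | p.1 ∈ sliceSet u h i f p.2} =
      ⋂ j, ⋂ (_ : j ≠ i), {p | ⟪f.emb p.1 + p.2 • u i, u j⟫ ≤ h j} := by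
    ext; simp [sliceSet]
  rw [this]
  have := f.emb.continuous
  exact isClosed_iInter fun j => isClosed_iInter fun _ =>
    isClosed_le (by fun_prop) (by fun_prop)

theorem sliceSet_measurable (h : Fin m → ℝ) (i : Fin m) (f : MFrame (u i)) (s : ℝ) :
    MeasurableSet (sliceSet u h i f s) := by
  have : Continuous (fun y : ES k => (y, s)) := by fun_prop
  exact ((sliceSet_closed u h i f).preimage this).measurableSet

theorem sliceSet_subset (hu : ∀ i, ‖u i‖ = 1) (hspan : Submodule.span ℝ (Set.range u) = ⊤)
    (a : Fin m → ℝ) (ha : ∀ i, 0 < a i) (hsum : ∑ i, a i • u i = 0)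
    (h : Fin m → ℝ) (i : Fin m) (f : MFrame (u i)) (t : ℝ) :
    ∃ R : ℝ, ∀ s ≤ t, sliceSet u h i f s ⊆ Metric.closedBall 0 R := by
  obtain ⟨R, hR⟩ := (poly_bounded u hspan a ha hsum (Function.update h i t)).subset_closedBall 0
  refine ⟨R, fun s hs y hy => ?_⟩
  have h1 := hR ((slice_update u hu h i f s t y).mpr ⟨hs, hy⟩)
  rw [mem_closedBall_zero_iff] at h1 ⊢
  have h2 := f.norm_sq (hu i) y s
  have h3 : 0 ≤ R := (norm_nonneg _).trans h1
  refine abs_le_of_sq_le_sq' ?_ h3 |>.2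
  nlinarith [norm_nonneg (f.emb y + s • u i), sq_nonneg s]

theorem slice_tendsto (hu : ∀ i, ‖u i‖ = 1) (huinj : Function.Injective u)
    (hspan : Submodule.span ℝ (Set.range u) = ⊤)
    (a : Fin m → ℝ) (ha : ∀ i, 0 < a i) (hsum : ∑ i, a i • u i = 0)
    (h : Fin m → ℝ) (hpos : 0 < (volume (poly u h)).toReal) (i : Fin m) (f : MFrame (u i)) :
    Tendsto (fun s => rho k (sliceSet u h i f s)) (𝓝 (h i))
      (𝓝 (rho k (sliceSet u h i f (h i)))) := by
  obtain ⟨R, hR⟩ := sliceSet_subset u hu hspan a ha hsum h i f (h i + 1)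
  refine tendsto_measure_of_ae_tendsto_indicator _ (sliceSet_measurable u h i f _)
    (sliceSet_measurable u h i f) (B := Metric.closedBall 0 R)
    Metric.isClosed_closedBall.measurableSet measure_closedBall_lt_top.ne ?_ ?_
  · filter_upwards [gt_mem_nhds (lt_add_one (h i))] with s hs
    exact hR s hs.le
  · have : ∀ᵐ y ∂(rho k), ∀ j, j ≠ i → ⟪f.emb y + h i • u i, u j⟫ ≠ h j := by
      rw [ae_all_iff]
      intro j
      by_cases hj : j = i
      · exact Eventually.of_forall fun y hy => absurd hj hy
      by_cases hneg : u j = -u i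
      · refine Eventually.of_forall fun y _ heq => ?_
        rw [hneg, inner_neg_right, f.inner_u (hu i)] at heq
        have hsub : poly u h ⊆ {x | ⟪x, u i⟫ = h i} := by
          intro x hx
          have h1 := hx i
          have h2 := hx j
          rw [hneg, inner_neg_right] at h2
          exact le_antisymm h1 (by linarith)
        have hz := measure_mono_null hsub
          (hyper_null (u i) (fun h0 => by simpa [h0] using hu i) (h i))
        simp [hz] at hpos
      · have := slice_null (hu i) f (u j) (hu j) (fun hh => hj (huinj hh)) hneg (h i) (h j)
        have h2 : ∀ᵐ y ∂(rho k), ⟪f.emb y + h i • u i, u j⟫ ≠ h j := by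
          rw [ae_iff]
          simpa using this
        filter_upwards [h2] with y hy _ using hy
    filter_upwards [this] with y hy
    have : ∀ᶠ s in 𝓝 (h i), ∀ j, (j ≠ i → ⟪f.emb y + s • u i, u j⟫ ≤ h j) ↔
        (j ≠ i → ⟪f.emb y + h i • u i, u j⟫ ≤ h j) := by
      rw [eventually_all]
      intro j
      by_cases hj : j = i
      · exact Eventually.of_forall fun s => ⟨fun _ h0 => absurd hj h0, fun _ h0 => absurd hj h0⟩
      have hc : Continuous fun s : ℝ => ⟪f.emb y + s • u i, u j⟫ := by fun_prop
      rcases lt_or_gt_of_ne (hy j hj) with hlt | hlt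
      · filter_upwards [hc.continuousAt.eventually (gt_mem_nhds hlt)] with s hs
        exact ⟨fun _ _ => hlt.le, fun _ _ => hs.le⟩
      · filter_upwards [hc.continuousAt.eventually (lt_mem_nhds hlt)] with s hs
        exact ⟨fun h5 => absurd (h5 hj) (not_le.mpr hs),
          fun h5 => absurd (h5 hj) (not_le.mpr hlt)⟩
    filter_upwards [this] with s hs
    exact forall_congr' hs

theorem vol_hasDeriv (hu : ∀ i, ‖u i‖ = 1) (huinj : Function.Injective u)
    (hspan : Submodule.span ℝ (Set.range u) = ⊤)
    (a : Fin m → ℝ) (ha : ∀ i, 0 < a i) (hsum : ∑ i, a i • u i = 0)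
    (h : Fin m → ℝ) (hpos : 0 < (volume (poly u h)).toReal) (i : Fin m) (f : MFrame (u i))
    (C : ℝ≥0) (hC : ∀ B : Set (ES (k + 1)), MeasurableSet B →
      (C : ℝ≥0∞) * volume B = ∫⁻ s : ℝ, rho k {y | f.emb y + s • u i ∈ B}) :
    HasDerivAt (fun t => (C : ℝ) * (volume (poly u (Function.update h i t))).toReal)
      (rho k (sliceSet u h i f (h i))).toReal (h i) := by
  have hfin : ∀ h, volume (poly u h) ≠ ∞ := fun h =>
    (poly_compact u hspan a ha hsum h).measure_lt_top.ne
  have hgfin : ∀ s, rho k (sliceSet u h i f s) < ∞ := by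
    intro s
    obtain ⟨R, hR⟩ := sliceSet_subset u hu hspan a ha hsum h i f s
    exact (measure_mono (hR s le_rfl)).trans_lt measure_closedBall_lt_top
  have hmeas : Measurable fun s => rho k (sliceSet u h i f s) :=
    measurable_measure_prodMk_right (sliceSet_closed u h i f).measurableSet
  set g : ℝ → ℝ := fun s => (rho k (sliceSet u h i f s)).toReal with hg
  have hlin : ∀ t, ∫⁻ s in Set.Iic t, rho k (sliceSet u h i f s) =
      (C : ℝ≥0∞) * volume (poly u (Function.update h i t)) := by
    intro t
    rw [hC _ (poly_closed u _).measurableSet, ← lintegral_indicator measurableSet_Iic]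
    refine lintegral_congr fun s => ?_
    by_cases hs : s ≤ t
    · rw [Set.indicator_of_mem (by exact hs)]
      congr 1
      ext y
      exact ((slice_update u hu h i f s t y).trans (and_iff_right hs)).symm
    · rw [Set.indicator_of_notMem (by exact hs)]
      have : {y | f.emb y + s • u i ∈ poly u (Function.update h i t)} = ∅ := by
        ext y
        simp only [Set.mem_ofPred_eq, slice_update u hu h i f s t y, hs, false_and,
          Set.mem_empty_iff_false]
      rw [this, measure_empty]
  have hgInt : ∀ t, IntegrableOn g (Set.Iic t) := by
    intro t
    refine integrable_toReal_of_lintegral_ne_top hmeas.aemeasurable ?_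
    rw [hlin t]
    exact ENNReal.mul_ne_top ENNReal.coe_ne_top (hfin _)
  have hG : ∀ t, (C : ℝ) * (volume (poly u (Function.update h i t))).toReal =
      ∫ s in Set.Iic t, g s := by
    intro t
    rw [integral_toReal hmeas.aemeasurable (Eventually.of_forall hgfin), hlin t,
      ENNReal.toReal_mul]
    simp
  have hcont : ContinuousAt g (h i) :=
    (ENNReal.tendsto_toReal (hgfin _).ne).comp
      (slice_tendsto u hu huinj hspan a ha hsum h hpos i f)
  have hd : HasDerivAt (fun t => ∫ s in (h i - 1)..t, g s) (g (h i)) (h i) := by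
    refine intervalIntegral.integral_hasDerivAt_right ?_ ?_ hcont
    · rw [intervalIntegrable_iff_integrableOn_Ioc_of_le (by linarith)]
      exact (hgInt (h i)).mono_set Set.Ioc_subset_Iic_self
    · exact hmeas.ennreal_toReal.stronglyMeasurable.stronglyMeasurableAtFilter
  have he : (fun t => (C : ℝ) * (volume (poly u (Function.update h i t))).toReal) =
      fun t => (∫ s in Set.Iic (h i - 1), g s) + ∫ s in (h i - 1)..t, g s := by
    funext t
    rw [hG, ← intervalIntegral.integral_Iic_sub_Iic (hgInt _) (hgInt _)]
    ring
  rw [he]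
  exact hd.const_add _

theorem max_slice (hu : ∀ i, ‖u i‖ = 1) (huinj : Function.Injective u)
    (hspan : Submodule.span ℝ (Set.range u) = ⊤)
    (a : Fin m → ℝ) (ha : ∀ i, 0 < a i) (hsum : ∑ i, a i • u i = 0) :
    ∃ (h : Fin m → ℝ) (c : ℝ), 0 < c ∧ 0 < (volume (poly u h)).toReal ∧
      ∀ i, μH[(k : ℝ)] {x | x ∈ poly u h ∧ ⟪x, u i⟫ = h i} = ENNReal.ofReal (c * a i) := by
  obtain ⟨h, hpos, hmax⟩ := exists_max u hu hspan a ha hsum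
  obtain ⟨C, hC0, hC⟩ := exists_fubini k
  refine ⟨h, C * (volume (poly u h)).toReal, by positivity, hpos, fun i => ?_⟩
  obtain ⟨f⟩ := exists_frame (u i) (hu i)
  have hd := vol_hasDeriv u hu huinj hspan a ha hsum h hpos i f C (hC (u i) (hu i) f)
  set G : ℝ → ℝ := fun t => (C : ℝ) * (volume (poly u (Function.update h i t))).toReal with hG
  set D := (rho k (sliceSet u h i f (h i))).toReal with hD
  have hE : HasDerivAt (fun t : ℝ => Real.exp (-(a i * t))) (Real.exp (-(a i * h i)) * (-a i))
      (h i) := by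
    have h1 : HasDerivAt (fun t : ℝ => -(a i * t)) (-a i) (h i) := by
      have h2 := (hasDerivAt_id (h i)).const_mul (-a i)
      simp only [id, neg_mul, mul_one] at h2
      exact h2
    exact h1.exp
  have hprod := hd.mul hE
  have hloc : IsLocalMax (G * fun t : ℝ => Real.exp (-(a i * t))) (h i) := by
    refine Eventually.of_forall fun t => ?_
    have h1 := hmax (Function.update h i t)
    have h2 : ∀ t, ∑ j, a j * Function.update h i t j =
        a i * t + ∑ j ∈ Finset.univ.erase i, a j * h j := by
      intro t
      rw [← Finset.add_sum_erase _ _ (Finset.mem_univ i), Function.update_self]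
      congr 1
      refine Finset.sum_congr rfl fun j hj => ?_
      rw [Function.update_of_ne (Finset.ne_of_mem_erase hj)]
    have h3 := h2 (h i)
    rw [Function.update_eq_self] at h3
    rw [h2 t, h3, neg_add, Real.exp_add, neg_add, Real.exp_add, ← mul_assoc, ← mul_assoc] at h1
    have h4 := le_of_mul_le_mul_right h1 (Real.exp_pos _)
    simp only [Pi.mul_apply, hG, Function.update_eq_self]
    rw [mul_assoc, mul_assoc]
    exact mul_le_mul_of_nonneg_left h4 C.2
  have hz := hloc.hasDerivAt_eq_zero hprod
  have hval : D = C * (volume (poly u h)).toReal * a i := by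
    have hGe : G (h i) = C * (volume (poly u h)).toReal := by
      simp only [hG, Function.update_eq_self]
    rw [← hGe]
    have he := Real.exp_pos (-(a i * h i))
    have : (D - G (h i) * a i) * Real.exp (-(a i * h i)) = 0 := by linarith
    rcases mul_eq_zero.mp this with h0 | h0
    · linarith
    · exact absurd h0 he.ne'
  rw [slice_measure (hu i) f, ← hval, hD]
  have hset : {y | f.emb y + h i • u i ∈ poly u h} = sliceSet u h i f (h i) := by
    ext y
    have := slice_update u hu h i f (h i) (h i) y
    rw [Function.update_eq_self] at this
    simpa using this
  rw [hset, ENNReal.ofReal_toReal]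
  obtain ⟨R, hR⟩ := sliceSet_subset u hu hspan a ha hsum h i f (h i)
  exact ((measure_mono (hR _ le_rfl)).trans_lt measure_closedBall_lt_top).ne

/-- Faces in other directions are null. -/
theorem face_null (hu : ∀ i, ‖u i‖ = 1) (h : Fin m → ℝ)
    (hpos : 0 < (volume (poly u h)).toReal) (hcomp : IsCompact (poly u h))
    (v : ES (k + 1)) (hv : ‖v‖ = 1) (hvu : v ∉ Set.range u) :
    μH[(k : ℝ)] (face (poly u h) v) = 0 := by
  have hbdd : BddAbove ((fun x => ⟪x, v⟫) '' poly u h) :=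
    (hcomp.image (by fun_prop)).bddAbove
  have hle : ∀ x ∈ poly u h, ⟪x, v⟫ ≤ suppFn (poly u h) v := fun x hx =>
    le_csSup hbdd ⟨x, hx, rfl⟩
  set s := suppFn (poly u h) v with hs
  have hsub : face (poly u h) v ⊆
      ⋃ j, {x | x ∈ {x | x ∈ poly u h ∧ ⟪x, u j⟫ = h j} ∧ ⟪x, v⟫ = s} := by
    rintro x ⟨hx, hxs⟩
    by_contra hcon
    simp only [Set.mem_iUnion, Set.mem_ofPred_eq, not_exists, not_and] at hcon
    have hlt : ∀ j, ⟪x, u j⟫ < h j := fun j =>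
      lt_of_le_of_ne (hx j) fun h1 => hcon j ⟨hx, h1⟩ hxs
    obtain ⟨ε, hε, hp⟩ := small_pert (fun j => h j - ⟪x, u j⟫) (fun j => ⟪v, u j⟫)
    have hmem : x + ε • v ∈ poly u h := by
      intro j
      have h1 := hp j (by simpa using hlt j)
      rw [inner_add_left, inner_smul_left, conj_trivial]
      nlinarith [le_abs_self ⟪v, u j⟫]
    have h2 := hle _ hmem
    rw [inner_add_left, inner_smul_left, conj_trivial, real_inner_self_eq_norm_sq, hv, hxs] at h2
    linarith
  refine measure_mono_null hsub (measure_iUnion_null fun j => ?_)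
  obtain ⟨f⟩ := exists_frame v hv
  by_cases hneg : u j = -v
  · have : {x | x ∈ {x | x ∈ poly u h ∧ ⟪x, u j⟫ = h j} ∧ ⟪x, v⟫ = s} = ∅ := by
      ext x
      simp only [Set.mem_ofPred_eq, Set.mem_empty_iff_false, iff_false]
      rintro ⟨⟨hx, h1⟩, h2⟩
      rw [hneg, inner_neg_right, h2] at h1
      have hsub : poly u h ⊆ {x | ⟪x, v⟫ = s} := by
        intro z hz
        have h3 := hz j
        rw [hneg, inner_neg_right] at h3
        exact le_antisymm (hle z hz) (by linarith)
      have hz := measure_mono_null hsub (hyper_null v (fun h0 => by simp [h0] at hv) s)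
      simp [hz] at hpos
    rw [this, measure_empty]
  · rw [slice_measure hv f]
    refine measure_mono_null ?_
      (slice_null hv f (u j) (hu j) (fun h0 => hvu ⟨j, h0⟩) hneg s (h j))
    rintro y ⟨_, hy⟩
    exact hy

end Deriv

theorem minkowski_aux (k : ℕ) (hk : 1 ≤ k) (m : ℕ)
    (u : Fin m → ES (k + 1)) (hu : ∀ i, ‖u i‖ = 1)
    (huinj : Function.Injective u)
    (hspan : Submodule.span ℝ (Set.range u) = ⊤)
    (a : Fin m → ℝ) (ha : ∀ i, 0 < a i)
    (hsum : ∑ i, a i • u i = 0) :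
    ∃ (S : Finset (ES (k + 1))) (P : Set (ES (k + 1))),
      P = convexHull ℝ (S : Set (ES (k + 1))) ∧
      (interior P).Nonempty ∧
      (∀ i, μH[(k : ℝ)] (face P (u i)) = ENNReal.ofReal (a i)) ∧
      (∀ v : ES (k + 1), ‖v‖ = 1 → v ∉ Set.range u →
        μH[(k : ℝ)] (face P v) = 0) := by
  obtain ⟨h0, c, hc, hpos0, hsl0⟩ := max_slice u hu huinj hspan a ha hsum
  set r : ℝ := (c⁻¹) ^ ((k : ℝ)⁻¹) with hr
  have hrpos : 0 < r := by positivity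
  have hrk : r ^ (k : ℝ) = c⁻¹ := by
    rw [hr, ← Real.rpow_mul (by positivity), inv_mul_cancel₀ (by positivity), Real.rpow_one]
  set h := r • h0 with hh
  have hcomp := poly_compact u hspan a ha hsum h
  have hpos : 0 < (volume (poly u h)).toReal := by
    rw [hh, poly_smul u h0 hrpos, Measure.addHaar_smul, ENNReal.toReal_mul]
    refine mul_pos (ENNReal.toReal_pos ?_ ENNReal.ofReal_ne_top) hpos0
    rw [Ne, ENNReal.ofReal_eq_zero, not_le]
    positivity
  have hsl : ∀ i, μH[(k : ℝ)] {x | x ∈ poly u h ∧ ⟪x, u i⟫ = h i} = ENNReal.ofReal (a i) := by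
    intro i
    have hset : {x | x ∈ poly u h ∧ ⟪x, u i⟫ = h i} =
        r • {x | x ∈ poly u h0 ∧ ⟪x, u i⟫ = h0 i} := by
      ext x
      rw [Set.mem_smul_set_iff_inv_smul_mem₀ hrpos.ne', hh, poly_smul u h0 hrpos]
      simp only [Set.mem_ofPred_eq, Set.mem_smul_set_iff_inv_smul_mem₀ hrpos.ne', inner_smul_left,
        conj_trivial, Pi.smul_apply, smul_eq_mul, inv_mul_eq_iff_eq_mul₀ hrpos.ne']
    rw [hset, Measure.hausdorffMeasure_smul₀ (by positivity) hrpos.ne', hsl0 i,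
      ENNReal.smul_def, smul_eq_mul]
    have : (((‖r‖₊ ^ (k : ℝ) : ℝ≥0)) : ℝ≥0∞) = ENNReal.ofReal (c⁻¹) := by
      rw [← hrk, ENNReal.ofReal]
      congr 1
      ext
      rw [Real.coe_toNNReal _ (by positivity)]
      simp [abs_of_pos hrpos]
    rw [this, ← ENNReal.ofReal_mul (by positivity), inv_mul_cancel_left₀ hc.ne']
  obtain ⟨S, hS⟩ := poly_hull u h hcomp
  refine ⟨S, poly u h, hS, ?_, fun i => ?_, fun v hv hvu =>
    face_null u hu h hpos hcomp v hv hvu⟩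
  · by_contra hemp
    rw [Set.not_nonempty_iff_eq_empty] at hemp
    have h1 := (poly_convex u h).addHaar_frontier volume
    rw [(poly_closed u h).frontier_eq, hemp, Set.sdiff_empty] at h1
    simp [h1] at hpos
  · have hne : {x | x ∈ poly u h ∧ ⟪x, u i⟫ = h i}.Nonempty := by
      rw [Set.nonempty_iff_ne_empty]
      intro he
      have h1 := hsl i
      rw [he, measure_empty] at h1
      exact (ENNReal.ofReal_pos.mpr (ha i)).ne h1
    obtain ⟨x, hx, hxi⟩ := hne
    have hsupp : suppFn (poly u h) (u i) = h i := by
      have : IsGreatest ((fun x => ⟪x, u i⟫) '' poly u h) (h i) := by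
        refine ⟨⟨x, hx, hxi⟩, ?_⟩
        rintro _ ⟨z, hz, rfl⟩
        exact hz i
      exact this.csSup_eq
    rw [← hsl i, face, hsupp]

end Helpers

/-- Minkowski's existence theorem, polytopal case: given pairwise distinct unit vectors
`u 1, …, u m` spanning `ℝⁿ` and positive reals `a 1, …, a m` with `∑ a i • u i = 0`, there is a
convex polytope with nonempty interior whose face in direction `u i` has `(n-1)`-dimensional
Hausdorff measure `a i`, and whose faces in all other unit directions are `(n-1)`-null. -/
theorem minkowski_existence_polytope (n : ℕ) (hn : 2 ≤ n) (m : ℕ)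
    (u : Fin m → EuclideanSpace ℝ (Fin n)) (hu : ∀ i, ‖u i‖ = 1)
    (huinj : Function.Injective u)
    (hspan : Submodule.span ℝ (Set.range u) = ⊤)
    (a : Fin m → ℝ) (ha : ∀ i, 0 < a i)
    (hsum : ∑ i, a i • u i = 0) :
    ∃ (S : Finset (EuclideanSpace ℝ (Fin n))) (P : Set (EuclideanSpace ℝ (Fin n))),
      P = convexHull ℝ (S : Set (EuclideanSpace ℝ (Fin n))) ∧
      (interior P).Nonempty ∧
      (∀ i, μH[(n : ℝ) - 1] (face P (u i)) = ENNReal.ofReal (a i)) ∧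
      (∀ v : EuclideanSpace ℝ (Fin n), ‖v‖ = 1 → v ∉ Set.range u →
        μH[(n : ℝ) - 1] (face P v) = 0) := by
  obtain ⟨k, rfl⟩ : ∃ k, n = k + 1 := ⟨n - 1, by omega⟩
  have hk : ((k + 1 : ℕ) : ℝ) - 1 = (k : ℝ) := by push_cast; ring
  rw [hk]
  exact minkowski_aux k (by omega) m u hu huinj hspan a ha hsum
end

section
/- (Minkowski uniqueness theorem, polytopal case) Let n ≥ 2 and let P and Q be convex polytopes in ℝ^n with nonempty interior such that for every unit vector u the faces F(P, u) and F(Q, u) have equal (n−1)-dimensional Hausdorff measure. Then Q is a translate of P: there exists t ∈ ℝ^n with Q = t + P. -/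
open MeasureTheory RealInnerProductSpace

open scoped ENNReal Pointwise


theorem bm_one_compact {A B : Set ℝ} (hA : IsCompact A) (hB : IsCompact B) (hAn : A.Nonempty)
    (hBn : B.Nonempty) : volume A + volume B ≤ volume (A + B) := by
  obtain ⟨a, haA, ha⟩ := hA.exists_isGreatest hAn
  obtain ⟨b, hbB, hb⟩ := hB.exists_isLeast hBn
  have h1 : volume ((fun x => x + b) '' A) = volume A := by
    simp
  have h2 : volume ((fun x => a + x) '' B) = volume B := by
    simp
  have hd : AEDisjoint volume ((fun x => x + b) '' A) ((fun x => a + x) '' B) := by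
    refine measure_mono_null (t := {a + b}) ?_ (by simp)
    rintro _ ⟨⟨x, hx, rfl⟩, ⟨y, hy, hxy⟩⟩
    have := ha hx
    have := hb hy
    simp only [Set.mem_singleton_iff] at *
    linarith
  have hm : NullMeasurableSet ((fun x => a + x) '' B) volume :=
    (hB.image (by fun_prop)).measurableSet.nullMeasurableSet
  rw [← h1, ← h2, ← measure_union₀ hm hd]
  apply measure_mono
  rintro _ (⟨x, hx, rfl⟩ | ⟨y, hy, rfl⟩)
  · exact Set.add_mem_add hx hbB
  · exact Set.add_mem_add haA hy

theorem bm_one {A B C : Set ℝ} (hA : MeasurableSet A) (hB : MeasurableSet B) (hAn : A.Nonempty)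
    (hBn : B.Nonempty) (hC : ∀ x ∈ A, ∀ y ∈ B, (x + y) / 2 ∈ C) :
    volume A + volume B ≤ 2 * volume C := by
  have key : ∀ K, K ⊆ A → IsCompact K → ∀ L, L ⊆ B → IsCompact L →
      volume K + volume L ≤ 2 * volume C := by
    intro K hKA hK L hLB hL
    obtain ⟨a, ha⟩ := hAn
    obtain ⟨b, hb⟩ := hBn
    calc volume K + volume L ≤ volume (insert a K) + volume (insert b L) := by
          gcongr <;> exact Set.subset_insert _ _
      _ ≤ volume (insert a K + insert b L) :=
          bm_one_compact (hK.insert a) (hL.insert b) (by simp) (by simp)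
      _ ≤ volume ((2 : ℝ) • C) := by
          apply measure_mono
          rintro _ ⟨x, hx, y, hy, rfl⟩
          have hx' : x ∈ A := by
            rcases hx with rfl | hx
            exacts [ha, hKA hx]
          have hy' : y ∈ B := by
            rcases hy with rfl | hy
            exacts [hb, hLB hy]
          refine ⟨(x + y) / 2, hC x hx' y hy', ?_⟩
          simp only [smul_eq_mul]
          ring
      _ = 2 * volume C := by
          rw [Measure.addHaar_smul]; simp
  rw [hA.measure_eq_iSup_isCompact, hB.measure_eq_iSup_isCompact]
  simp only [iSup_and']
  refine ENNReal.biSup_add_biSup_le' ⟨∅, by simp⟩ ⟨∅, by simp⟩ ?_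
  rintro K ⟨hK, hK'⟩ L ⟨hL, hL'⟩
  exact key K hK hK' L hL hL'

theorem ennreal_amgm (x y : ℝ≥0∞) : 4 * (x * y) ≤ (x + y) ^ 2 := by
  rcases eq_or_ne x ⊤ with rfl | hx
  · simp
  rcases eq_or_ne y ⊤ with rfl | hy
  · simp
  lift x to NNReal using hx
  lift y to NNReal using hy
  norm_cast
  rw [← NNReal.coe_le_coe]
  push_cast
  nlinarith [sq_nonneg ((x : ℝ) - y)]

theorem pl_one_norm {F G H : ℝ → ℝ} (hF : Measurable F) (hG : Measurable G) (hH : Measurable H)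
    (hF0 : ∀ x, 0 ≤ F x) (hG0 : ∀ x, 0 ≤ G x) (hH0 : ∀ x, 0 ≤ H x)
    (hF1 : ∀ x, F x ≤ 1) (hG1 : ∀ x, G x ≤ 1)
    (hFs : ∀ s, 0 < s → s < 1 → ∃ x, s < F x) (hGs : ∀ s, 0 < s → s < 1 → ∃ x, s < G x)
    (h : ∀ x y, F x * G y ≤ H ((x + y) / 2) ^ 2) :
    (∫⁻ x, ENNReal.ofReal (F x)) + (∫⁻ x, ENNReal.ofReal (G x)) ≤
      2 * ∫⁻ x, ENNReal.ofReal (H x) := by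
  rw [lintegral_eq_lintegral_meas_lt _ (.of_forall hF0) hF.aemeasurable,
    lintegral_eq_lintegral_meas_lt _ (.of_forall hG0) hG.aemeasurable,
    lintegral_eq_lintegral_meas_lt _ (.of_forall hH0) hH.aemeasurable,
    ← lintegral_const_mul' _ _ (by simp), ← lintegral_add_left']
  · refine setLIntegral_mono' measurableSet_Ioi ?_
    intro s hs
    rcases lt_or_ge s 1 with hs1 | hs1
    · refine bm_one (measurableSet_lt measurable_const hF) (measurableSet_lt measurable_const hG)
        (hFs s hs hs1) (hGs s hs hs1) ?_
      intro x hx y hy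
      simp only [Set.mem_ofPred_eq, Set.mem_Ioi] at *
      have := h x y
      have h3 := hH0 ((x + y) / 2)
      have : s * s < F x * G y := mul_lt_mul'' hx hy hs.le hs.le
      nlinarith
    · have e1 : {a | s < F a} = ∅ := by
        ext a; simp; linarith [hF1 a]
      have e2 : {a | s < G a} = ∅ := by
        ext a; simp; linarith [hG1 a]
      simp [e1, e2]
  · apply Measurable.aemeasurable
    refine Antitone.measurable ?_
    intro s t hst
    exact measure_mono fun x hx => lt_of_le_of_lt hst hx

theorem pl_one_bdd {f g h : ℝ → ℝ≥0∞} (hf : Measurable f) (hg : Measurable g) (hh : Measurable h)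
    (i j : ℕ) (hfi : ∀ x, f x ≤ i) (hgj : ∀ x, g x ≤ j)
    (hfg : ∀ x y, f x * g y ≤ h ((x + y) / 2) ^ 2) :
    (∫⁻ x, f x) * (∫⁻ x, g x) ≤ (∫⁻ x, h x) ^ 2 := by
  set a := ⨆ x, f x with ha
  set b := ⨆ x, g x with hb
  have hat : a ≠ ⊤ := ne_top_of_le_ne_top (ENNReal.natCast_ne_top i) (iSup_le hfi)
  have hbt : b ≠ ⊤ := ne_top_of_le_ne_top (ENNReal.natCast_ne_top j) (iSup_le hgj)
  have hfa : ∀ x, f x ≤ a := fun x => le_iSup f x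
  have hgb : ∀ x, g x ≤ b := fun x => le_iSup g x
  rcases eq_or_ne a 0 with ha0 | ha0
  · have : ∀ x, f x = 0 := fun x => by simpa [ha0] using hfa x
    simp [this]
  rcases eq_or_ne b 0 with hb0 | hb0
  · have : ∀ x, g x = 0 := fun x => by simpa [hb0] using hgb x
    simp [this]
  set α := a.toReal with hα
  set β := b.toReal with hβ
  have hα0 : 0 < α := ENNReal.toReal_pos ha0 hat
  have hβ0 : 0 < β := ENNReal.toReal_pos hb0 hbt
  have haα : a = ENNReal.ofReal α := (ENNReal.ofReal_toReal hat).symm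
  have hbβ : b = ENNReal.ofReal β := (ENNReal.ofReal_toReal hbt).symm
  set c := Real.sqrt (α * β) with hc
  have hc0 : 0 < c := Real.sqrt_pos.2 (mul_pos hα0 hβ0)
  have hcc : c ^ 2 = α * β := Real.sq_sqrt (mul_pos hα0 hβ0).le
  have hft : ∀ x, f x ≠ ⊤ := fun x => ne_top_of_le_ne_top hat (hfa x)
  have hgt : ∀ x, g x ≠ ⊤ := fun x => ne_top_of_le_ne_top hbt (hgb x)
  have hmt : ∀ x, min (h x) (ENNReal.ofReal c) ≠ ⊤ :=
    fun x => ne_top_of_le_ne_top ENNReal.ofReal_ne_top (min_le_right _ _)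
  let F : ℝ → ℝ := fun x => (f x).toReal / α
  let G : ℝ → ℝ := fun x => (g x).toReal / β
  let H : ℝ → ℝ := fun x => (min (h x) (ENNReal.ofReal c)).toReal / c
  have eF : ∀ x, f x = a * ENNReal.ofReal (F x) := by
    intro x
    rw [haα, ← ENNReal.ofReal_mul hα0.le, mul_div_cancel₀ _ hα0.ne', ENNReal.ofReal_toReal (hft x)]
  have eG : ∀ x, g x = b * ENNReal.ofReal (G x) := by
    intro x
    rw [hbβ, ← ENNReal.ofReal_mul hβ0.le, mul_div_cancel₀ _ hβ0.ne', ENNReal.ofReal_toReal (hgt x)]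
  have eH : ∀ x, ENNReal.ofReal c * ENNReal.ofReal (H x) ≤ h x := by
    intro x
    rw [← ENNReal.ofReal_mul hc0.le, mul_div_cancel₀ _ hc0.ne', ENNReal.ofReal_toReal (hmt x)]
    exact min_le_left _ _
  have key := pl_one_norm (F := F) (G := G) (H := H) (by fun_prop) (by fun_prop) (by fun_prop)
    (fun x => by positivity) (fun x => by positivity) (fun x => by positivity)
    (fun x => by
      rw [div_le_one hα0]; exact ENNReal.toReal_mono hat (hfa x))
    (fun x => by
      rw [div_le_one hβ0]; exact ENNReal.toReal_mono hbt (hgb x))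
    (fun s hs0 hs => by
      have : ENNReal.ofReal (s * α) < a := by
        rw [haα]; apply (ENNReal.ofReal_lt_ofReal_iff hα0).2; nlinarith
      obtain ⟨x, hx⟩ := lt_iSup_iff.1 this
      refine ⟨x, ?_⟩
      rw [lt_div_iff₀ hα0]
      exact (ENNReal.ofReal_lt_iff_lt_toReal (by positivity) (hft x)).1 hx)
    (fun s hs0 hs => by
      have : ENNReal.ofReal (s * β) < b := by
        rw [hbβ]; apply (ENNReal.ofReal_lt_ofReal_iff hβ0).2; nlinarith
      obtain ⟨x, hx⟩ := lt_iSup_iff.1 this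
      refine ⟨x, ?_⟩
      rw [lt_div_iff₀ hβ0]
      exact (ENNReal.ofReal_lt_iff_lt_toReal (by positivity) (hgt x)).1 hx)
    (fun x y => by
      have h1 : f x * g y ≤ (min (h ((x + y) / 2)) (ENNReal.ofReal c)) ^ 2 := by
        rcases le_total (h ((x + y) / 2)) (ENNReal.ofReal c) with h2 | h2
        · rw [min_eq_left h2]; exact hfg x y
        · rw [min_eq_right h2, ← ENNReal.ofReal_pow hc0.le, hcc, ENNReal.ofReal_mul hα0.le,
            ← haα, ← hbβ]
          exact mul_le_mul' (hfa x) (hgb y)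
      have h2 := ENNReal.toReal_mono (by simp [hmt]) h1
      rw [ENNReal.toReal_mul, ENNReal.toReal_pow] at h2
      simp only [F, G, H]
      rw [div_mul_div_comm, div_pow, hcc]
      gcongr)
  have hcE : ENNReal.ofReal c ^ 2 = a * b := by
    rw [← ENNReal.ofReal_pow hc0.le, hcc, ENNReal.ofReal_mul hα0.le, ← haα, ← hbβ]
  set IF := ∫⁻ x, ENNReal.ofReal (F x)
  set IG := ∫⁻ x, ENNReal.ofReal (G x)
  set IH := ∫⁻ x, ENNReal.ofReal (H x)
  have h1 : (∫⁻ x, f x) = a * IF := by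
    simp_rw [eF]; rw [lintegral_const_mul' _ _ hat]
  have h2 : (∫⁻ x, g x) = b * IG := by
    simp_rw [eG]; rw [lintegral_const_mul' _ _ hbt]
  have h3 : ENNReal.ofReal c * IH ≤ ∫⁻ x, h x := by
    rw [← lintegral_const_mul' _ _ (by simp)]; exact lintegral_mono eH
  have h4 : IF * IG ≤ IH ^ 2 := by
    have : 4 * (IF * IG) ≤ 4 * IH ^ 2 := by
      refine (ennreal_amgm _ _).trans ?_
      calc (IF + IG) ^ 2 ≤ (2 * IH) ^ 2 := by gcongr
        _ = 4 * IH ^ 2 := by rw [mul_pow]; norm_num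
    exact (ENNReal.mul_le_mul_iff_right (by norm_num) (by simp)).1 this
  calc (∫⁻ x, f x) * (∫⁻ x, g x) = (a * b) * (IF * IG) := by rw [h1, h2]; ring
    _ ≤ ENNReal.ofReal c ^ 2 * IH ^ 2 := by rw [hcE]; gcongr
    _ = (ENNReal.ofReal c * IH) ^ 2 := by ring
    _ ≤ _ := by gcongr

theorem lintegral_trunc {f : ℝ → ℝ≥0∞} (hf : Measurable f) :
    ∫⁻ x, f x = ⨆ i : ℕ, ∫⁻ x, min (f x) i := by
  rw [← lintegral_iSup (fun i => by fun_prop)]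
  · congr with x
    apply le_antisymm
    · rcases eq_or_ne (f x) ⊤ with h | h
      · simp [h, ENNReal.iSup_natCast]
      · obtain ⟨k, hk⟩ := ENNReal.exists_nat_gt h
        exact le_iSup_of_le k (by simp [hk.le])
    · exact iSup_le fun i => min_le_left _ _
  · intro i j hij x
    dsimp
    gcongr

theorem pl_one {f g h : ℝ → ℝ≥0∞} (hf : Measurable f) (hg : Measurable g) (hh : Measurable h)
    (hfg : ∀ x y, f x * g y ≤ h ((x + y) / 2) ^ 2) :
    (∫⁻ x, f x) * (∫⁻ x, g x) ≤ (∫⁻ x, h x) ^ 2 := by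
  rw [lintegral_trunc hf, lintegral_trunc hg, ENNReal.iSup_mul]
  refine iSup_le fun i => ?_
  rw [ENNReal.mul_iSup]
  refine iSup_le fun j => ?_
  refine pl_one_bdd (by fun_prop) (by fun_prop) hh i j (fun x => min_le_right _ _)
    (fun x => min_le_right _ _) (fun x y => le_trans ?_ (hfg x y))
  gcongr <;> exact min_le_left _ _

theorem lintegral_fin_succ {n : ℕ} {f : (Fin (n + 1) → ℝ) → ℝ≥0∞} (hf : Measurable f) :
    ∫⁻ x, f x = ∫⁻ s : ℝ, ∫⁻ y : Fin n → ℝ, f (Fin.cons s y) := by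
  have e := (volume_preserving_piFinSuccAbove (fun _ : Fin (n + 1) => ℝ) 0).symm
  rw [← e.lintegral_comp hf]
  erw [lintegral_prod]
  · simp [MeasurableEquiv.piFinSuccAbove, Fin.insertNthEquiv]
  · exact (hf.comp e.measurable).aemeasurable

theorem pl_fin (n : ℕ) : ∀ {f g h : (Fin n → ℝ) → ℝ≥0∞}, Measurable f → Measurable g →
    Measurable h → (∀ x y, f x * g y ≤ h ((2⁻¹ : ℝ) • (x + y)) ^ 2) →
    (∫⁻ x, f x) * (∫⁻ x, g x) ≤ (∫⁻ x, h x) ^ 2 := by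
  induction n with
  | zero =>
    intro f g h hf hg hh hfg
    simp only [Measure.volume_pi_eq_dirac (0 : Fin 0 → ℝ)]
    rw [lintegral_dirac' _ hf, lintegral_dirac' _ hg, lintegral_dirac' _ hh]
    simpa using hfg 0 0
  | succ n ih =>
    intro f g h hf hg hh hfg
    have hc : Measurable (fun p : ℝ × (Fin n → ℝ) => (Fin.cons p.1 p.2 : Fin (n + 1) → ℝ)) := by
      rw [measurable_pi_iff]
      intro i
      refine Fin.cases ?_ (fun j => ?_) i
      · simpa using measurable_fst
      · simp only [Fin.cons_succ]; fun_prop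
    rw [lintegral_fin_succ hf, lintegral_fin_succ hg, lintegral_fin_succ hh]
    refine pl_one (Measurable.lintegral_prod_right' (hf.comp hc))
      (Measurable.lintegral_prod_right' (hg.comp hc))
      (Measurable.lintegral_prod_right' (hh.comp hc)) ?_
    intro s t
    refine ih (hf.comp (hc.comp measurable_prodMk_left)) (hg.comp (hc.comp measurable_prodMk_left))
      (hh.comp (hc.comp measurable_prodMk_left)) ?_
    intro x y
    refine (hfg _ _).trans (le_of_eq ?_)
    congr 2
    ext i
    refine Fin.cases ?_ (fun j => ?_) i
    · simp; ring
    · simp; ring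

/-- Multiplicative Brunn-Minkowski inequality for midpoints. -/
theorem bm_half {n : ℕ} {A B C : Set (EuclideanSpace ℝ (Fin n))} (hA : MeasurableSet A)
    (hB : MeasurableSet B) (hC : MeasurableSet C)
    (h : ∀ x ∈ A, ∀ y ∈ B, (2⁻¹ : ℝ) • (x + y) ∈ C) :
    volume A * volume B ≤ volume C ^ 2 := by
  have e := PiLp.volume_preserving_toLp (Fin n)
  have hi : ∀ D : Set (EuclideanSpace ℝ (Fin n)), MeasurableSet D →
      volume D = ∫⁻ x, (WithLp.toLp 2 ⁻¹' D).indicator 1 x := by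
    intro D hD
    rw [lintegral_indicator_one (e.measurable hD), e.measure_preimage hD.nullMeasurableSet]
  rw [hi A hA, hi B hB, hi C hC]
  refine pl_fin n (measurable_one.indicator (e.measurable hA))
    (measurable_one.indicator (e.measurable hB)) (measurable_one.indicator (e.measurable hC)) ?_
  intro x y
  by_cases hx : WithLp.toLp 2 x ∈ A
  · by_cases hy : WithLp.toLp 2 y ∈ B
    · have := h _ hx _ hy
      rw [← WithLp.toLp_add, ← WithLp.toLp_smul] at this
      have h2 : (2⁻¹ : ℝ) • (x + y) ∈ (WithLp.toLp 2 ⁻¹' C : Set (Fin n → ℝ)) := this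
      rw [Set.indicator_of_mem h2]
      simp [Set.indicator, hx, hy]
    · simp [Set.indicator, hy]
  · simp [Set.indicator, hx]

section supp

variable {n : ℕ} {K : Set (EuclideanSpace ℝ (Fin n))}

theorem le_suppFn (hK : IsCompact K) {x : EuclideanSpace ℝ (Fin n)} (hx : x ∈ K)
    (u : EuclideanSpace ℝ (Fin n)) : ⟪x, u⟫ ≤ suppFn K u :=
  le_csSup (hK.image (f := fun x => ⟪x, u⟫) (by fun_prop)).bddAbove ⟨x, hx, rfl⟩

theorem suppFn_le (hn : K.Nonempty) {u : EuclideanSpace ℝ (Fin n)} {c : ℝ}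
    (h : ∀ x ∈ K, ⟪x, u⟫ ≤ c) : suppFn K u ≤ c := by
  apply csSup_le (hn.image _)
  rintro _ ⟨x, hx, rfl⟩
  exact h x hx

theorem exists_chart {m : ℕ} (u : EuclideanSpace ℝ (Fin (m + 1))) (hu : ‖u‖ = 1) :
    ∃ J : (Fin m → ℝ) →ₗ[ℝ] EuclideanSpace ℝ (Fin (m + 1)), (∀ y, ⟪J y, u⟫ = 0) ∧
      MeasurePreserving (fun p : ℝ × (Fin m → ℝ) => p.1 • u + J p.2) volume volume ∧
      Isometry (fun y : EuclideanSpace ℝ (Fin m) => J (WithLp.ofLp y)) ∧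
      ∀ x, ∃ y, x = ⟪x, u⟫ • u + J y := by
  obtain ⟨b, hb⟩ := Orthonormal.exists_orthonormalBasis_extension_of_card_eq (𝕜 := ℝ)
    (E := EuclideanSpace ℝ (Fin (m + 1))) (ι := Fin (m + 1)) (by simp) (v := fun _ => u)
    (s := {0}) (by
      refine ⟨fun i => by simpa using hu, fun i j hij => absurd (Subsingleton.elim i j) hij⟩)
  have hb0 : b 0 = u := hb 0 (by simp)
  let J : (Fin m → ℝ) →ₗ[ℝ] EuclideanSpace ℝ (Fin (m + 1)) :=
    { toFun := fun y => b.repr.symm (WithLp.toLp 2 (Fin.cons 0 y))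
      map_add' := by
        intro x y
        rw [← map_add, ← WithLp.toLp_add]
        congr 2
        ext i
        refine Fin.cases ?_ (fun j => ?_) i <;> simp
      map_smul' := by
        intro c y
        simp only [RingHom.id_apply]
        rw [← map_smul, ← WithLp.toLp_smul]
        congr 2
        ext i
        refine Fin.cases ?_ (fun j => ?_) i <;> simp }
  have hJ : ∀ y, J y = b.repr.symm (WithLp.toLp 2 (Fin.cons 0 y)) := fun y => rfl
  have hsJ : ∀ s y, s • u + J y = b.repr.symm (WithLp.toLp 2 (Fin.cons s y)) := by
    intro s y
    rw [hJ, ← hb0, ← b.repr_symm_single, ← map_smul, ← map_add]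
    congr 1
    ext i
    refine Fin.cases ?_ (fun j => ?_) i <;> simp
  refine ⟨J, ?_, ?_, ?_, ?_⟩
  · intro y
    rw [real_inner_comm, ← hb0, ← b.repr_apply_apply, hJ]
    simp
  · have e := (volume_preserving_piFinSuccAbove (fun _ : Fin (m + 1) => ℝ) 0).symm
    have e2 := (b.repr.symm.measurePreserving.comp
      (PiLp.volume_preserving_toLp (Fin (m + 1)))).comp e
    have hfun : (fun p : ℝ × (Fin m → ℝ) => p.1 • u + J p.2) = (b.repr.symm ∘ WithLp.toLp 2) ∘
        (MeasurableEquiv.piFinSuccAbove (fun _ : Fin (m + 1) => ℝ) 0).symm := by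
      funext p
      rw [hsJ]
      simp [MeasurableEquiv.piFinSuccAbove, Fin.insertNthEquiv]
    rw [hfun]
    exact e2
  · let J' : EuclideanSpace ℝ (Fin m) →ₗ[ℝ] EuclideanSpace ℝ (Fin (m + 1)) :=
      J ∘ₗ (WithLp.linearEquiv 2 ℝ (Fin m → ℝ)).toLinearMap
    refine AddMonoidHomClass.isometry_of_norm J' ?_
    intro y
    change ‖J (WithLp.ofLp y)‖ = ‖y‖
    rw [hJ, LinearIsometryEquiv.norm_map, EuclideanSpace.norm_eq, EuclideanSpace.norm_eq,
      Fin.sum_univ_succ]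
    simp
  · intro x
    refine ⟨Fin.tail (b.repr x), ?_⟩
    rw [hsJ, real_inner_comm, ← hb0, ← b.repr_apply_apply, LinearIsometryEquiv.eq_symm_apply]
    ext i
    refine Fin.cases ?_ (fun j => ?_) i <;> simp [Fin.tail]

open Classical in
/-- A linear parametrization of the hyperplane orthogonal to `u`. -/
noncomputable def Jc {m : ℕ} (u : EuclideanSpace ℝ (Fin (m + 1))) :
    (Fin m → ℝ) →ₗ[ℝ] EuclideanSpace ℝ (Fin (m + 1)) :=
  if hu : ‖u‖ = 1 then (exists_chart u hu).choose else 0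

theorem Jc_spec {m : ℕ} (u : EuclideanSpace ℝ (Fin (m + 1))) (hu : ‖u‖ = 1) :
    (∀ y, ⟪Jc u y, u⟫ = 0) ∧
      MeasurePreserving (fun p : ℝ × (Fin m → ℝ) => p.1 • u + Jc u p.2) volume volume ∧
      Isometry (fun y : EuclideanSpace ℝ (Fin m) => Jc u (WithLp.ofLp y)) ∧
      ∀ x, ∃ y, x = ⟪x, u⟫ • u + Jc u y := by
  unfold Jc
  rw [dif_pos hu]
  exact (exists_chart u hu).choose_spec

theorem Jc_cont {m : ℕ} (u : EuclideanSpace ℝ (Fin (m + 1))) : Continuous (Jc u) :=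
  LinearMap.continuous_of_finiteDimensional _

theorem Jc_inner {m : ℕ} {u : EuclideanSpace ℝ (Fin (m + 1))} (hu : ‖u‖ = 1) (s : ℝ)
    (y : Fin m → ℝ) : ⟪s • u + Jc u y, u⟫ = s := by
  rw [inner_add_left, (Jc_spec u hu).1, real_inner_smul_left, real_inner_self_eq_norm_sq, hu]
  simp

/-- Lebesgue area of the face in direction `u`. -/
noncomputable def ar {m : ℕ} (K : Set (EuclideanSpace ℝ (Fin (m + 1))))
    (u : EuclideanSpace ℝ (Fin (m + 1))) : ℝ≥0∞ :=
  volume {y : Fin m → ℝ | suppFn K u • u + Jc u y ∈ K}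

theorem hausdorff_face (m : ℕ) : ∃ c : ℝ≥0∞, c ≠ 0 ∧ c ≠ ⊤ ∧
    ∀ (K : Set (EuclideanSpace ℝ (Fin (m + 1)))) (u : EuclideanSpace ℝ (Fin (m + 1))),
      ‖u‖ = 1 → μH[(m : ℝ)] (face K u) = c * ar K u := by
  have hH : Measure.IsAddHaarMeasure (μH[(m : ℝ)] : Measure (EuclideanSpace ℝ (Fin m))) := by
    simpa using MeasureTheory.isAddHaarMeasure_hausdorffMeasure (E := EuclideanSpace ℝ (Fin m))
  have heq := Measure.isAddLeftInvariant_eq_smul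
    (μH[(m : ℝ)] : Measure (EuclideanSpace ℝ (Fin m))) volume
  set c := Measure.addHaarScalarFactor (μH[(m : ℝ)] : Measure (EuclideanSpace ℝ (Fin m))) volume
  refine ⟨c, ?_, by simp, ?_⟩
  · simpa using (Measure.addHaarScalarFactor_pos_of_isAddHaarMeasure _ _).ne'
  · intro K u hu
    obtain ⟨h1, -, h3, h4⟩ := Jc_spec u hu
    have hface : face K u = (fun y : EuclideanSpace ℝ (Fin m) =>
        suppFn K u • u + Jc u (WithLp.ofLp y)) ''
          (WithLp.ofLp ⁻¹' {y : Fin m → ℝ | suppFn K u • u + Jc u y ∈ K}) := by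
      ext x
      constructor
      · rintro ⟨hx, hxu⟩
        obtain ⟨y, hy⟩ := h4 x
        rw [hxu] at hy
        exact ⟨WithLp.toLp 2 y, by simpa [← hy] using hx, by simpa using hy.symm⟩
      · rintro ⟨y, hy, rfl⟩
        exact ⟨hy, Jc_inner hu _ _⟩
    have hiso : Isometry (fun y : EuclideanSpace ℝ (Fin m) =>
        suppFn K u • u + Jc u (WithLp.ofLp y)) :=
      (IsometryEquiv.addLeft (suppFn K u • u)).isometry.comp h3
    rw [hface, hiso.hausdorffMeasure_image (Or.inl (by positivity)), heq]
    rw [Measure.smul_apply]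
    have := (PiLp.volume_preserving_ofLp (Fin m)).measure_preimage_equiv
      (f := (MeasurableEquiv.toLp 2 (Fin m → ℝ)).symm)
      {y : Fin m → ℝ | suppFn K u • u + Jc u y ∈ K}
    simp only [MeasurableEquiv.coe_toLp_symm] at this
    rw [this]
    rfl

end supp

/-- Polytopes with the origin in the interior are finite intersections of half-spaces. -/
theorem exists_hrep {n : ℕ} (S : Finset (EuclideanSpace ℝ (Fin n)))
    (P : Set (EuclideanSpace ℝ (Fin n)))
    (hP : P = convexHull ℝ (S : Set (EuclideanSpace ℝ (Fin n)))) (h0 : (0 : EuclideanSpace ℝ (Fin n)) ∈ interior P) :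
    ∃ U : Finset (EuclideanSpace ℝ (Fin n)), (∀ u ∈ U, ‖u‖ = 1) ∧
      ∀ x, (∀ u ∈ U, ⟪x, u⟫ ≤ suppFn P u) → x ∈ P := by
  classical
  have hPc : IsCompact P := by rw [hP]; exact S.finite_toSet.isCompact_convexHull ℝ
  have hPconv : Convex ℝ P := by rw [hP]; exact convex_convexHull _ _
  let D : Set (EuclideanSpace ℝ (Fin n)) := {y | ∀ s ∈ S, ⟪s, y⟫ ≤ 1}
  have hDP : ∀ y ∈ D, ∀ x ∈ P, ⟪x, y⟫ ≤ 1 := by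
    intro y hy x hx
    rw [hP] at hx
    have hc : Convex ℝ {x : EuclideanSpace ℝ (Fin n) | ⟪x, y⟫ ≤ 1} :=
      convex_halfSpace_le (f := fun x => ⟪x, y⟫)
        ⟨fun a b => inner_add_left _ _ _, fun c a => real_inner_smul_left _ _ _⟩ _
    exact convexHull_min (fun s hs => hy s hs) hc hx
  have hDclosed : IsClosed D := by
    have : D = ⋂ s ∈ S, {y | ⟪s, y⟫ ≤ 1} := by ext; simp [D]
    rw [this]
    exact isClosed_biInter fun s _ => isClosed_le (by fun_prop) (by fun_prop)
  obtain ⟨ε, hε, hball⟩ := Metric.isOpen_iff.1 isOpen_interior 0 h0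
  have hDb : D ⊆ Metric.closedBall 0 (2 / ε) := by
    intro y hy
    rw [mem_closedBall_zero_iff]
    rcases eq_or_ne y 0 with rfl | hy0
    · simpa using by positivity
    have hny : 0 < ‖y‖ := norm_pos_iff.2 hy0
    have hmem : (ε / 2 / ‖y‖) • y ∈ P := by
      apply interior_subset
      apply hball
      rw [mem_ball_zero_iff, norm_smul, Real.norm_of_nonneg (by positivity),
        div_mul_cancel₀ _ hny.ne']
      linarith
    have := hDP y hy _ hmem
    rw [real_inner_smul_left, real_inner_self_eq_norm_sq] at this
    have h2 : ε / 2 / ‖y‖ * ‖y‖ ^ 2 = ε / 2 * ‖y‖ := by field_simp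
    rw [h2] at this
    rw [le_div_iff₀ hε]
    linarith
  have hDc : IsCompact D := (isCompact_closedBall _ _).of_isClosed_subset hDclosed hDb
  have hDconv : Convex ℝ D := by
    intro x hx y hy a b ha hb hab s hs
    have := hx s hs
    have := hy s hs
    rw [inner_add_right, real_inner_smul_right, real_inner_smul_right]
    nlinarith
  have hfin : (D.extremePoints ℝ).Finite := by
    refine Set.Finite.of_injOn (f := fun y => S.filter (fun s => ⟪s, y⟫ = 1))
      (t := (S.powerset : Set (Finset (EuclideanSpace ℝ (Fin n))))) ?_ ?_ S.powerset.finite_toSet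
    · intro y _
      exact Finset.mem_coe.2 (Finset.mem_powerset.2 (Finset.filter_subset _ _))
    · intro y hy y' hy' hact
      by_contra hne
      simp only at hact
      have hact' : ∀ s ∈ S, ⟪s, y⟫ = 1 → ⟪s, y'⟫ = 1 := by
        intro s hs h
        have : s ∈ S.filter (fun s => ⟪s, y⟫ = 1) := by simp [hs, h]
        rw [hact] at this
        exact (Finset.mem_filter.1 this).2
      -- find a small step
      have hstep : ∃ δ > 0, ∀ s ∈ S, ∀ t : ℝ, |t| ≤ δ → ⟪s, y + t • (y' - y)⟫ ≤ 1 := by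
        have hs1 : ∀ s ∈ S, ∃ δ > 0, ∀ t : ℝ, |t| ≤ δ → ⟪s, y + t • (y' - y)⟫ ≤ 1 := by
          intro s hs
          rcases (hy.1 s hs).lt_or_eq with hlt | heq
          · have hcont : ContinuousAt (fun t : ℝ => ⟪s, y + t • (y' - y)⟫) 0 := by fun_prop
            have := hcont.eventually_lt (continuousAt_const (y := (1 : ℝ))) (by simpa using hlt)
            obtain ⟨δ, hδ, h⟩ := Metric.eventually_nhds_iff.1 this
            refine ⟨δ / 2, by positivity, fun t ht => (h ?_).le⟩
            simp only [dist_zero_right, Real.norm_eq_abs]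
            linarith
          · refine ⟨1, one_pos, fun t _ => ?_⟩
            rw [inner_add_right, real_inner_smul_right, inner_sub_right, heq, hact' s hs heq]
            simp
        choose! δ hδ using hs1
        rcases S.eq_empty_or_nonempty with rfl | hSn
        · exact ⟨1, one_pos, by simp⟩
        · refine ⟨S.inf' hSn δ, ?_, ?_⟩
          · exact (Finset.lt_inf'_iff hSn).2 fun s hs => (hδ s hs).1
          · intro s hs t ht
            exact (hδ s hs).2 t (ht.trans (Finset.inf'_le _ hs))
      obtain ⟨δ, hδ, hst⟩ := hstep
      have m1 : y + δ • (y' - y) ∈ D := fun s hs => hst s hs δ (abs_of_pos hδ).le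
      have m2 : y + (-δ) • (y' - y) ∈ D := fun s hs => hst s hs (-δ) (by simp [abs_of_pos hδ])
      have hseg : y ∈ openSegment ℝ (y + δ • (y' - y)) (y + (-δ) • (y' - y)) := by
        refine ⟨1 / 2, 1 / 2, by norm_num, by norm_num, by norm_num, ?_⟩
        module
      have h3 := hy.2 m1 m2 hseg
      have h4 : δ • (y' - y) = 0 := by simpa using h3
      rcases smul_eq_zero.1 h4 with h | h
      · exact hδ.ne' h
      · exact hne (sub_eq_zero.1 h).symm
  refine ⟨(hfin.toFinset.filter (fun y => y ≠ 0)).image (fun y => (‖y‖)⁻¹ • y), ?_, ?_⟩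
  · intro u hu
    obtain ⟨y, hy, rfl⟩ := Finset.mem_image.1 hu
    have hy0 := (Finset.mem_filter.1 hy).2
    rw [norm_smul, norm_inv, norm_norm, inv_mul_cancel₀ (norm_ne_zero_iff.2 hy0)]
  · intro x hx
    have hext : ∀ y ∈ D.extremePoints ℝ, ⟪x, y⟫ ≤ 1 := by
      intro y hy
      rcases eq_or_ne y 0 with rfl | hy0
      · simp
      have hny : 0 < ‖y‖ := norm_pos_iff.2 hy0
      have h1 := hx ((‖y‖)⁻¹ • y) (Finset.mem_image.2 ⟨y, by simp [hy, hy0], rfl⟩)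
      have h2 : suppFn P ((‖y‖)⁻¹ • y) ≤ ‖y‖⁻¹ := by
        refine suppFn_le ⟨0, interior_subset h0⟩ ?_
        intro z hz
        rw [real_inner_smul_right]
        have := hDP y hy.1 z hz
        have h3 : 0 < ‖y‖⁻¹ := inv_pos.2 hny
        nlinarith
      rw [real_inner_smul_right] at h1
      have h3 : 0 < ‖y‖⁻¹ := inv_pos.2 hny
      have h4 := h1.trans h2
      exact le_of_mul_le_mul_left (by linarith) h3
    have hall : ∀ y ∈ D, ⟪x, y⟫ ≤ 1 := by
      intro y hy
      rw [← closure_convexHull_extremePoints hDc hDconv] at hy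
      have hcl : IsClosed {y : EuclideanSpace ℝ (Fin n) | ⟪x, y⟫ ≤ 1} :=
        isClosed_le (by fun_prop) (by fun_prop)
      have hcv : Convex ℝ {y : EuclideanSpace ℝ (Fin n) | ⟪x, y⟫ ≤ 1} :=
        convex_halfSpace_le (f := fun y => ⟪x, y⟫)
          ⟨fun a b => inner_add_right _ _ _, fun c a => real_inner_smul_right _ _ _⟩ _
      exact closure_minimal (convexHull_min hext hcv) hcl hy
    by_contra hxP
    obtain ⟨f, c, hfc, hcx⟩ := geometric_hahn_banach_closed_point hPconv hPc.isClosed hxP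
    have hc0 : 0 < c := by simpa using hfc 0 (interior_subset h0)
    obtain ⟨y, rfl⟩ := (InnerProductSpace.toDual ℝ (EuclideanSpace ℝ (Fin n))).surjective f
    simp only [InnerProductSpace.toDual_apply_apply] at hfc hcx
    have hyD : c⁻¹ • y ∈ D := by
      intro s hs
      have := hfc s (by rw [hP]; exact subset_convexHull _ _ hs)
      rw [real_inner_smul_right, real_inner_comm, inv_mul_le_iff₀ hc0]
      linarith
    have := hall _ hyD
    rw [real_inner_smul_right, real_inner_comm, inv_mul_le_iff₀ hc0] at this
    linarith

section firstVariation

variable {m : ℕ}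

theorem Jc_injective {u : EuclideanSpace ℝ (Fin (m + 1))} (hu : ‖u‖ = 1) :
    Function.Injective (Jc u) := by
  intro x y hxy
  have := (Jc_spec u hu).2.2.1.injective (a₁ := WithLp.toLp 2 x) (a₂ := WithLp.toLp 2 y)
    (by simpa using hxy)
  simpa using this

theorem slice_compact {u : EuclideanSpace ℝ (Fin (m + 1))} (hu : ‖u‖ = 1)
    {K : Set (EuclideanSpace ℝ (Fin (m + 1)))} (hK : IsCompact K) (s : ℝ) :
    IsCompact {y : Fin m → ℝ | s • u + Jc u y ∈ K} := by
  have h1 : Topology.IsClosedEmbedding (Jc u) :=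
    LinearMap.isClosedEmbedding_of_injective (LinearMap.ker_eq_bot.2 (Jc_injective hu))
  have h2 : Topology.IsClosedEmbedding (fun y => s • u + Jc u y) :=
    (Homeomorph.addLeft (s • u)).isClosedEmbedding.comp h1
  exact h2.isCompact_preimage hK

theorem smul_mono_of_star {P : Set (EuclideanSpace ℝ (Fin (m + 1)))} (hPconv : Convex ℝ P)
    (h0 : (0 : EuclideanSpace ℝ (Fin (m + 1))) ∈ P) {a b : ℝ} (ha : 0 < a) (hab : a ≤ b) :
    a • P ⊆ b • P := by
  rintro _ ⟨x, hx, rfl⟩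
  have hb : 0 < b := ha.trans_le hab
  refine ⟨(a / b) • x, ?_, ?_⟩
  · exact hPconv.smul_mem_of_zero_mem h0 hx ⟨by positivity, (div_le_one hb).2 hab⟩
  · simp only [smul_smul]
    rw [mul_div_cancel₀ _ hb.ne']

theorem slab_bound {P K : Set (EuclideanSpace ℝ (Fin (m + 1)))}
    {U : Finset (EuclideanSpace ℝ (Fin (m + 1)))} (hPc : IsCompact P) (hPconv : Convex ℝ P)
    (h0 : (0 : EuclideanSpace ℝ (Fin (m + 1))) ∈ interior P) (hU1 : ∀ u ∈ U, ‖u‖ = 1)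
    (hU : ∀ x, (∀ u ∈ U, ⟪x, u⟫ ≤ suppFn P u) → x ∈ P) (hKc : IsCompact K)
    (hK0 : (0 : EuclideanSpace ℝ (Fin (m + 1))) ∈ K) :
    ∃ C > 0, ∀ τ : ℝ, 0 < τ → volume (P + τ • K) ≤ volume P + ∑ u ∈ U,
      ENNReal.ofReal (τ * suppFn K u) *
        volume {y : Fin m → ℝ | suppFn P u • u + Jc u y ∈ (1 + C * τ) • P} := by
  obtain ⟨ε, hε, hball⟩ := Metric.isOpen_iff.1 isOpen_interior 0 h0
  obtain ⟨M, hM0, hM⟩ := hKc.isBounded.exists_pos_norm_le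
  set C : ℝ := 4 * M / ε with hC
  have hC0 : 0 < C := by positivity
  have hw : ∀ w : EuclideanSpace ℝ (Fin (m + 1)), ‖w‖ ≤ 2 * M → C⁻¹ • w ∈ P := by
    intro w hw
    apply interior_subset
    apply hball
    rw [mem_ball_zero_iff, norm_smul, Real.norm_of_nonneg (by positivity), inv_mul_lt_iff₀ hC0, hC]
    have : 4 * M / ε * ε = 4 * M := by field_simp
    rw [this]
    linarith
  have hin : ∀ τ : ℝ, 0 < τ → ∀ z ∈ P, ∀ w : EuclideanSpace ℝ (Fin (m + 1)), ‖w‖ ≤ 2 * M →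
      z + τ • w ∈ (1 + C * τ) • P := by
    intro τ hτ z hz w hw'
    have hpos : 0 < 1 + C * τ := by positivity
    have := hPconv hz (hw w hw') (a := (1 + C * τ)⁻¹) (b := (1 + C * τ)⁻¹ * (C * τ))
      (by positivity) (by positivity) (by field_simp)
    refine ⟨_, this, ?_⟩
    simp only [smul_add, smul_smul]
    rw [mul_inv_cancel₀ hpos.ne', one_smul]
    congr 2
    field_simp
  refine ⟨C, hC0, ?_⟩
  intro τ hτ
  have hPK : IsCompact (P + τ • K) := hPc.add (hKc.smul τ)
  have hsub : P + τ • K ⊆ P ∪ ⋃ u ∈ U, {x ∈ P + τ • K | suppFn P u < ⟪x, u⟫} := by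
    intro x hx
    by_cases hxP : x ∈ P
    · exact Or.inl hxP
    · right
      have : ∃ u ∈ U, suppFn P u < ⟪x, u⟫ := by
        by_contra hcon
        push Not at hcon
        exact hxP (hU x hcon)
      obtain ⟨u, hu, hlt⟩ := this
      simp only [Set.mem_iUnion]
      exact ⟨u, hu, hx, hlt⟩
  have hslab : ∀ u ∈ U, volume {x ∈ P + τ • K | suppFn P u < ⟪x, u⟫} ≤
      ENNReal.ofReal (τ * suppFn K u) *
        volume {y : Fin m → ℝ | suppFn P u • u + Jc u y ∈ (1 + C * τ) • P} := by
    intro u hu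
    have hu1 := hU1 u hu
    have hmeas : MeasurableSet {x ∈ P + τ • K | suppFn P u < ⟪x, u⟫} :=
      hPK.measurableSet.inter (measurableSet_lt (f := fun _ => suppFn P u)
        (g := fun x : EuclideanSpace ℝ (Fin (m + 1)) => ⟪x, u⟫) (by fun_prop) (by fun_prop))
    rw [← (Jc_spec u hu1).2.1.measure_preimage hmeas.nullMeasurableSet]
    have hsub2 : (fun p : ℝ × (Fin m → ℝ) => p.1 • u + Jc u p.2) ⁻¹'
        {x ∈ P + τ • K | suppFn P u < ⟪x, u⟫} ⊆
        Set.Ioc (suppFn P u) (suppFn P u + τ * suppFn K u) ×ˢ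
          {y : Fin m → ℝ | suppFn P u • u + Jc u y ∈ (1 + C * τ) • P} := by
      rintro ⟨s, y⟩ ⟨hx, hlt⟩
      simp only at hx hlt
      rw [Jc_inner hu1] at hlt
      obtain ⟨z, hz, _, ⟨k, hk, rfl⟩, hzk⟩ := hx
      simp only at hzk
      have hs : s = ⟪z, u⟫ + τ * ⟪k, u⟫ := by
        rw [← real_inner_smul_left, ← inner_add_left, hzk, Jc_inner hu1]
      have hz1 := le_suppFn hPc hz u
      have hk1 := le_suppFn hKc hk u
      have hs2 : s ≤ suppFn P u + τ * suppFn K u := by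
        rw [hs]; gcongr
      refine ⟨⟨hlt, hs2⟩, ?_⟩
      have hkM : suppFn K u ≤ M := by
        refine suppFn_le ⟨0, hK0⟩ fun x hx => (real_inner_le_norm _ _).trans ?_
        rw [hu1, mul_one]
        exact hM x hx
      have hkey := hin τ hτ z hz (k - ((s - suppFn P u) / τ) • u) (by
        refine (norm_sub_le _ _).trans ?_
        rw [norm_smul, hu1, mul_one, Real.norm_of_nonneg (div_nonneg (by linarith) hτ.le)]
        have : (s - suppFn P u) / τ ≤ M := by
          rw [div_le_iff₀ hτ]; nlinarith
        linarith [hM k hk])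
      have heq : suppFn P u • u + Jc u y = z + τ • (k - ((s - suppFn P u) / τ) • u) := by
        rw [smul_sub, smul_smul, mul_div_cancel₀ _ hτ.ne', ← add_sub_assoc, hzk, sub_smul]
        abel
      simp only [Set.mem_ofPred_eq]
      rw [heq]
      exact hkey
    refine (measure_mono hsub2).trans ?_
    rw [Measure.volume_eq_prod, Measure.prod_prod, Real.volume_Ioc]
    simp
  calc volume (P + τ • K) ≤ volume (P ∪ ⋃ u ∈ U, {x ∈ P + τ • K | suppFn P u < ⟪x, u⟫}) :=
        measure_mono hsub
    _ ≤ volume P + volume (⋃ u ∈ U, {x ∈ P + τ • K | suppFn P u < ⟪x, u⟫}) :=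
        measure_union_le _ _
    _ ≤ _ := by
        gcongr
        refine (measure_biUnion_finset_le _ _).trans ?_
        exact Finset.sum_le_sum hslab

theorem bm_dyadic {P K : Set (EuclideanSpace ℝ (Fin (m + 1)))} (hPc : IsCompact P)
    (hPconv : Convex ℝ P) (hKc : IsCompact K) (hvol : volume K = volume P) (k : ℕ) :
    volume P ≤ volume ((1 - (2⁻¹ : ℝ) ^ k) • P + ((2⁻¹ : ℝ) ^ k) • K) := by
  have hfin : volume P ≠ ⊤ := hPc.measure_lt_top.ne
  induction k with
  | zero =>
    rcases P.eq_empty_or_nonempty with rfl | hne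
    · simp
    simp [Set.zero_smul_set hne, hvol]
  | succ k ih =>
    set t : ℝ := (2⁻¹ : ℝ) ^ k with ht
    have ht0 : 0 < t := by positivity
    have ht1 : t ≤ 1 := pow_le_one₀ (by norm_num) (by norm_num)
    have hW : ∀ t : ℝ, MeasurableSet ((1 - t) • P + t • K) :=
      fun t => ((hPc.smul _).add (hKc.smul _)).measurableSet
    have h := bm_half hPc.measurableSet (hW t) (hW (2⁻¹ ^ (k + 1))) (by
      rintro x hx _ ⟨_, ⟨x', hx', rfl⟩, _, ⟨y, hy, rfl⟩, rfl⟩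
      have e : (2⁻¹ : ℝ) ^ (k + 1) = t / 2 := by rw [pow_succ, ← ht]; ring
      rw [e]
      have hpos : 0 < 1 - t / 2 := by linarith
      have hx'' := hPconv hx hx' (a := (1 - t / 2)⁻¹ * 2⁻¹) (b := (1 - t / 2)⁻¹ * ((1 - t) / 2))
        (by positivity) (mul_nonneg (by positivity) (by linarith)) (by
          rw [← mul_add, inv_mul_eq_one₀ hpos.ne']; ring)
      refine ⟨_, ⟨_, hx'', rfl⟩, _, ⟨y, hy, rfl⟩, ?_⟩
      have e1 : (1 - t / 2) * ((1 - t / 2)⁻¹ * 2⁻¹) = 2⁻¹ := by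
        rw [← mul_assoc, mul_inv_cancel₀ hpos.ne', one_mul]
      have e2 : (1 - t / 2) * ((1 - t / 2)⁻¹ * ((1 - t) / 2)) = 2⁻¹ * (1 - t) := by
        rw [← mul_assoc, mul_inv_cancel₀ hpos.ne', one_mul]; ring
      have e3 : t / 2 = 2⁻¹ * t := by ring
      simp only [smul_add, smul_smul, e1, e2]
      rw [add_assoc, e3])
    rcases eq_or_ne (volume P) 0 with hz | hz
    · simp [hz]
    have h2 : volume P ^ 2 ≤ volume ((1 - (2⁻¹ : ℝ) ^ (k + 1)) • P + (2⁻¹ : ℝ) ^ (k + 1) • K) ^ 2 := by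
      refine le_trans ?_ h
      rw [sq]
      gcongr
    exact (ENNReal.pow_le_pow_left_iff two_ne_zero).1 h2

theorem slice_tendsto_s8 {P : Set (EuclideanSpace ℝ (Fin (m + 1)))} (hPc : IsCompact P)
    (hPconv : Convex ℝ P) (h0 : (0 : EuclideanSpace ℝ (Fin (m + 1))) ∈ P)
    {u : EuclideanSpace ℝ (Fin (m + 1))} (hu : ‖u‖ = 1) :
    Filter.Tendsto (fun r : ℝ => volume {y : Fin m → ℝ | suppFn P u • u + Jc u y ∈ (1 + r) • P})
      (nhdsWithin 0 (Set.Ioi 0)) (nhds (ar P u)) := by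
  have key := tendsto_measure_biInter_gt (μ := (volume : Measure (Fin m → ℝ)))
    (s := fun r : ℝ => {y : Fin m → ℝ | suppFn P u • u + Jc u y ∈ (1 + r) • P}) (a := 0)
    (fun r _ => (slice_compact hu (hPc.smul (1 + r)) _).measurableSet.nullMeasurableSet)
    (fun i j hi hij y hy => smul_mono_of_star hPconv h0 (by linarith) (by linarith) hy)
    ⟨1, one_pos, (slice_compact hu (hPc.smul (1 + 1)) _).measure_lt_top.ne⟩
  have hI : (⋂ r > (0 : ℝ), {y : Fin m → ℝ | suppFn P u • u + Jc u y ∈ (1 + r) • P}) =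
      {y : Fin m → ℝ | suppFn P u • u + Jc u y ∈ P} := by
    ext y
    simp only [Set.mem_iInter, Set.mem_ofPred_eq]
    constructor
    · intro h
      set x := suppFn P u • u + Jc u y
      have hx : ∀ r : ℝ, 0 < r → (1 + r)⁻¹ • x ∈ P := by
        intro r hr
        exact (Set.mem_smul_set_iff_inv_smul_mem₀ (by positivity) _ _).1 (h r hr)
      have ht : Filter.Tendsto (fun r : ℝ => (1 + r)⁻¹ • x) (nhdsWithin 0 (Set.Ioi 0))
          (nhds x) := by
        have : ContinuousAt (fun r : ℝ => (1 + r)⁻¹ • x) 0 := by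
          have h3 : ContinuousAt (fun r : ℝ => (1 + r)⁻¹) 0 :=
            ContinuousAt.inv₀ (by fun_prop) (by norm_num)
          fun_prop
        have h2 := this.tendsto
        simp only [add_zero, inv_one, one_smul] at h2
        exact h2.mono_left nhdsWithin_le_nhds
      refine hPc.isClosed.mem_of_tendsto ht ?_
      filter_upwards [self_mem_nhdsWithin] with r hr
      exact hx r hr
    · intro h r hr
      have := smul_mono_of_star hPconv h0 one_pos (b := 1 + r) (by linarith)
      rw [one_smul] at this
      exact this h
  rw [hI] at key
  exact key

/-- Minkowski's first inequality for a polytope and a compact set of the same volume. -/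
theorem mink_first {P K : Set (EuclideanSpace ℝ (Fin (m + 1)))}
    {U : Finset (EuclideanSpace ℝ (Fin (m + 1)))} (hPc : IsCompact P) (hPconv : Convex ℝ P)
    (h0 : (0 : EuclideanSpace ℝ (Fin (m + 1))) ∈ interior P) (hU1 : ∀ u ∈ U, ‖u‖ = 1)
    (hU : ∀ x, (∀ u ∈ U, ⟪x, u⟫ ≤ suppFn P u) → x ∈ P) (hKc : IsCompact K)
    (hK0 : (0 : EuclideanSpace ℝ (Fin (m + 1))) ∈ K) (hvol : volume K = volume P) :
    ((m + 1 : ℕ) : ℝ) * (volume P).toReal ≤ ∑ u ∈ U, suppFn K u * (ar P u).toReal := by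
  obtain ⟨C, hC0, hC⟩ := slab_bound hPc hPconv h0 hU1 hU hKc hK0
  have hPfin : volume P ≠ ⊤ := hPc.measure_lt_top.ne
  set g : EuclideanSpace ℝ (Fin (m + 1)) → ℝ → ℝ := fun u r =>
    (volume {y : Fin m → ℝ | suppFn P u • u + Jc u y ∈ (1 + r) • P}).toReal with hg
  have hk0 : ∀ u, 0 ≤ suppFn K u := fun u => by simpa using le_suppFn hKc hK0 u
  have step : ∀ k : ℕ, 1 ≤ k → ((m + 1 : ℕ) : ℝ) * (volume P).toReal ≤
      ∑ u ∈ U, suppFn K u * g u (C * ((2 : ℝ) ^ k - 1)⁻¹) := by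
    intro k hk
    have h2k : (1 : ℝ) < 2 ^ k := one_lt_pow₀ (by norm_num) (by omega)
    set τ : ℝ := ((2 : ℝ) ^ k - 1)⁻¹ with hτ
    have hτ0 : 0 < τ := inv_pos.2 (by linarith)
    have ht : (1 - (2⁻¹ : ℝ) ^ k) = (1 + τ)⁻¹ := by
      rw [inv_pow, hτ]
      have : (2 : ℝ) ^ k - 1 ≠ 0 := by linarith
      field_simp
      simp
    have ht2 : (2⁻¹ : ℝ) ^ k = (1 + τ)⁻¹ * τ := by
      rw [inv_pow, hτ]
      have : (2 : ℝ) ^ k - 1 ≠ 0 := by linarith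
      field_simp
      simp
    have h1 := bm_dyadic hPc hPconv hKc hvol k
    rw [ht, ht2, mul_smul, ← smul_add, Measure.addHaar_smul] at h1
    simp only [finrank_euclideanSpace, Fintype.card_fin] at h1
    rw [abs_of_nonneg (by positivity)] at h1
    have h3 := hC τ hτ0
    have hsumtop : ∑ u ∈ U, ENNReal.ofReal (τ * suppFn K u) *
        volume {y : Fin m → ℝ | suppFn P u • u + Jc u y ∈ (1 + C * τ) • P} ≠ ⊤ :=
      ENNReal.sum_ne_top.2 fun u hu => ENNReal.mul_ne_top ENNReal.ofReal_ne_top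
        (slice_compact (hU1 u hu) (hPc.smul _) _).measure_lt_top.ne
    have h1' := ENNReal.toReal_mono (ENNReal.mul_ne_top ENNReal.ofReal_ne_top
      ((hPc.add (hKc.smul τ)).measure_lt_top.ne)) h1
    have h3' := ENNReal.toReal_mono (ENNReal.add_ne_top.2 ⟨hPfin, hsumtop⟩) h3
    rw [ENNReal.toReal_add hPfin hsumtop, ENNReal.toReal_sum (fun u hu => ENNReal.mul_ne_top
      ENNReal.ofReal_ne_top (slice_compact (hU1 u hu) (hPc.smul _) _).measure_lt_top.ne)] at h3'
    rw [ENNReal.toReal_mul, ENNReal.toReal_ofReal (by positivity)] at h1'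
    have h4 : ∑ u ∈ U, (ENNReal.ofReal (τ * suppFn K u) *
        volume {y : Fin m → ℝ | suppFn P u • u + Jc u y ∈ (1 + C * τ) • P}).toReal =
        τ * ∑ u ∈ U, suppFn K u * g u (C * τ) := by
      rw [Finset.mul_sum]
      refine Finset.sum_congr rfl fun u hu => ?_
      rw [ENNReal.toReal_mul, ENNReal.toReal_ofReal (mul_nonneg hτ0.le (hk0 u))]
      simp only [hg]
      ring
    rw [h4] at h3'
    set V := (volume P).toReal
    set W := (volume (P + τ • K)).toReal
    have hV0 : 0 ≤ V := ENNReal.toReal_nonneg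
    have h5 : (1 + τ) ^ (m + 1) * V ≤ W := by
      have : (0 : ℝ) < (1 + τ) ^ (m + 1) := by positivity
      rw [inv_pow, le_inv_mul_iff₀ this] at h1'
      exact h1'
    have h6 : 1 + ((m + 1 : ℕ) : ℝ) * τ ≤ (1 + τ) ^ (m + 1) :=
      one_add_mul_le_pow (by linarith) _
    have h7 : (1 + ((m + 1 : ℕ) : ℝ) * τ) * V ≤ V + τ * ∑ u ∈ U, suppFn K u * g u (C * τ) :=
      (mul_le_mul_of_nonneg_right h6 hV0).trans (h5.trans h3')
    have h8 : τ * (((m + 1 : ℕ) : ℝ) * V) ≤ τ * ∑ u ∈ U, suppFn K u * g u (C * τ) := by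
      linarith
    exact le_of_mul_le_mul_left h8 hτ0
  have hlim0 : Filter.Tendsto (fun k : ℕ => C * ((2 : ℝ) ^ k - 1)⁻¹) Filter.atTop
      (nhdsWithin 0 (Set.Ioi 0)) := by
    rw [tendsto_nhdsWithin_iff]
    constructor
    · have h1 : Filter.Tendsto (fun k : ℕ => (2 : ℝ) ^ k - 1) Filter.atTop Filter.atTop :=
        Filter.tendsto_atTop_add_const_right _ _
          (tendsto_pow_atTop_atTop_of_one_lt (by norm_num))
      simpa using (h1.inv_tendsto_atTop).const_mul C
    · filter_upwards [Filter.eventually_ge_atTop 1] with k hk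
      have h2k : (1 : ℝ) < 2 ^ k := one_lt_pow₀ (by norm_num) (by omega)
      exact mul_pos hC0 (inv_pos.2 (by linarith))
  have hlim : Filter.Tendsto (fun k : ℕ => ∑ u ∈ U, suppFn K u * g u (C * ((2 : ℝ) ^ k - 1)⁻¹))
      Filter.atTop (nhds (∑ u ∈ U, suppFn K u * (ar P u).toReal)) := by
    refine tendsto_finsetSum _ fun u hu => Filter.Tendsto.const_mul _ ?_
    have h1 := slice_tendsto_s8 hPc hPconv (interior_subset h0) (hU1 u hu)
    have h2 := (ENNReal.tendsto_toReal
      (slice_compact (hU1 u hu) hPc _).measure_lt_top.ne).comp (h1.comp hlim0)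
    exact h2
  refine ge_of_tendsto hlim ?_
  filter_upwards [Filter.eventually_ge_atTop 1] with k hk
  exact step k hk

end firstVariation

section cones

variable {m : ℕ}

/-- The cone over the face in direction `u`. -/
def coneOver (Q : Set (EuclideanSpace ℝ (Fin (m + 1)))) (u : EuclideanSpace ℝ (Fin (m + 1))) :
    Set (EuclideanSpace ℝ (Fin (m + 1))) :=
  (fun p : ℝ × (Fin m → ℝ) => p.1 • (suppFn Q u • u + Jc u p.2)) ''
    (Set.Icc 0 1 ×ˢ {y : Fin m → ℝ | suppFn Q u • u + Jc u y ∈ Q})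

theorem coneOver_compact {Q : Set (EuclideanSpace ℝ (Fin (m + 1)))}
    {u : EuclideanSpace ℝ (Fin (m + 1))} (hu : ‖u‖ = 1) (hQ : IsCompact Q) :
    IsCompact (coneOver Q u) := by
  refine (isCompact_Icc.prod (slice_compact hu hQ _)).image ?_
  have := Jc_cont u
  fun_prop

theorem coneOver_subset {Q : Set (EuclideanSpace ℝ (Fin (m + 1)))} (hQ : Convex ℝ Q)
    (h0 : (0 : EuclideanSpace ℝ (Fin (m + 1))) ∈ Q)
    (u : EuclideanSpace ℝ (Fin (m + 1))) : coneOver Q u ⊆ Q := by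
  rintro _ ⟨⟨s, y⟩, ⟨hs, hy⟩, rfl⟩
  exact hQ.smul_mem_of_zero_mem h0 hy hs

theorem suppFn_pos {Q : Set (EuclideanSpace ℝ (Fin (m + 1)))} (hQ : IsCompact Q)
    (h0 : (0 : EuclideanSpace ℝ (Fin (m + 1))) ∈ interior Q)
    {u : EuclideanSpace ℝ (Fin (m + 1))} (hu : ‖u‖ = 1) : 0 < suppFn Q u := by
  obtain ⟨ε, hε, hball⟩ := Metric.isOpen_iff.1 isOpen_interior 0 h0
  have hmem : (ε / 2) • u ∈ Q := by
    apply interior_subset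
    apply hball
    rw [mem_ball_zero_iff, norm_smul, hu, Real.norm_of_nonneg (by positivity)]
    linarith
  have := le_suppFn hQ hmem u
  rw [real_inner_smul_left, real_inner_self_eq_norm_sq, hu] at this
  linarith

theorem coneOver_vol {Q : Set (EuclideanSpace ℝ (Fin (m + 1)))} (hQ : IsCompact Q)
    (h0 : (0 : EuclideanSpace ℝ (Fin (m + 1))) ∈ interior Q)
    {u : EuclideanSpace ℝ (Fin (m + 1))} (hu : ‖u‖ = 1) :
    suppFn Q u * (ar Q u).toReal ≤ ((m + 1 : ℕ) : ℝ) * (volume (coneOver Q u)).toReal := by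
  set h := suppFn Q u with hh
  have hpos : 0 < h := suppFn_pos hQ h0 hu
  have hcc := coneOver_compact hu hQ
  have hart : ar Q u ≠ ⊤ := (slice_compact hu hQ _).measure_lt_top.ne
  have h1 : ENNReal.ofReal (h / (m + 1)) * ar Q u ≤ volume (coneOver Q u) := by
    rw [← (Jc_spec u hu).2.1.measure_preimage hcc.measurableSet.nullMeasurableSet,
      Measure.volume_eq_prod, Measure.prod_apply ((Jc_spec u hu).2.1.measurable hcc.measurableSet)]
    calc ENNReal.ofReal (h / (m + 1)) * ar Q u
        = (∫⁻ s in Set.Ioc 0 h, ENNReal.ofReal ((s / h) ^ m)) * ar Q u := by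
          congr 1
          rw [← ofReal_integral_eq_lintegral_ofReal]
          · rw [← intervalIntegral.integral_of_le hpos.le]
            congr 1
            simp only [div_pow]
            rw [intervalIntegral.integral_div, integral_pow]
            have : (h : ℝ) ^ m ≠ 0 := by positivity
            field_simp
            simp
            ring
          · exact (Continuous.integrableOn_Icc (by fun_prop)).mono_set Set.Ioc_subset_Icc_self
          · refine (ae_restrict_iff' measurableSet_Ioc).2 (.of_forall fun s hs => ?_)
            have := hs.1
            simp only [Pi.zero_apply]
            positivity
      _ = ∫⁻ s in Set.Ioc 0 h, ENNReal.ofReal ((s / h) ^ m) * ar Q u := by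
          rw [lintegral_mul_const' _ _ hart]
      _ ≤ ∫⁻ s in Set.Ioc 0 h, volume (Prod.mk s ⁻¹'
            ((fun p : ℝ × (Fin m → ℝ) => p.1 • u + Jc u p.2) ⁻¹' coneOver Q u)) := by
          refine setLIntegral_mono' measurableSet_Ioc fun s hs => ?_
          have hs0 := hs.1
          have e : ENNReal.ofReal ((s / h) ^ m) * ar Q u =
              volume ((s / h) • {y : Fin m → ℝ | suppFn Q u • u + Jc u y ∈ Q}) := by
            rw [Measure.addHaar_smul]
            simp only [Module.finrank_fintype_fun_eq_card, Fintype.card_fin]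
            rw [abs_of_nonneg (by positivity)]
            rfl
          rw [e]
          apply measure_mono
          rintro _ ⟨y, hy, rfl⟩
          refine ⟨(s / h, y), ⟨⟨by positivity, (div_le_one hpos).2 hs.2⟩, hy⟩, ?_⟩
          simp only [smul_add, smul_smul, map_smul]
          rw [← hh, div_mul_cancel₀ _ hpos.ne']
      _ ≤ _ := setLIntegral_le_lintegral _ _
  have h2 := ENNReal.toReal_mono hcc.measure_lt_top.ne h1
  rw [ENNReal.toReal_mul, ENNReal.toReal_ofReal (by positivity)] at h2
  have h3 : h * (ar Q u).toReal = ((m + 1 : ℕ) : ℝ) * (h / (m + 1) * (ar Q u).toReal) := by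
    push_cast
    field_simp
  rw [h3]
  gcongr

theorem hyperplane_null {w : EuclideanSpace ℝ (Fin (m + 1))} (hw : w ≠ 0) :
    volume {x : EuclideanSpace ℝ (Fin (m + 1)) | ⟪w, x⟫ = 0} = 0 := by
  have h1 : LinearMap.ker (innerSL ℝ w).toLinearMap ≠ ⊤ := by
    intro h
    have : w ∈ LinearMap.ker (innerSL ℝ w).toLinearMap := by rw [h]; trivial
    simp at this
    exact hw this
  have h2 := Measure.addHaar_submodule (volume : Measure (EuclideanSpace ℝ (Fin (m + 1)))) _ h1
  convert h2 using 2
  ext x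
  simp

theorem coneOver_disj {Q : Set (EuclideanSpace ℝ (Fin (m + 1)))} (hQ : IsCompact Q)
    (h0 : (0 : EuclideanSpace ℝ (Fin (m + 1))) ∈ interior Q)
    {u v : EuclideanSpace ℝ (Fin (m + 1))} (hu : ‖u‖ = 1) (hv : ‖v‖ = 1) (huv : u ≠ v) :
    AEDisjoint volume (coneOver Q u) (coneOver Q v) := by
  have hpu := suppFn_pos hQ h0 hu
  have hpv := suppFn_pos hQ h0 hv
  have hw : suppFn Q v • u - suppFn Q u • v ≠ 0 := by
    intro h
    rw [sub_eq_zero] at h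
    have h2 := congrArg norm h
    rw [norm_smul, norm_smul, hu, hv, Real.norm_of_nonneg hpu.le, Real.norm_of_nonneg hpv.le] at h2
    simp only [mul_one] at h2
    rw [h2] at h
    exact huv (smul_right_injective _ hpu.ne' h)
  refine measure_mono_null ?_ (hyperplane_null hw)
  rintro x ⟨⟨⟨s, y⟩, ⟨hs, hy⟩, rfl⟩, ⟨⟨t, z⟩, ⟨ht, hz⟩, hst⟩⟩
  simp only at hst
  simp only [Set.mem_ofPred_eq]
  have hyv := le_suppFn hQ hy v
  have hzu := le_suppFn hQ hz u
  have e1 : ⟪s • (suppFn Q u • u + Jc u y), u⟫ = s * suppFn Q u := by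
    rw [real_inner_smul_left, Jc_inner hu]
  have e2 : ⟪s • (suppFn Q u • u + Jc u y), v⟫ = t * suppFn Q v := by
    rw [← hst, real_inner_smul_left, Jc_inner hv]
  have l1 : s * suppFn Q u ≤ t * suppFn Q u := by
    rw [← e1, ← hst, real_inner_smul_left]
    exact mul_le_mul_of_nonneg_left hzu ht.1
  have l2 : t * suppFn Q v ≤ s * suppFn Q v := by
    rw [← e2, real_inner_smul_left]
    exact mul_le_mul_of_nonneg_left hyv hs.1
  have hst' : s = t :=
    le_antisymm (le_of_mul_le_mul_right l1 hpu) (le_of_mul_le_mul_right l2 hpv)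
  rw [real_inner_comm, inner_sub_right, real_inner_smul_right, real_inner_smul_right, e1, e2, hst']
  ring

theorem cone_sum {Q : Set (EuclideanSpace ℝ (Fin (m + 1)))} (hQ : IsCompact Q)
    (hQconv : Convex ℝ Q) (h0 : (0 : EuclideanSpace ℝ (Fin (m + 1))) ∈ interior Q)
    {U : Finset (EuclideanSpace ℝ (Fin (m + 1)))} (hU1 : ∀ u ∈ U, ‖u‖ = 1) :
    ∑ u ∈ U, suppFn Q u * (ar Q u).toReal ≤ ((m + 1 : ℕ) : ℝ) * (volume Q).toReal := by
  have h1 : ∑ u ∈ U, volume (coneOver Q u) ≤ volume Q := by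
    rw [← measure_biUnion_finset₀]
    · exact measure_mono (Set.iUnion₂_subset fun u _ =>
        coneOver_subset hQconv (interior_subset h0) u)
    · intro u hu v hv huv
      exact coneOver_disj hQ h0 (hU1 u hu) (hU1 v hv) huv
    · intro u hu
      exact (coneOver_compact (hU1 u hu) hQ).measurableSet.nullMeasurableSet
  have h2 := ENNReal.toReal_mono hQ.measure_lt_top.ne h1
  rw [ENNReal.toReal_sum fun u hu => (coneOver_compact (hU1 u hu) hQ).measure_lt_top.ne] at h2
  calc ∑ u ∈ U, suppFn Q u * (ar Q u).toReal
      ≤ ∑ u ∈ U, ((m + 1 : ℕ) : ℝ) * (volume (coneOver Q u)).toReal :=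
        Finset.sum_le_sum fun u hu => coneOver_vol hQ h0 (hU1 u hu)
    _ = ((m + 1 : ℕ) : ℝ) * ∑ u ∈ U, (volume (coneOver Q u)).toReal := by rw [Finset.mul_sum]
    _ ≤ _ := by gcongr

end cones

section volumes

variable {m : ℕ}

theorem suppFn_smul {K : Set (EuclideanSpace ℝ (Fin (m + 1)))} (hK : IsCompact K)
    (hn : K.Nonempty) {c : ℝ} (hc : 0 ≤ c) (u : EuclideanSpace ℝ (Fin (m + 1))) :
    suppFn (c • K) u ≤ c * suppFn K u := by
  refine suppFn_le (hn.smul_set) ?_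
  rintro _ ⟨x, hx, rfl⟩
  simp only
  rw [real_inner_smul_left]
  exact mul_le_mul_of_nonneg_left (le_suppFn hK hx u) hc

/-- Minkowski's first inequality, scaled form: `λ` is the ratio of homothety. -/
theorem mink_scaled {P K : Set (EuclideanSpace ℝ (Fin (m + 1)))}
    {U : Finset (EuclideanSpace ℝ (Fin (m + 1)))} (hPc : IsCompact P) (hPconv : Convex ℝ P)
    (h0 : (0 : EuclideanSpace ℝ (Fin (m + 1))) ∈ interior P) (hU1 : ∀ u ∈ U, ‖u‖ = 1)
    (hU : ∀ x, (∀ u ∈ U, ⟪x, u⟫ ≤ suppFn P u) → x ∈ P) (hKc : IsCompact K)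
    (hK0 : (0 : EuclideanSpace ℝ (Fin (m + 1))) ∈ K) (hKv : 0 < (volume K).toReal) :
    ∃ c : ℝ, 0 < c ∧ c ^ (m + 1) * (volume K).toReal = (volume P).toReal ∧
      ((m + 1 : ℕ) : ℝ) * (volume P).toReal ≤ c * ∑ u ∈ U, suppFn K u * (ar P u).toReal := by
  have hPv : 0 < (volume P).toReal :=
    ENNReal.toReal_pos ((isOpen_interior.measure_pos volume ⟨0, h0⟩).trans_le
      (measure_mono interior_subset)).ne' hPc.measure_lt_top.ne
  set c : ℝ := ((volume P).toReal / (volume K).toReal) ^ (((m + 1 : ℕ) : ℝ)⁻¹) with hc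
  have hc0 : 0 < c := Real.rpow_pos_of_pos (div_pos hPv hKv) _
  have hcp : c ^ (m + 1) = (volume P).toReal / (volume K).toReal :=
    Real.rpow_inv_natCast_pow (div_pos hPv hKv).le (by omega)
  have hcv : c ^ (m + 1) * (volume K).toReal = (volume P).toReal := by
    rw [hcp, div_mul_cancel₀ _ hKv.ne']
  refine ⟨c, hc0, hcv, ?_⟩
  have hvol : volume (c • K) = volume P := by
    rw [Measure.addHaar_smul]
    simp only [finrank_euclideanSpace, Fintype.card_fin]
    rw [abs_of_nonneg (by positivity), ← ENNReal.ofReal_toReal hKc.measure_lt_top.ne,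
      ← ENNReal.ofReal_mul (by positivity), hcv, ENNReal.ofReal_toReal hPc.measure_lt_top.ne]
  refine (mink_first hPc hPconv h0 hU1 hU (hKc.smul c) ⟨0, hK0, by simp⟩ hvol).trans ?_
  rw [Finset.mul_sum]
  refine Finset.sum_le_sum fun u hu => ?_
  rw [← mul_assoc]
  exact mul_le_mul_of_nonneg_right (suppFn_smul hKc ⟨0, hK0⟩ hc0.le u) ENNReal.toReal_nonneg

theorem vol_le {P Q : Set (EuclideanSpace ℝ (Fin (m + 1)))}
    {U : Finset (EuclideanSpace ℝ (Fin (m + 1)))} (hm : 1 ≤ m) (hPc : IsCompact P)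
    (hPconv : Convex ℝ P)
    (h0 : (0 : EuclideanSpace ℝ (Fin (m + 1))) ∈ interior P) (hU1 : ∀ u ∈ U, ‖u‖ = 1)
    (hU : ∀ x, (∀ u ∈ U, ⟪x, u⟫ ≤ suppFn P u) → x ∈ P) (hQc : IsCompact Q)
    (hQconv : Convex ℝ Q) (hQ0 : (0 : EuclideanSpace ℝ (Fin (m + 1))) ∈ interior Q)
    (har : ∀ u ∈ U, ar P u = ar Q u) :
    (volume P).toReal ≤ (volume Q).toReal := by
  have hQv : 0 < (volume Q).toReal :=
    ENNReal.toReal_pos ((isOpen_interior.measure_pos volume ⟨0, hQ0⟩).trans_le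
      (measure_mono interior_subset)).ne' hQc.measure_lt_top.ne
  obtain ⟨c, hc0, hcv, hle⟩ := mink_scaled hPc hPconv h0 hU1 hU hQc (interior_subset hQ0) hQv
  have hs := cone_sum hQc hQconv hQ0 hU1
  have he : ∑ u ∈ U, suppFn Q u * (ar P u).toReal = ∑ u ∈ U, suppFn Q u * (ar Q u).toReal :=
    Finset.sum_congr rfl fun u hu => by rw [har u hu]
  rw [he] at hle
  have h1 : ((m + 1 : ℕ) : ℝ) * (volume P).toReal ≤
      ((m + 1 : ℕ) : ℝ) * (c * (volume Q).toReal) := by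
    refine hle.trans ?_
    calc _ ≤ c * (((m + 1 : ℕ) : ℝ) * (volume Q).toReal) := by gcongr
      _ = _ := by ring
  have h2 := le_of_mul_le_mul_left h1 (by positivity)
  by_contra hlt
  push Not at hlt
  have hc1 : 1 < c := by
    by_contra hc1
    push Not at hc1
    have : c ^ (m + 1) ≤ 1 := pow_le_one₀ hc0.le hc1
    nlinarith
  have h3 : c < c ^ (m + 1) := by
    calc c = c ^ 1 := (pow_one c).symm
      _ < c ^ (m + 1) := pow_lt_pow_right₀ hc1 (by omega)
  nlinarith

theorem vol_mid_le {P Q : Set (EuclideanSpace ℝ (Fin (m + 1)))}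
    {U : Finset (EuclideanSpace ℝ (Fin (m + 1)))} (hPc : IsCompact P)
    (hPconv : Convex ℝ P)
    (h0 : (0 : EuclideanSpace ℝ (Fin (m + 1))) ∈ interior P) (hU1 : ∀ u ∈ U, ‖u‖ = 1)
    (hU : ∀ x, (∀ u ∈ U, ⟪x, u⟫ ≤ suppFn P u) → x ∈ P) (hQc : IsCompact Q)
    (hQconv : Convex ℝ Q) (hQ0 : (0 : EuclideanSpace ℝ (Fin (m + 1))) ∈ interior Q)
    (har : ∀ u ∈ U, ar P u = ar Q u) (hvol : (volume P).toReal = (volume Q).toReal) :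
    (volume ((2⁻¹ : ℝ) • (P + Q))).toReal ≤ (volume P).toReal := by
  set M := (2⁻¹ : ℝ) • (P + Q) with hM
  have hMc : IsCompact M := (hPc.add hQc).smul _
  have hM0 : (0 : EuclideanSpace ℝ (Fin (m + 1))) ∈ M :=
    ⟨0, ⟨0, interior_subset h0, 0, interior_subset hQ0, by simp⟩, by simp⟩
  rcases (ENNReal.toReal_nonneg (a := volume M)).eq_or_lt with hMv | hMv
  · rw [← hMv]; exact ENNReal.toReal_nonneg
  have hPv : 0 < (volume P).toReal :=
    ENNReal.toReal_pos ((isOpen_interior.measure_pos volume ⟨0, h0⟩).trans_le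
      (measure_mono interior_subset)).ne' hPc.measure_lt_top.ne
  obtain ⟨c, hc0, hcv, hle⟩ := mink_scaled hPc hPconv h0 hU1 hU hMc hM0 hMv
  have hsP := cone_sum hPc hPconv h0 hU1
  have hsQ := cone_sum hQc hQconv hQ0 hU1
  have hsM : ∑ u ∈ U, suppFn M u * (ar P u).toReal ≤ 2⁻¹ * (∑ u ∈ U, suppFn P u * (ar P u).toReal
      + ∑ u ∈ U, suppFn Q u * (ar Q u).toReal) := by
    rw [← Finset.sum_add_distrib, Finset.mul_sum]
    refine Finset.sum_le_sum fun u hu => ?_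
    rw [← har u hu, ← add_mul, ← mul_assoc]
    refine mul_le_mul_of_nonneg_right ?_ ENNReal.toReal_nonneg
    refine suppFn_le ⟨0, hM0⟩ ?_
    rintro _ ⟨_, ⟨x, hx, y, hy, rfl⟩, rfl⟩
    simp only
    rw [real_inner_smul_left, inner_add_left]
    have := le_suppFn hPc hx u
    have := le_suppFn hQc hy u
    linarith
  have h1 : ((m + 1 : ℕ) : ℝ) * (volume P).toReal ≤
      ((m + 1 : ℕ) : ℝ) * (c * (volume P).toReal) := by
    refine hle.trans ?_
    calc _ ≤ c * (((m + 1 : ℕ) : ℝ) * (volume P).toReal) := by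
          gcongr
          rw [← hvol] at hsQ
          linarith
      _ = _ := by ring
  have h2 := le_of_mul_le_mul_left h1 (by positivity)
  have hc1 : 1 ≤ c := by
    by_contra hc1
    push Not at hc1
    nlinarith
  have h3 : 1 ≤ c ^ (m + 1) := one_le_pow₀ hc1
  nlinarith

end volumes

section oneDim

/-- The properties of the cumulative volume function of a convex body used below. -/
structure IsCum (V : ℝ) (F : ℝ → ℝ) : Prop where
  mono : Monotone F
  cont : Continuous F
  lo : ∃ x, F x = 0
  hi : ∃ x, F x = V
  nonneg : ∀ x, 0 ≤ F x
  le : ∀ x, F x ≤ V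
  strict : ∀ x y, x < y → 0 < F x → F x < V → F x < F y

theorem IsCum.exists_quantile {V : ℝ} {F : ℝ → ℝ} (hF : IsCum V F) {z : ℝ} (h0 : 0 < z)
    (h1 : z < V) : ∃ x, F x = z := by
  obtain ⟨a, ha⟩ := hF.lo
  obtain ⟨b, hb⟩ := hF.hi
  exact mem_range_of_exists_le_of_exists_ge hF.cont ⟨a, by linarith⟩ ⟨b, by linarith⟩

theorem IsCum.le_of_le {V : ℝ} {F : ℝ → ℝ} (hF : IsCum V F) {x y : ℝ} (h0 : 0 < F x)
    (h1 : F x < V) (h : F x ≤ F y) : x ≤ y := by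
  by_contra hc
  push Not at hc
  have h2 := hF.mono hc.le
  have h3 := hF.strict y x hc (by linarith) (by linarith)
  linarith

theorem quantile_incr {V : ℝ} {p r : ℝ → ℝ} {L : ℝ} {G : ℝ → ℝ} (hG : IsCum V G)
    (hL : ∀ s < L, Real.exp s < V)
    (hr : ∀ s < L, G (r s) = Real.exp s)
    (hinc : ∀ s h, 0 < h → s + h < L → r s - r (s - h) ≤ p (s + h) - p s)
    {a b : ℝ} (hab : a < b) (hb : b < L) : r b - r a ≤ p b - p a := by
  have key : ∀ h, 0 < h → ∀ k : ℕ, a + k * h < L →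
      r (a + k * h - h) - r (a - h) ≤ p (a + k * h) - p a := by
    intro h hh k
    induction k with
    | zero => intro _; simp
    | succ k ih =>
      intro hk
      push_cast at hk ⊢
      have e1 : a + (k + 1) * h = a + k * h + h := by ring
      rw [e1] at hk ⊢
      have := ih (by linarith)
      have h2 := hinc (a + k * h) h hh hk
      have e3 : a + k * h + h - h = a + k * h := by ring
      rw [e3]
      linarith
  refine le_of_forall_pos_le_add fun ε hε => ?_
  have hlt : G (r b - ε) < Real.exp b := by
    by_contra hc
    push Not at hc
    rw [← hr b hb] at hc
    have := hG.le_of_le (by rw [hr b hb]; positivity) (by rw [hr b hb]; exact hL b hb) hc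
    linarith
  have hcont : Filter.Tendsto (fun k : ℕ => Real.exp (b - (b - a) / ((k : ℝ) + 1)))
      Filter.atTop (nhds (Real.exp (b - 0))) := by
    refine (Real.continuous_exp.tendsto _).comp (tendsto_const_nhds.sub ?_)
    have := (tendsto_one_div_add_atTop_nhds_zero_nat (𝕜 := ℝ)).const_mul (b - a)
    simpa [div_eq_mul_inv] using this
  rw [sub_zero] at hcont
  obtain ⟨k, hk⟩ := (hcont.eventually (lt_mem_nhds hlt)).exists
  set h := (b - a) / ((k : ℝ) + 1) with hh
  have hpos : 0 < h := by have : 0 < b - a := by linarith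
                          positivity
  have e1 : a + ((k + 1 : ℕ) : ℝ) * h = b := by
    push_cast
    rw [hh]; field_simp; ring
  have h3 := key h hpos (k + 1) (by rw [e1]; exact hb)
  rw [e1] at h3
  have h4 : r b - ε ≤ r (b - h) := by
    by_contra hc
    push Not at hc
    have := hG.mono hc.le
    rw [hr _ (by linarith)] at this
    linarith
  have h5 : r (a - h) ≤ r a := by
    refine hG.le_of_le ?_ ?_ ?_ <;> rw [hr _ (by linarith)]
    · positivity
    · exact hL _ (by linarith)
    · rw [hr _ (by linarith)]
      exact Real.exp_le_exp.2 (by linarith)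
  linarith

theorem cum_shift {V : ℝ} (hV : 0 < V) {F G H : ℝ → ℝ} (hF : IsCum V F) (hG : IsCum V G)
    (hH : IsCum V H) (hlow : ∀ a b, F a * G b ≤ H ((a + b) / 2) ^ 2)
    (hup : ∀ a b, (V - F a) * (V - G b) ≤ (V - H ((a + b) / 2)) ^ 2) :
    ∃ c, ∀ x, F x = G (x - c) := by
  have hL : ∀ s < Real.log V, Real.exp s < V := fun s hs => by
    rwa [← Real.lt_log_iff_exp_lt hV]
  have h1 : ∀ s, ∃ x, s < Real.log V → F x = Real.exp s := fun s => by
    by_cases hs : s < Real.log V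
    · obtain ⟨x, hx⟩ := hF.exists_quantile (Real.exp_pos s) (hL s hs)
      exact ⟨x, fun _ => hx⟩
    · exact ⟨0, fun h => absurd h hs⟩
  have h2 : ∀ s, ∃ x, s < Real.log V → G x = Real.exp s := fun s => by
    by_cases hs : s < Real.log V
    · obtain ⟨x, hx⟩ := hG.exists_quantile (Real.exp_pos s) (hL s hs)
      exact ⟨x, fun _ => hx⟩
    · exact ⟨0, fun h => absurd h hs⟩
  choose p hp using h1
  choose r hr using h2
  have hm : ∀ s < Real.log V, H ((p s + r s) / 2) = Real.exp s := by
    intro s hs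
    have e1 := hlow (p s) (r s)
    have e2 := hup (p s) (r s)
    rw [hp s hs, hr s hs] at e1 e2
    have n1 := hH.nonneg ((p s + r s) / 2)
    have n2 := hH.le ((p s + r s) / 2)
    have n3 := hL s hs
    have n4 := Real.exp_pos s
    refine le_antisymm ?_ ?_
    · have := abs_le_of_sq_le_sq' (a := V - Real.exp s) (b := V - H ((p s + r s) / 2))
        (by linarith) (by linarith)
      linarith [this.2]
    · exact (abs_le_of_sq_le_sq' (by linarith) n1).2
  have hinc : ∀ s h, s + h < Real.log V → s - h < Real.log V → s < Real.log V →
      p s + r s ≤ p (s + h) + r (s - h) := by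
    intro s h h1 h2 h3
    have e1 := hlow (p (s + h)) (r (s - h))
    rw [hp _ h1, hr _ h2, ← Real.exp_add] at e1
    have e2 : Real.exp (s + h + (s - h)) = Real.exp s ^ 2 := by
      rw [← Real.exp_nat_mul]; congr 1; push_cast; ring
    rw [e2] at e1
    have e3 := (abs_le_of_sq_le_sq' e1 (hH.nonneg _)).2
    rw [← hm s h3] at e3
    have := hH.le_of_le (by rw [hm s h3]; positivity) (by rw [hm s h3]; exact hL s h3) e3
    linarith
  have hle : ∀ a b, a < b → b < Real.log V → p b - p a = r b - r a := by
    intro a b hab hb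
    refine le_antisymm ?_ ?_
    · refine quantile_incr (G := F) (r := p) (p := r) hF hL (fun s hs => hp s hs) ?_ hab hb
      intro s h h0 h1
      have := hinc s (-h) (by linarith) (by linarith) (by linarith)
      rw [sub_neg_eq_add, ← sub_eq_add_neg] at this
      linarith
    · refine quantile_incr (G := G) (r := r) (p := p) hG hL (fun s hs => hr s hs) ?_ hab hb
      intro s h h0 h1
      have := hinc s h (by linarith) (by linarith) (by linarith)
      linarith
  set s0 := Real.log V - 1
  have hc : ∀ s < Real.log V, p s = r s + (p s0 - r s0) := by
    intro s hs
    rcases lt_trichotomy s s0 with h | h | h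
    · have := hle s s0 h (by simp [s0]); linarith
    · rw [h]; ring
    · have := hle s0 s h hs; linarith
  have hz : ∀ z, 0 < z → z < V → ∃ x, G x = z ∧ F (x + (p s0 - r s0)) = z := by
    intro z h0 h1
    have hs : Real.log z < Real.log V := Real.log_lt_log h0 h1
    refine ⟨r (Real.log z), ?_, ?_⟩
    · rw [hr _ hs, Real.exp_log h0]
    · rw [← hc _ hs, hp _ hs, Real.exp_log h0]
  refine ⟨p s0 - r s0, fun x => ?_⟩
  set c := p s0 - r s0
  by_contra hne
  rcases lt_or_gt_of_ne hne with h | h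
  · obtain ⟨z, z1, z2⟩ := exists_between h
    obtain ⟨y, y1, y2⟩ := hz z ((hF.nonneg x).trans_lt z1) (z2.trans_le (hG.le _))
    have : x ≤ y + c := by
      by_contra hc; push Not at hc
      have := hF.mono hc.le; linarith
    have := hG.mono (show x - c ≤ y by linarith)
    linarith
  · obtain ⟨z, z1, z2⟩ := exists_between h
    obtain ⟨y, y1, y2⟩ := hz z ((hG.nonneg _).trans_lt z1) (z2.trans_le (hF.le _))
    have : x - c ≤ y := by
      by_contra hc; push Not at hc
      have := hG.mono hc.le; linarith
    have := hF.mono (show x ≤ y + c by linarith)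
    linarith

end oneDim

section cumulative

variable {m : ℕ}

/-- Cumulative volume of `K` in direction `u`. -/
noncomputable def cumV (K : Set (EuclideanSpace ℝ (Fin (m + 1))))
    (u : EuclideanSpace ℝ (Fin (m + 1))) (s : ℝ) : ℝ :=
  (volume (K ∩ {x | ⟪x, u⟫ ≤ s})).toReal

theorem level_null_s8 {u : EuclideanSpace ℝ (Fin (m + 1))} (hu : ‖u‖ = 1) (s : ℝ) :
    volume {x : EuclideanSpace ℝ (Fin (m + 1)) | ⟪x, u⟫ = s} = 0 := by
  have h0 : u ≠ 0 := by rintro rfl; simp at hu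
  rw [← hyperplane_null h0, ← measure_preimage_add_right volume (-(s • u)) {x | ⟪u, x⟫ = 0}]
  congr 1
  ext x
  simp only [Set.mem_preimage, Set.mem_ofPred_eq, inner_add_right, inner_neg_right,
    real_inner_smul_right, real_inner_self_eq_norm_sq, hu, real_inner_comm]
  constructor <;> intro h <;> linarith

theorem meas_le (u : EuclideanSpace ℝ (Fin (m + 1))) (s : ℝ) :
    MeasurableSet {x : EuclideanSpace ℝ (Fin (m + 1)) | ⟪x, u⟫ ≤ s} :=
  (isClosed_le (by fun_prop) (by fun_prop)).measurableSet

theorem upper_cum {K : Set (EuclideanSpace ℝ (Fin (m + 1)))} (hK : IsCompact K)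
    (u : EuclideanSpace ℝ (Fin (m + 1))) (s : ℝ) :
    (volume (K ∩ {x | s < ⟪x, u⟫})).toReal = (volume K).toReal - cumV K u s := by
  have h := measure_inter_add_sdiff (μ := volume) K (meas_le u s)
  have e : K \ {x | ⟪x, u⟫ ≤ s} = K ∩ {x | s < ⟪x, u⟫} := by
    ext x; simp
  rw [e] at h
  rw [← h, ENNReal.toReal_add, cumV]
  · ring
  · exact (measure_mono Set.inter_subset_left).trans_lt hK.measure_lt_top |>.ne
  · exact (measure_mono Set.inter_subset_left).trans_lt hK.measure_lt_top |>.ne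

theorem subset_closure_interior {K : Set (EuclideanSpace ℝ (Fin (m + 1)))}
    (hc : Convex ℝ K) (hi : (interior K).Nonempty) : K ⊆ closure (interior K) := by
  rw [hc.closure_interior_eq_closure_of_nonempty_interior hi]
  exact subset_closure

theorem exists_interior_gt {K : Set (EuclideanSpace ℝ (Fin (m + 1)))}
    (hc : Convex ℝ K) (hi : (interior K).Nonempty) {u : EuclideanSpace ℝ (Fin (m + 1))} {s : ℝ}
    {y : EuclideanSpace ℝ (Fin (m + 1))} (hy : y ∈ K) (hs : s < ⟪y, u⟫) :
    ∃ x ∈ interior K, s < ⟪x, u⟫ := by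
  by_contra h
  push Not at h
  have h1 : closure (interior K) ⊆ {x | ⟪x, u⟫ ≤ s} :=
    closure_minimal h (isClosed_le (by fun_prop) (by fun_prop))
  have := h1 (subset_closure_interior hc hi hy)
  simp only [Set.mem_ofPred_eq] at this
  linarith

theorem cum_le_of_full {K : Set (EuclideanSpace ℝ (Fin (m + 1)))} (hK : IsCompact K)
    (hc : Convex ℝ K) (hi : (interior K).Nonempty) {u : EuclideanSpace ℝ (Fin (m + 1))} {s : ℝ}
    (h : cumV K u s = (volume K).toReal) {y : EuclideanSpace ℝ (Fin (m + 1))} (hy : y ∈ K) :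
    ⟪y, u⟫ ≤ s := by
  by_contra hs
  push Not at hs
  obtain ⟨x, hx, hxs⟩ := exists_interior_gt hc hi hy hs
  have h1 := upper_cum hK u s
  rw [h, sub_self] at h1
  have h2 : 0 < volume (interior K ∩ {x | s < ⟪x, u⟫}) :=
    (isOpen_interior.inter (isOpen_lt (by fun_prop) (by fun_prop))).measure_pos _ ⟨x, hx, hxs⟩
  have h3 := h2.trans_le (measure_mono (Set.inter_subset_inter_left _ interior_subset))
  have h4 := ENNReal.toReal_pos h3.ne'
    ((measure_mono Set.inter_subset_left).trans_lt hK.measure_lt_top).ne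
  linarith

theorem cum_mono {K : Set (EuclideanSpace ℝ (Fin (m + 1)))} (hK : IsCompact K)
    (u : EuclideanSpace ℝ (Fin (m + 1))) : Monotone (cumV K u) := by
  intro s t hst
  refine ENNReal.toReal_mono
    ((measure_mono Set.inter_subset_left).trans_lt hK.measure_lt_top).ne (measure_mono ?_)
  rintro x ⟨h1, h2⟩
  exact ⟨h1, le_trans h2 hst⟩

theorem map_Iic {K : Set (EuclideanSpace ℝ (Fin (m + 1)))} 
    (u : EuclideanSpace ℝ (Fin (m + 1))) (s : ℝ) :
    (Measure.map (fun x => ⟪x, u⟫) (volume.restrict K)) (Set.Iic s) =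
      volume (K ∩ {x | ⟪x, u⟫ ≤ s}) := by
  rw [Measure.map_apply (by fun_prop) measurableSet_Iic]
  have e : (fun x : EuclideanSpace ℝ (Fin (m + 1)) => ⟪x, u⟫) ⁻¹' Set.Iic s
      = {x | ⟪x, u⟫ ≤ s} := rfl
  rw [e, Measure.restrict_apply (meas_le u s), Set.inter_comm]

theorem cum_cont {K : Set (EuclideanSpace ℝ (Fin (m + 1)))} (hK : IsCompact K)
    {u : EuclideanSpace ℝ (Fin (m + 1))} (hu : ‖u‖ = 1) : Continuous (cumV K u) := by
  have : IsFiniteMeasure ((volume : Measure (EuclideanSpace ℝ (Fin (m + 1)))).restrict K) :=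
    ⟨by simpa using hK.measure_lt_top⟩
  set μ := Measure.map (fun x => ⟪x, u⟫) (volume.restrict K) with hμ
  have : IsFiniteMeasure μ := Measure.isFiniteMeasure_map _ _
  have : NullSingletonClass μ := ⟨fun s => by
    rw [hμ, Measure.map_apply (by fun_prop) (measurableSet_singleton s)]
    exact measure_mono_null (fun x hx => hx) (Measure.absolutelyContinuous_of_le
      Measure.restrict_le_self (level_null_s8 hu s))⟩
  have h1 : ∀ s, cumV K u s = ∫ x in Set.Iic s, (1 : ℝ) ∂μ := by
    intro s
    rw [setIntegral_const, smul_eq_mul, mul_one, Measure.real, map_Iic]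
    rfl
  have h2 : ∀ s, cumV K u s = (∫ x in (0 : ℝ)..s, (1 : ℝ) ∂μ) + cumV K u 0 := by
    intro s
    rw [h1, h1, ← intervalIntegral.integral_Iic_sub_Iic (integrable_const _).integrableOn
      (integrable_const _).integrableOn]
    ring
  have h3 : cumV K u = fun s => (∫ x in (0 : ℝ)..s, (1 : ℝ) ∂μ) + cumV K u 0 := funext h2
  rw [h3]
  refine Continuous.add (intervalIntegral.continuous_primitive (fun a b => ?_) 0) continuous_const
  exact intervalIntegrable_const

theorem cum_isCum {K : Set (EuclideanSpace ℝ (Fin (m + 1)))} (hK : IsCompact K)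
    (hc : Convex ℝ K) (hi : (interior K).Nonempty) {u : EuclideanSpace ℝ (Fin (m + 1))}
    (hu : ‖u‖ = 1) : IsCum (volume K).toReal (cumV K u) where
  mono := cum_mono hK u
  cont := cum_cont hK hu
  lo := by
    obtain ⟨b, hb⟩ := (hK.image (f := fun x => ⟪x, u⟫) (by fun_prop)).bddBelow
    refine ⟨b - 1, ?_⟩
    have : K ∩ {x | ⟪x, u⟫ ≤ b - 1} = ∅ := by
      ext x
      simp only [Set.mem_inter_iff, Set.mem_ofPred_eq, Set.mem_empty_iff_false, iff_false]
      rintro ⟨h1, h2⟩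
      have := hb ⟨x, h1, rfl⟩
      simp only at this
      linarith
    simp [cumV, this]
  hi := by
    obtain ⟨b, hb⟩ := (hK.image (f := fun x => ⟪x, u⟫) (by fun_prop)).bddAbove
    refine ⟨b, ?_⟩
    have : K ∩ {x | ⟪x, u⟫ ≤ b} = K :=
      Set.inter_eq_left.2 fun x hx => hb ⟨x, hx, rfl⟩
    rw [cumV, this]
  nonneg := fun x => ENNReal.toReal_nonneg
  le := fun x => ENNReal.toReal_mono hK.measure_lt_top.ne (measure_mono Set.inter_subset_left)
  strict := by
    intro x y hxy h0 h1
    obtain ⟨a, ha, hax⟩ : ∃ a ∈ interior K, ⟪a, u⟫ ≤ x := by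
      by_contra h
      push Not at h
      have h1 : closure (interior K) ⊆ {z | x ≤ ⟪z, u⟫} :=
        closure_minimal (fun z hz => (h z hz).le) (isClosed_le (by fun_prop) (by fun_prop))
      have h2 : volume (K ∩ {z | ⟪z, u⟫ ≤ x}) = 0 := by
        refine measure_mono_null ?_ (level_null_s8 hu x)
        rintro z ⟨hz, hz2⟩
        exact le_antisymm hz2 (h1 (subset_closure_interior hc hi hz))
      simp [cumV, h2] at h0
    obtain ⟨b, hb, hbx⟩ : ∃ b ∈ interior K, x < ⟪b, u⟫ := by
      by_contra h
      push Not at h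
      refine h1.ne ?_
      have h1 : closure (interior K) ⊆ {z | ⟪z, u⟫ ≤ x} :=
        closure_minimal h (isClosed_le (by fun_prop) (by fun_prop))
      rw [cumV, Set.inter_eq_left.2 ((subset_closure_interior hc hi).trans h1)]
    obtain ⟨v, hv1, hv2⟩ := exists_between (lt_min hxy hbx)
    have hpre : IsPreconnected ((fun z => ⟪z, u⟫) '' interior K) :=
      hc.interior.isPreconnected.image _ (by fun_prop)
    obtain ⟨w, hw, hwv⟩ := hpre.ordConnected.out ⟨a, ha, rfl⟩ ⟨b, hb, rfl⟩
      ⟨hax.trans hv1.le, (hv2.trans_le (min_le_right _ _)).le⟩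
    simp only at hwv
    have hpos : 0 < volume (interior K ∩ {z | x < ⟪z, u⟫} ∩ {z | ⟪z, u⟫ < y}) := by
      refine ((isOpen_interior.inter (isOpen_lt (by fun_prop) (by fun_prop))).inter
        (isOpen_lt (by fun_prop) (by fun_prop))).measure_pos _ ⟨w, ⟨hw, ?_⟩, ?_⟩
      · simpa [hwv] using hv1
      · simpa [hwv] using hv2.trans_le (min_le_left _ _)
    have hd := measure_union (μ := volume) (s₁ := interior K ∩ {z | x < ⟪z, u⟫} ∩ {z | ⟪z, u⟫ < y})
      (s₂ := K ∩ {z | ⟪z, u⟫ ≤ x}) (by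
        rw [Set.disjoint_left]
        rintro z ⟨⟨_, h1⟩, _⟩ ⟨_, h2⟩
        simp only [Set.mem_ofPred_eq] at h1 h2
        linarith) (hK.measurableSet.inter (meas_le u x))
    have hf1 : volume (K ∩ {z | ⟪z, u⟫ ≤ y}) ≠ ⊤ :=
      ((measure_mono Set.inter_subset_left).trans_lt hK.measure_lt_top).ne
    have hf2 : volume (K ∩ {z | ⟪z, u⟫ ≤ x}) ≠ ⊤ :=
      ((measure_mono Set.inter_subset_left).trans_lt hK.measure_lt_top).ne
    refine (ENNReal.toReal_lt_toReal hf2 hf1).2 ?_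
    calc volume (K ∩ {z | ⟪z, u⟫ ≤ x}) < _ := (ENNReal.lt_add_right hf2 hpos.ne')
      _ = _ := add_comm _ _
      _ = _ := hd.symm
      _ ≤ _ := by
        refine measure_mono ?_
        rintro z (⟨⟨h1, h2⟩, h3⟩ | ⟨h1, h2⟩)
        · exact ⟨interior_subset h1, le_of_lt (show ⟪z, u⟫ < y from h3)⟩
        · exact ⟨h1, le_trans h2 hxy.le⟩

theorem bm_real {A B C : Set (EuclideanSpace ℝ (Fin (m + 1)))} (hA : MeasurableSet A)
    (hB : MeasurableSet B) (hC : MeasurableSet C) (hCf : volume C ≠ ⊤)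
    (h : ∀ x ∈ A, ∀ y ∈ B, (2⁻¹ : ℝ) • (x + y) ∈ C) :
    (volume A).toReal * (volume B).toReal ≤ (volume C).toReal ^ 2 := by
  rw [← ENNReal.toReal_mul, ← ENNReal.toReal_pow]
  exact ENNReal.toReal_mono (ENNReal.pow_ne_top hCf) (bm_half hA hB hC h)

theorem shift_exists {P Q : Set (EuclideanSpace ℝ (Fin (m + 1)))}
    (hP : IsCompact P) (hPc : Convex ℝ P) (hPi : (interior P).Nonempty)
    (hQ : IsCompact Q) (hQc : Convex ℝ Q) (hQi : (interior Q).Nonempty)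
    (hMi : (interior ((2⁻¹ : ℝ) • (P + Q))).Nonempty)
    (hv : (volume Q).toReal = (volume P).toReal)
    (hvM : (volume ((2⁻¹ : ℝ) • (P + Q))).toReal = (volume P).toReal)
    {u : EuclideanSpace ℝ (Fin (m + 1))} (hu : ‖u‖ = 1) :
    ∃ c, ∀ x, cumV P u x = cumV Q u (x - c) := by
  set M := (2⁻¹ : ℝ) • (P + Q) with hM
  have hMc : IsCompact M := (hP.add hQ).smul _
  have hMconv : Convex ℝ M := (hPc.add hQc).smul _
  have hmem : ∀ x ∈ P, ∀ y ∈ Q, (2⁻¹ : ℝ) • (x + y) ∈ M := fun x hx y hy =>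
    Set.smul_mem_smul_set (Set.add_mem_add hx hy)
  have mlt : ∀ s, MeasurableSet {x : EuclideanSpace ℝ (Fin (m + 1)) | s < ⟪x, u⟫} := fun s =>
    (isOpen_lt (by fun_prop) (by fun_prop)).measurableSet
  have hVpos : 0 < (volume P).toReal :=
    ENNReal.toReal_pos ((isOpen_interior.measure_pos volume hPi).trans_le
      (measure_mono interior_subset)).ne' hP.measure_lt_top.ne
  refine cum_shift hVpos (cum_isCum hP hPc hPi hu) (hv ▸ cum_isCum hQ hQc hQi hu)
    (hvM ▸ cum_isCum hMc hMconv hMi hu) ?_ ?_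
  · intro a b
    refine bm_real (hP.measurableSet.inter (meas_le u a)) (hQ.measurableSet.inter (meas_le u b))
      (hMc.measurableSet.inter (meas_le u _))
      ((measure_mono Set.inter_subset_left).trans_lt hMc.measure_lt_top).ne ?_
    rintro x ⟨hx, hxa⟩ y ⟨hy, hyb⟩
    refine ⟨hmem x hx y hy, ?_⟩
    simp only [Set.mem_ofPred_eq, real_inner_smul_left, inner_add_left] at *
    linarith
  · intro a b
    have e1 := upper_cum hP u a
    have e2 := upper_cum hQ u b
    have e3 := upper_cum hMc u ((a + b) / 2)
    rw [hv] at e2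
    rw [hvM] at e3
    rw [← e1, ← e2, ← e3]
    refine bm_real (hP.measurableSet.inter (mlt a)) (hQ.measurableSet.inter (mlt b))
      (hMc.measurableSet.inter (mlt _))
      ((measure_mono Set.inter_subset_left).trans_lt hMc.measure_lt_top).ne ?_
    rintro x ⟨hx, hxa⟩ y ⟨hy, hyb⟩
    refine ⟨hmem x hx y hy, ?_⟩
    simp only [Set.mem_ofPred_eq, real_inner_smul_left, inner_add_left] at *
    linarith

theorem shift_eq {P Q : Set (EuclideanSpace ℝ (Fin (m + 1)))}
    (hP : IsCompact P) (hQ : IsCompact Q) 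
    (hv : (volume Q).toReal = (volume P).toReal)
    {u : EuclideanSpace ℝ (Fin (m + 1))} {c : ℝ}
    (h : ∀ x, cumV P u x = cumV Q u (x - c)) :
    ⟪∫ x in P, x, u⟫ = ⟪∫ x in Q, x, u⟫ + (volume P).toReal * c := by
  have : IsFiniteMeasure ((volume : Measure (EuclideanSpace ℝ (Fin (m + 1)))).restrict P) :=
    ⟨by simpa using hP.measure_lt_top⟩
  have : IsFiniteMeasure ((volume : Measure (EuclideanSpace ℝ (Fin (m + 1)))).restrict Q) :=
    ⟨by simpa using hQ.measure_lt_top⟩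
  have iP : IntegrableOn (fun x : EuclideanSpace ℝ (Fin (m + 1)) => x) P :=
    continuous_id.continuousOn.integrableOn_compact hP
  have iQ : IntegrableOn (fun x : EuclideanSpace ℝ (Fin (m + 1)) => x) Q :=
    continuous_id.continuousOn.integrableOn_compact hQ
  have iQ2 : IntegrableOn (fun x : EuclideanSpace ℝ (Fin (m + 1)) => ⟪x, u⟫) Q :=
    ContinuousOn.integrableOn_compact hQ (by fun_prop)
  have hmeas : Measure.map (fun x => ⟪x, u⟫) (volume.restrict P) =
      Measure.map (fun x => ⟪x, u⟫ + c) (volume.restrict Q) := by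
    have : IsFiniteMeasure (Measure.map (fun x => ⟪x, u⟫)
      ((volume : Measure (EuclideanSpace ℝ (Fin (m + 1)))).restrict P)) :=
      Measure.isFiniteMeasure_map _ _
    refine Measure.ext_of_Iic _ _ fun s => ?_
    rw [map_Iic, Measure.map_apply (by fun_prop) measurableSet_Iic]
    have e : (fun x : EuclideanSpace ℝ (Fin (m + 1)) => ⟪x, u⟫ + c) ⁻¹' Set.Iic s
        = {x | ⟪x, u⟫ ≤ s - c} := by
      ext x; simp [le_sub_iff_add_le]
    rw [e, Measure.restrict_apply (meas_le _ _), Set.inter_comm _ Q]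
    exact (ENNReal.toReal_eq_toReal_iff'
      ((measure_mono Set.inter_subset_left).trans_lt hP.measure_lt_top).ne
      ((measure_mono Set.inter_subset_left).trans_lt hQ.measure_lt_top).ne).1 (h s)
  have h1 : ∫ x in P, ⟪x, u⟫ = ∫ x in Q, (⟪x, u⟫ + c) := by
    have a1 := integral_map (μ := volume.restrict P)
      (φ := fun x : EuclideanSpace ℝ (Fin (m + 1)) => ⟪x, u⟫)
      (f := fun t : ℝ => t) (by fun_prop) (by fun_prop)
    have a2 := integral_map (μ := volume.restrict Q)
      (φ := fun x : EuclideanSpace ℝ (Fin (m + 1)) => ⟪x, u⟫ + c)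
      (f := fun t : ℝ => t) (by fun_prop) (by fun_prop)
    rw [← a1, ← a2, hmeas]
  rw [integral_add iQ2 (integrable_const _), setIntegral_const] at h1
  have i1 : ⟪∫ x in P, x, u⟫ = ∫ x in P, ⟪x, u⟫ := by
    rw [real_inner_comm, ← integral_inner (𝕜 := ℝ) iP u]
    exact integral_congr_ae (.of_forall fun x => real_inner_comm _ _)
  have i2 : ⟪∫ x in Q, x, u⟫ = ∫ x in Q, ⟪x, u⟫ := by
    rw [real_inner_comm, ← integral_inner (𝕜 := ℝ) iQ u]
    exact integral_congr_ae (.of_forall fun x => real_inner_comm _ _)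
  rw [i1, i2, h1, smul_eq_mul, Measure.real, hv]

theorem shift_subset {P Q : Set (EuclideanSpace ℝ (Fin (m + 1)))}
    (hP : IsCompact P) (hPc : Convex ℝ P) 
    (hQ : IsCompact Q) (hQc : Convex ℝ Q) (hQi : (interior Q).Nonempty)
    (hv : (volume Q).toReal = (volume P).toReal)
    {t : EuclideanSpace ℝ (Fin (m + 1))}
    (h : ∀ u : EuclideanSpace ℝ (Fin (m + 1)), ‖u‖ = 1 →
      ∀ x, cumV P u x = cumV Q u (x + ⟪t, u⟫)) {y : EuclideanSpace ℝ (Fin (m + 1))} (hy : y ∈ Q) :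
    y - t ∈ P := by
  by_contra hn
  obtain ⟨f, s, hf1, hf2⟩ := geometric_hahn_banach_closed_point hPc hP.isClosed hn
  set w := (InnerProductSpace.toDual ℝ (EuclideanSpace ℝ (Fin (m + 1)))).symm f with hw
  have hfw : ∀ x, f x = ⟪x, w⟫ := fun x => by
    rw [real_inner_comm, hw, InnerProductSpace.toDual_symm_apply]
  have hPne : P.Nonempty := by
    by_contra he
    rw [Set.not_nonempty_iff_eq_empty] at he
    have : 0 < (volume Q).toReal :=
      ENNReal.toReal_pos ((isOpen_interior.measure_pos volume hQi).trans_le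
        (measure_mono interior_subset)).ne' hQ.measure_lt_top.ne
    rw [hv, he] at this
    simp at this
  have hw0 : w ≠ 0 := by
    intro h0
    obtain ⟨x, hx⟩ := hPne
    have h1 := hf1 x hx
    rw [hfw, h0, inner_zero_right] at h1 hf2
    linarith
  have hwn : 0 < ‖w‖ := norm_pos_iff.2 hw0
  set u := ‖w‖⁻¹ • w with hu
  have hun : ‖u‖ = 1 := by rw [hu, norm_smul, norm_inv, norm_norm, inv_mul_cancel₀ hwn.ne']
  have hiu : ∀ x, ⟪x, u⟫ = ‖w‖⁻¹ * f x := fun x => by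
    rw [hu, real_inner_smul_right, hfw]
  have hfull : cumV P u (‖w‖⁻¹ * s) = (volume P).toReal := by
    rw [cumV, Set.inter_eq_left.2]
    intro x hx
    simp only [Set.mem_ofPred_eq, hiu]
    exact mul_le_mul_of_nonneg_left (hf1 x hx).le (by positivity)
  rw [h u hun, ← hv] at hfull
  have h3 := cum_le_of_full hQ hQc hQi hfull hy
  have h4 : ⟪y - t, u⟫ ≤ ‖w‖⁻¹ * s := by rw [inner_sub_left]; linarith
  rw [hiu] at h4
  have := mul_lt_mul_of_pos_left hf2 (inv_pos.2 hwn)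
  linarith

theorem equality_case {P Q : Set (EuclideanSpace ℝ (Fin (m + 1)))}
    (hP : IsCompact P) (hPc : Convex ℝ P) (hPi : (interior P).Nonempty)
    (hQ : IsCompact Q) (hQc : Convex ℝ Q) (hQi : (interior Q).Nonempty)
    (hMi : (interior ((2⁻¹ : ℝ) • (P + Q))).Nonempty)
    (hv : (volume Q).toReal = (volume P).toReal)
    (hvM : (volume ((2⁻¹ : ℝ) • (P + Q))).toReal = (volume P).toReal) :
    ∃ t, Q = (fun x => t + x) '' P := by
  have hVpos : 0 < (volume P).toReal :=
    ENNReal.toReal_pos ((isOpen_interior.measure_pos volume hPi).trans_le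
      (measure_mono interior_subset)).ne' hP.measure_lt_top.ne
  set t := ((volume P).toReal)⁻¹ • ((∫ x in Q, x) - ∫ x in P, x) with ht
  have key : ∀ u : EuclideanSpace ℝ (Fin (m + 1)), ‖u‖ = 1 →
      ∀ x, cumV P u x = cumV Q u (x + ⟪t, u⟫) := by
    intro u hu x
    obtain ⟨c, hc⟩ := shift_exists hP hPc hPi hQ hQc hQi hMi hv hvM hu
    have h1 := shift_eq hP hQ hv hc
    have h2 : ⟪t, u⟫ = -c := by
      rw [ht, real_inner_smul_left, inner_sub_left, h1]
      field_simp
      ring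
    rw [hc, h2, sub_eq_add_neg]
  refine ⟨t, Set.Subset.antisymm ?_ ?_⟩
  · intro y hy
    exact ⟨y - t, shift_subset hP hPc hQ hQc hQi hv key hy, by simp⟩
  · rintro _ ⟨x, hx, rfl⟩
    have := shift_subset (t := -t) hQ hQc hP hPc hPi hv.symm (fun u hu s => by
      rw [key u hu]; congr 1; rw [inner_neg_left]; ring) hx
    simpa [add_comm] using this

end cumulative

section final

theorem suppFn_translate {n : ℕ} {K : Set (EuclideanSpace ℝ (Fin n))} (hK : IsCompact K)
    (hne : K.Nonempty) (t u : EuclideanSpace ℝ (Fin n)) :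
    suppFn ((fun x => t + x) '' K) u = ⟪t, u⟫ + suppFn K u := by
  have hc : IsCompact ((fun x => t + x) '' K) := hK.image (by fun_prop)
  refine le_antisymm ?_ ?_
  · refine suppFn_le (hne.image _) ?_
    rintro _ ⟨x, hx, rfl⟩
    simp only
    rw [inner_add_left]
    have := le_suppFn hK hx u
    linarith
  · have : suppFn K u ≤ suppFn ((fun x => t + x) '' K) u - ⟪t, u⟫ := by
      refine suppFn_le hne fun x hx => ?_
      have := le_suppFn hc ⟨x, hx, rfl⟩ u
      simp only [inner_add_left] at this
      linarith
    linarith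

theorem face_translate {n : ℕ} {K : Set (EuclideanSpace ℝ (Fin n))} (hK : IsCompact K)
    (hne : K.Nonempty) (t u : EuclideanSpace ℝ (Fin n)) :
    face ((fun x => t + x) '' K) u = (fun x => t + x) '' face K u := by
  ext y
  simp only [face, Set.mem_ofPred_eq, suppFn_translate hK hne]
  constructor
  · rintro ⟨⟨x, hx, rfl⟩, h⟩
    simp only [inner_add_left] at h
    exact ⟨x, ⟨hx, by linarith⟩, rfl⟩
  · rintro ⟨x, ⟨hx, h⟩, rfl⟩
    refine ⟨⟨x, hx, rfl⟩, ?_⟩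
    simp only [inner_add_left, h]

theorem hausdorff_translate {n : ℕ} (d : ℝ) (A : Set (EuclideanSpace ℝ (Fin n)))
    (t : EuclideanSpace ℝ (Fin n)) : μH[d] ((fun x => t + x) '' A) = μH[d] A :=
  (IsometryEquiv.addLeft t).hausdorffMeasure_image d A

/-- The theorem for polytopes with the origin in the interior. -/
theorem minkowski_centered {m : ℕ} (hm : 1 ≤ m)
    (P Q : Set (EuclideanSpace ℝ (Fin (m + 1))))
    (SP SQ : Finset (EuclideanSpace ℝ (Fin (m + 1))))
    (hP : P = convexHull ℝ (SP : Set (EuclideanSpace ℝ (Fin (m + 1)))))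
    (hQ : Q = convexHull ℝ (SQ : Set (EuclideanSpace ℝ (Fin (m + 1)))))
    (hP0 : (0 : EuclideanSpace ℝ (Fin (m + 1))) ∈ interior P)
    (hQ0 : (0 : EuclideanSpace ℝ (Fin (m + 1))) ∈ interior Q)
    (hfaces : ∀ u : EuclideanSpace ℝ (Fin (m + 1)), ‖u‖ = 1 →
      μH[(m : ℝ)] (face P u) = μH[(m : ℝ)] (face Q u)) :
    ∃ t : EuclideanSpace ℝ (Fin (m + 1)), Q = (fun x => t + x) '' P := by
  classical
  have hPc : IsCompact P := hP ▸ SP.finite_toSet.isCompact_convexHull (𝕜 := ℝ)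
  have hQc : IsCompact Q := hQ ▸ SQ.finite_toSet.isCompact_convexHull (𝕜 := ℝ)
  have hPv : Convex ℝ P := hP ▸ convex_convexHull ℝ _
  have hQv : Convex ℝ Q := hQ ▸ convex_convexHull ℝ _
  obtain ⟨c, hc0, hct, hc⟩ := hausdorff_face m
  have har : ∀ u : EuclideanSpace ℝ (Fin (m + 1)), ‖u‖ = 1 → ar P u = ar Q u := by
    intro u hu
    have := hfaces u hu
    rw [hc P u hu, hc Q u hu] at this
    exact (ENNReal.mul_right_inj hc0 hct).1 this
  obtain ⟨U1, hU1, hU1'⟩ := exists_hrep SP P hP hP0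
  obtain ⟨U2, hU2, hU2'⟩ := exists_hrep SQ Q hQ hQ0
  have hl1 := vol_le hm hPc hPv hP0 hU1 hU1' hQc hQv hQ0 (fun u hu => har u (hU1 u hu))
  have hl2 := vol_le hm hQc hQv hQ0 hU2 hU2' hPc hPv hP0 (fun u hu => (har u (hU2 u hu)).symm)
  have hvol : (volume P).toReal = (volume Q).toReal := le_antisymm hl1 hl2
  have hmid := vol_mid_le hPc hPv hP0 hU1 hU1' hQc hQv hQ0 (fun u hu => har u (hU1 u hu)) hvol
  have hMc : IsCompact ((2⁻¹ : ℝ) • (P + Q)) := (hPc.add hQc).smul _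
  have hbm := bm_real hPc.measurableSet hQc.measurableSet hMc.measurableSet
    hMc.measure_lt_top.ne (fun x hx y hy => Set.smul_mem_smul_set (Set.add_mem_add hx hy))
  rw [← hvol, ← sq] at hbm
  have hge := (abs_le_of_sq_le_sq' hbm ENNReal.toReal_nonneg).2
  refine equality_case hPc hPv ⟨0, hP0⟩ hQc hQv ⟨0, hQ0⟩ ?_ hvol.symm (le_antisymm hmid hge)
  have hop : IsOpen ((2⁻¹ : ℝ) • interior P) := isOpen_interior.smul₀ (by norm_num)
  refine ⟨0, interior_maximal ?_ hop ⟨0, hP0, by simp⟩⟩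
  rintro _ ⟨x, hx, rfl⟩
  exact ⟨x, ⟨x, interior_subset hx, 0, interior_subset hQ0, by simp⟩, rfl⟩

theorem translate_hull {n : ℕ} {P : Set (EuclideanSpace ℝ (Fin n))}
    (S : Finset (EuclideanSpace ℝ (Fin n)))
    (hP : P = convexHull ℝ (S : Set (EuclideanSpace ℝ (Fin n)))) (t : EuclideanSpace ℝ (Fin n)) :
    ∃ S' : Finset (EuclideanSpace ℝ (Fin n)),
      (fun x => t + x) '' P = convexHull ℝ (S' : Set (EuclideanSpace ℝ (Fin n))) := by
  classical
  refine ⟨S.image (fun x => t + x), ?_⟩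
  rw [hP, Finset.coe_image]
  have := (AffineEquiv.constVAdd ℝ (EuclideanSpace ℝ (Fin n)) t).toAffineMap.image_convexHull
    (S : Set (EuclideanSpace ℝ (Fin n)))
  exact this

theorem translate_int {n : ℕ} {P : Set (EuclideanSpace ℝ (Fin n))}
    {p : EuclideanSpace ℝ (Fin n)} (hp : p ∈ interior P) :
    (0 : EuclideanSpace ℝ (Fin n)) ∈ interior ((fun x => -p + x) '' P) := by
  have h := (Homeomorph.addLeft (-p)).image_interior P
  have h2 : (0 : EuclideanSpace ℝ (Fin n)) ∈ (Homeomorph.addLeft (-p)) '' interior P :=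
    ⟨p, hp, by simp⟩
  rw [h] at h2
  exact h2

end final

/-- Minkowski's uniqueness theorem, polytopal case: two convex polytopes in `ℝⁿ` with nonempty
interior whose faces in every unit direction have equal `(n-1)`-dimensional Hausdorff measure
are translates of one another. -/
theorem minkowski_uniqueness_polytope (n : ℕ) (hn : 2 ≤ n)
    (P Q : Set (EuclideanSpace ℝ (Fin n)))
    (SP SQ : Finset (EuclideanSpace ℝ (Fin n)))
    (hP : P = convexHull ℝ (SP : Set (EuclideanSpace ℝ (Fin n))))
    (hQ : Q = convexHull ℝ (SQ : Set (EuclideanSpace ℝ (Fin n))))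
    (hPint : (interior P).Nonempty) (hQint : (interior Q).Nonempty)
    (hfaces : ∀ u : EuclideanSpace ℝ (Fin n), ‖u‖ = 1 →
      μH[(n : ℝ) - 1] (face P u) = μH[(n : ℝ) - 1] (face Q u)) :
    ∃ t : EuclideanSpace ℝ (Fin n), Q = (fun x => t + x) '' P := by
  obtain ⟨m, rfl⟩ : ∃ m, n = m + 1 := ⟨n - 1, by omega⟩
  have hd : (((m + 1 : ℕ) : ℝ) - 1) = m := by push_cast; ring
  rw [hd] at hfaces
  have hPc : IsCompact P := hP ▸ SP.finite_toSet.isCompact_convexHull (𝕜 := ℝ)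
  have hQc : IsCompact Q := hQ ▸ SQ.finite_toSet.isCompact_convexHull (𝕜 := ℝ)
  obtain ⟨p, hp⟩ := hPint
  obtain ⟨q, hq⟩ := hQint
  obtain ⟨SP', hSP⟩ := translate_hull SP hP (-p)
  obtain ⟨SQ', hSQ⟩ := translate_hull SQ hQ (-q)
  obtain ⟨t, ht⟩ := minkowski_centered (by omega) _ _ SP' SQ' hSP hSQ (translate_int hp)
    (translate_int hq) (fun u hu => by
      rw [face_translate hPc ⟨p, interior_subset hp⟩, face_translate hQc ⟨q, interior_subset hq⟩,
        hausdorff_translate, hausdorff_translate, hfaces u hu])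
  refine ⟨q + t - p, ?_⟩
  have h1 : Q = (fun x => q + x) '' ((fun x => -q + x) '' Q) := by
    rw [Set.image_image]; simp
  rw [h1, ht, Set.image_image, Set.image_image]
  refine Set.image_congr fun x _ => ?_
  abel
end
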